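/- arXiv:1602.02629 — 6 statements merged into one kernel-verified Lean document; each statement's English description precedes it below -/
import Mathlib

section
/- Let G be a graph, T ⊆ V(G), k' a positive integer, and 0 < α ≤ 1. If T is not (k',α)-well-linked in G, then there is a partition (A,B) of V(G) with |E(A,B)| < α · min(|A ∩ T|, |B ∩ T|, k'). -/
attribute [local instance] Classical.propDecidable

noncomputable section

variable {V : Type}

/-- The degree of a vertex `v` in the simple graph `G`. -/
def deg [Fintype V] (G : SimpleGraph V) (v : V) : ℕ :=
  (Finset.univ.filter (fun u => G.Adj v u)).card

/-- The boundary `Γ(C)` of a cluster `C`: the vertices of `C` having a neighbor outside `C`. -/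
def bdry (G : SimpleGraph V) (C : Finset V) : Finset V :=
  C.filter (fun v => ∃ u, u ∉ C ∧ G.Adj v u)

/-- The number of edges `|E(A,B)|` with one endpoint in `A` and the other in `B`
(for disjoint `A`, `B`). -/
def cutCard (G : SimpleGraph V) (A B : Finset V) : ℕ :=
  ((A ×ˢ B).filter (fun ab => G.Adj ab.1 ab.2)).card

/-- A flow in `G[C]` from `A` to `B`, in which every vertex of `A` sends exactly one
unit of flow, every vertex of `B` receives exactly one unit of flow, and the total
flow through any edge is at most `η`. -/
def HasUnitFlowIn (G : SimpleGraph V) (C A B : Finset V) (η : ℝ) : Prop :=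
  ∃ (P : Finset (Σ u v : V, G.Walk u v)) (f : (Σ u v : V, G.Walk u v) → ℝ),
    (∀ p ∈ P, 0 ≤ f p) ∧
    (∀ p ∈ P, p.1 ∈ A ∧ p.2.1 ∈ B) ∧
    (∀ p ∈ P, ∀ x ∈ p.2.2.support, x ∈ C) ∧
    (∀ a ∈ A, ∑ p ∈ P.filter (fun p => p.1 = a), f p = 1) ∧
    (∀ b ∈ B, ∑ p ∈ P.filter (fun p => p.2.1 = b), f p = 1) ∧
    (∀ e : Sym2 V, ∑ p ∈ P.filter (fun p => e ∈ p.2.2.edges), f p ≤ η)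

/-- `T` is `α`-well-linked in `G[C]`: every pair of disjoint equal-sized subsets of `T`
can be connected, one-to-one, by a flow of edge-congestion at most `1/α` inside `C`. -/
def WellLinkedIn (G : SimpleGraph V) (C T : Finset V) (α : ℝ) : Prop :=
  ∀ T' T'' : Finset V, T' ⊆ T → T'' ⊆ T → Disjoint T' T'' → T'.card = T''.card →
    HasUnitFlowIn G C T' T'' (1 / α)

/-- `T` is `(k',α)`-well-linked in `G[C]`. -/
def WellLinkedKIn (G : SimpleGraph V) (C T : Finset V) (k' : ℕ) (α : ℝ) : Prop :=
  ∀ T' T'' : Finset V, T' ⊆ T → T'' ⊆ T → Disjoint T' T'' → T'.card = T''.card →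
    T'.card ≤ k' → HasUnitFlowIn G C T' T'' (1 / α)

/-- `T` is `α`-well-linked in `G`. -/
def WellLinked [Fintype V] (G : SimpleGraph V) (T : Finset V) (α : ℝ) : Prop :=
  WellLinkedIn G Finset.univ T α

/-- There is a family of pairwise vertex-disjoint paths in `G`, one starting at each
vertex of `A`, each ending at a (necessarily distinct) vertex of `B`. -/
def NodeLinkedSets (G : SimpleGraph V) (A B : Finset V) : Prop :=
  ∃ P : Finset (Σ u v : V, G.Walk u v),
    (∀ p ∈ P, p.2.2.IsPath ∧ p.1 ∈ A ∧ p.2.1 ∈ B) ∧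
    (∀ a ∈ A, ∃ p ∈ P, p.1 = a) ∧
    (∀ p ∈ P, ∀ q ∈ P, p ≠ q → ∀ x ∈ p.2.2.support, x ∉ q.2.2.support)

/-- `T` is node-well-linked in `G`. -/
def NodeWellLinked (G : SimpleGraph V) (T : Finset V) : Prop :=
  ∀ T' T'' : Finset V, T' ⊆ T → T'' ⊆ T → Disjoint T' T'' → T'.card = T''.card →
    NodeLinkedSets G T' T''

/-- `(T₁, T₂)` are node-linked in `G`. -/
def NodeLinked (G : SimpleGraph V) (T₁ T₂ : Finset V) : Prop :=
  ∀ T' T'' : Finset V, T' ⊆ T₁ → T'' ⊆ T₂ → T'.card = T''.card → NodeLinkedSets G T' T''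

/-- `(A,B)` is a `ρ`-balanced cut of the cluster `C` with respect to the vertex set `Γ`. -/
def IsBalancedCut (Γ A B C : Finset V) (ρ : ℝ) : Prop :=
  A ∪ B = C ∧ Disjoint A B ∧
    ρ * (Γ.card : ℝ) ≤ ((A ∩ Γ).card : ℝ) ∧ ρ * (Γ.card : ℝ) ≤ ((B ∩ Γ).card : ℝ)


/-- Separation: infeasibility of a system over a compact convex set gives dual multipliers. -/
lemma sep_aux {S ι κ : Type} [Fintype ι] [Fintype κ] (X : Set (S → ℝ)) (hXc : Convex ℝ X)
    (hXk : IsCompact X) (P : Finset S) (M : ι → S → ℝ) (N : κ → S → ℝ) (r : ι → ℝ) (η : ℝ)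
    (hno : ¬ ∃ x ∈ X, (∀ i, ∑ p ∈ P, M i p * x p = r i) ∧ ∀ e, ∑ p ∈ P, N e p * x p ≤ η) :
    ∃ (z : ι → ℝ) (w : κ → ℝ), (∀ e, 0 ≤ w e) ∧ ∀ x ∈ X,
      ∑ i, z i * r i + η * ∑ e, w e <
        ∑ i, z i * (∑ p ∈ P, M i p * x p) + ∑ e, w e * (∑ p ∈ P, N e p * x p) := by
  let L : (S → ℝ) →ₗ[ℝ] (ι ⊕ κ → ℝ) :=
    { toFun := fun x => Sum.elim (fun i => ∑ p ∈ P, M i p * x p) (fun e => ∑ p ∈ P, N e p * x p)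
      map_add' := by
        intro x y
        ext j
        rcases j with i | e <;> simp [mul_add, Finset.sum_add_distrib]
      map_smul' := by
        intro c x
        ext j
        rcases j with i | e <;> simp [Finset.mul_sum, mul_left_comm] }
  have hLc : Continuous L := by
    apply continuous_pi
    intro j
    rcases j with i | e
    · change Continuous fun x : S → ℝ => ∑ p ∈ P, M i p * x p
      fun_prop
    · change Continuous fun x : S → ℝ => ∑ p ∈ P, N e p * x p
      fun_prop
  let K : Set (ι ⊕ κ → ℝ) := {y | (∀ i, y (Sum.inl i) = r i) ∧ ∀ e, y (Sum.inr e) ≤ η}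
  have hKc : Convex ℝ K := by
    intro x hx y hy a b ha hb hab
    refine ⟨fun i => ?_, fun e => ?_⟩
    · simp only [Pi.add_apply, Pi.smul_apply, smul_eq_mul, hx.1 i, hy.1 i]
      rw [← add_mul, hab, one_mul]
    · simp only [Pi.add_apply, Pi.smul_apply, smul_eq_mul]
      have h1 := mul_le_mul_of_nonneg_left (hx.2 e) ha
      have h2 := mul_le_mul_of_nonneg_left (hy.2 e) hb
      calc _ ≤ a * η + b * η := add_le_add h1 h2
        _ = η := by rw [← add_mul, hab, one_mul]
  have hKcl : IsClosed K := by
    have : K = (⋂ i, {y | y (Sum.inl i) = r i}) ∩ ⋂ e, {y | y (Sum.inr e) ≤ η} := by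
      ext y; simp [K]
    rw [this]
    refine IsClosed.inter (isClosed_iInter fun i => ?_) (isClosed_iInter fun e => ?_)
    · exact isClosed_eq (by fun_prop) (by fun_prop)
    · exact isClosed_le (by fun_prop) (by fun_prop)
  have hdis : Disjoint (L '' X) K := by
    rw [Set.disjoint_left]
    rintro _ ⟨x, hx, rfl⟩ hK
    exact hno ⟨x, hx, hK.1, hK.2⟩
  obtain ⟨f, u, v, h1, h2, h3⟩ := geometric_hahn_banach_compact_closed
    (hXc.is_linear_image L.isLinear) (hXk.image hLc) hKc hKcl hdis
  have hf : ∀ y : ι ⊕ κ → ℝ, f y = ∑ i, y (Sum.inl i) * f (Pi.single (Sum.inl i) 1)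
      + ∑ e, y (Sum.inr e) * f (Pi.single (Sum.inr e) 1) := by
    intro y
    have := LinearMap.pi_apply_eq_sum_univ f.toLinearMap y
    rw [Fintype.sum_sum_type] at this
    simp only [ContinuousLinearMap.coe_coe, smul_eq_mul] at this
    rw [this]
    congr 1 <;> refine Finset.sum_congr rfl fun j _ => ?_ <;> congr 2 <;> ext k <;>
      simp [Pi.single_apply, eq_comm]
  have hw : ∀ e, f (Pi.single (Sum.inr e) 1) ≤ 0 := by
    intro e
    by_contra! hpos
    set c := f (Pi.single (Sum.inr e) 1)
    let y0 : ι ⊕ κ → ℝ := Sum.elim r (fun _ => η)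
    let s : ℝ := max 0 ((f y0 - v) / c)
    have hmem : y0 - s • Pi.single (Sum.inr e) 1 ∈ K := by
      refine ⟨fun i => by simp [y0], fun e' => ?_⟩
      simp only [Pi.sub_apply, Pi.smul_apply, y0, Sum.elim_inr, smul_eq_mul]
      have hs : 0 ≤ s := le_max_left _ _
      have : 0 ≤ (Pi.single (Sum.inr e) 1 : ι ⊕ κ → ℝ) (Sum.inr e') := by
        rw [Pi.single_apply]; split_ifs <;> norm_num
      nlinarith [mul_nonneg hs this]
    have h4 := h3 _ hmem
    rw [map_sub, map_smul, smul_eq_mul] at h4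
    have h5 : (f y0 - v) / c ≤ s := le_max_right _ _
    rw [div_le_iff₀ hpos] at h5
    change v < f y0 - s * c at h4
    linarith
  refine ⟨fun i => - f (Pi.single (Sum.inl i) 1), fun e => - f (Pi.single (Sum.inr e) 1),
    fun e => by linarith [hw e], fun x hx => ?_⟩
  have h4 := h1 _ ⟨x, hx, rfl⟩
  have h5 := h3 (Sum.elim r (fun _ => η)) ⟨fun i => rfl, fun e => le_rfl⟩
  rw [hf] at h4 h5
  have h6 := h4.trans (h2.trans h5)
  simp only [Sum.elim_inl, Sum.elim_inr, ← Finset.mul_sum] at h6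
  simp only [neg_mul, Finset.sum_neg_distrib]
  have e1 : ∀ i, (L x) (Sum.inl i) = ∑ p ∈ P, M i p * x p := fun i => rfl
  have e2 : ∀ i, (L x) (Sum.inr i) = ∑ p ∈ P, N i p * x p := fun i => rfl
  simp only [e1, e2] at h6
  simp only [mul_comm (f _)]
  linarith

/-- Threshold rounding of a potential. -/
lemma threshold_aux [Fintype V] (G : SimpleGraph V) (T' T'' : Finset V)
    (hcard : T'.card = T''.card) (η : ℝ) (φ : V → ℝ)
    (h : ∑ v ∈ T'', φ v + η * ∑ q ∈ (Finset.univ : Finset (V × V)).filter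
        (fun q => G.Adj q.1 q.2), max (φ q.1 - φ q.2) 0 < ∑ v ∈ T', φ v) :
    ∃ A : Finset V, ((A ∩ T'').card : ℝ) + η * (cutCard G A Aᶜ : ℝ) < ((A ∩ T').card : ℝ) := by
  by_contra! hcon
  obtain ⟨m, hm⟩ : ∃ m, ∀ v, m ≤ φ v := by
    obtain ⟨m, hm⟩ := (Set.finite_range φ).bddBelow
    exact ⟨m, fun v => hm ⟨v, rfl⟩⟩
  obtain ⟨B, hB⟩ : ∃ B, ∀ v, φ v ≤ B := by
    obtain ⟨m, hm⟩ := (Set.finite_range φ).bddAbove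
    exact ⟨m, fun v => hm ⟨v, rfl⟩⟩
  let F : V → ℝ → ℝ := fun v => (Set.Ioc m (φ v)).indicator (fun _ => 1)
  let H : V × V → ℝ → ℝ := fun q => (Set.Ioc (φ q.2) (φ q.1)).indicator (fun _ => 1)
  have hFi : ∀ v, MeasureTheory.Integrable (F v) := by
    intro v
    apply (MeasureTheory.integrable_indicator_iff measurableSet_Ioc).2
    simp
  have hHi : ∀ q, MeasureTheory.Integrable (H q) := by
    intro v
    apply (MeasureTheory.integrable_indicator_iff measurableSet_Ioc).2
    simp
  have hF : ∀ v, ∫ t, F v t = φ v - m := by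
    intro v
    simp only [F]
    rw [MeasureTheory.integral_indicator measurableSet_Ioc]
    simp [hm v]
  have hH : ∀ q, ∫ t, H q t = max (φ q.1 - φ q.2) 0 := by
    intro q
    simp only [H]
    rw [MeasureTheory.integral_indicator measurableSet_Ioc]
    simp [MeasureTheory.Measure.real, ENNReal.toReal_ofReal']
  have key : ∀ t, ∑ v ∈ T', F v t ≤ ∑ v ∈ T'', F v t + η * ∑ q ∈ (Finset.univ : Finset (V × V)).filter
        (fun q => G.Adj q.1 q.2), H q t := by
    intro t
    by_cases ht : m < t
    · have h1 := hcon (Finset.univ.filter fun v => t ≤ φ v)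
      have e1 : ∀ U : Finset V, ∑ v ∈ U, F v t =
          (((Finset.univ.filter fun v => t ≤ φ v) ∩ U).card : ℝ) := by
        intro U
        rw [Finset.card_eq_sum_ones, Nat.cast_sum, ← Finset.filter_mem_eq_inter,
          Finset.filter_filter, Finset.sum_filter]
        rw [← Finset.sum_subset (Finset.subset_univ U)]
        · refine Finset.sum_congr rfl fun v hv => ?_
          simp [F, Set.indicator_apply, ht, hv]
        · intro v _ hv
          simp [hv]
      have e2 : ∑ q ∈ (Finset.univ : Finset (V × V)).filter (fun q => G.Adj q.1 q.2), H q t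
          = (cutCard G (Finset.univ.filter fun v => t ≤ φ v)
              (Finset.univ.filter fun v => t ≤ φ v)ᶜ : ℝ) := by
        unfold cutCard
        rw [Finset.card_eq_sum_ones, Nat.cast_sum, Finset.sum_filter, Finset.sum_filter,
          ← Finset.sum_subset (Finset.subset_univ ((Finset.univ.filter fun v => t ≤ φ v) ×ˢ
            (Finset.univ.filter fun v => t ≤ φ v)ᶜ))]
        rotate_left
        · intro q _ hq
          simp only [H, Set.indicator_apply]
          simp only [Finset.mem_product, Finset.mem_filter, Finset.mem_univ, true_and,
            Finset.mem_compl, not_and, not_not] at hq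
          split_ifs with h1 h2
          · exact absurd (hq h2.2) (not_le.2 h2.1)
          · rfl
          · rfl
        · refine Finset.sum_congr rfl fun q hq => ?_
          simp only [Finset.mem_product, Finset.mem_filter, Finset.mem_univ, true_and,
            Finset.mem_compl, not_le] at hq
          simp [H, hq.1, hq.2]
      rw [e1, e1, e2]
      exact h1
    · have e1 : ∀ v, F v t = 0 := by
        intro v; simp [F, ht]
      have e2 : ∀ q, H q t = 0 := by
        intro q
        simp only [H, Set.indicator_apply]
        rw [if_neg]
        intro h
        exact ht ((hm _).trans_lt h.1)
      simp [e1, e2]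
  have hint := MeasureTheory.integral_mono
    (MeasureTheory.integrable_finsetSum T' fun v _ => hFi v)
    ((MeasureTheory.integrable_finsetSum T'' fun v _ => hFi v).add
      ((MeasureTheory.integrable_finsetSum ((Finset.univ : Finset (V × V)).filter
        (fun q => G.Adj q.1 q.2)) fun q _ => hHi q).const_mul η)) key
  simp only [Pi.add_apply] at hint
  rw [MeasureTheory.integral_add (MeasureTheory.integrable_finsetSum T'' fun v _ => hFi v)
      ((MeasureTheory.integrable_finsetSum ((Finset.univ : Finset (V × V)).filter
        (fun q => G.Adj q.1 q.2)) fun q _ => hHi q).const_mul η),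
    MeasureTheory.integral_const_mul,
    MeasureTheory.integral_finsetSum _ fun v _ => hFi v,
    MeasureTheory.integral_finsetSum _ fun v _ => hFi v,
    MeasureTheory.integral_finsetSum _ fun v _ => hHi v] at hint
  simp only [hF, hH, Finset.sum_sub_distrib, Finset.sum_const, nsmul_eq_mul, hcard] at hint
  linarith

/-- The finite set of simple paths ending in a given set. -/
lemma exists_pathset [Fintype V] (G : SimpleGraph V) (T'' : Finset V) :
    ∃ Q : Finset (Σ u v : V, G.Walk u v), ∀ p, p ∈ Q ↔ p.2.2.IsPath ∧ p.2.1 ∈ T'' := by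
  have hfin : Set.Finite {p : Σ u v : V, G.Walk u v | p.2.2.IsPath ∧ p.2.1 ∈ T''} := by
    have : Set.Finite (Set.range fun q : (Σ u v : V, G.Path u v) =>
        (⟨q.1, q.2.1, q.2.2.1⟩ : Σ u v : V, G.Walk u v)) := Set.finite_range _
    refine this.subset ?_
    rintro ⟨u, v, p⟩ hp
    exact ⟨⟨u, v, ⟨p, hp.1⟩⟩, rfl⟩
  exact ⟨hfin.toFinset, fun p => by simp⟩

lemma exists_potential [Fintype V] (G : SimpleGraph V) (T'' : Finset V)
    (Q : Finset (Σ u v : V, G.Walk u v)) (hQ : ∀ p, p ∈ Q ↔ p.2.2.IsPath ∧ p.2.1 ∈ T'')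
    (z : V → ℝ) (w : Sym2 V → ℝ) (hw : ∀ e, 0 ≤ w e) :
    ∃ φ : V → ℝ, (∀ v ∈ T'', φ v ≤ z v) ∧ (∀ u v, G.Adj u v → φ u ≤ φ v + w s(u, v)) ∧
      ∀ p ∈ Q, ∃ q ∈ Q, q.1 = p.1 ∧ φ p.1 = z q.2.1 + ∑ e ∈ q.2.2.edges.toFinset, w e := by
  let c : (Σ u v : V, G.Walk u v) → ℝ := fun q => z q.2.1 + ∑ e ∈ q.2.2.edges.toFinset, w e
  have hex : ∀ v, ∃ r : ℝ, (∀ p ∈ Q, p.1 = v → r ≤ c p) ∧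
      ((∃ p ∈ Q, p.1 = v) → ∃ q ∈ Q, q.1 = v ∧ r = c q) ∧
      ((¬ ∃ p ∈ Q, p.1 = v) → r = 0) := by
    intro v
    by_cases hv : ∃ p ∈ Q, p.1 = v
    · obtain ⟨p, hp, hpv⟩ := hv
      obtain ⟨q, hq, hmin⟩ := Finset.exists_min_image (Q.filter fun p => p.1 = v) c
        ⟨p, by simp [hp, hpv]⟩
      rw [Finset.mem_filter] at hq
      exact ⟨c q, fun p hp hpv => hmin p (by simp [hp, hpv]),
        fun _ => ⟨q, hq.1, hq.2, rfl⟩, fun hn => (hn ⟨p, hp, hpv⟩).elim⟩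
    · exact ⟨0, fun p hp hpv => (hv ⟨p, hp, hpv⟩).elim, fun h => (hv h).elim, fun _ => rfl⟩
  choose φ h1 h2 h3 using hex
  have ext : ∀ u v, G.Adj u v → ∀ q ∈ Q, q.1 = v →
      ∃ p ∈ Q, p.1 = u ∧ c p ≤ c q + w s(u, v) := by
    rintro u v huv ⟨v', b, q⟩ hq rfl
    refine ⟨⟨u, b, (SimpleGraph.Walk.cons huv q).bypass⟩, ?_, rfl, ?_⟩
    · rw [hQ]
      exact ⟨SimpleGraph.Walk.bypass_isPath _, ((hQ _).1 hq).2⟩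
    · simp only [c]
      have hsub : (SimpleGraph.Walk.cons huv q).bypass.edges.toFinset ⊆
          insert s(u, v') q.edges.toFinset := by
        intro e he
        rw [List.mem_toFinset] at he
        have := SimpleGraph.Walk.edges_bypass_subset_edges _ he
        simpa using this
      have a1 := Finset.sum_le_sum_of_subset_of_nonneg (f := w) hsub (fun e _ _ => hw e)
      have a2 : ∑ e ∈ insert s(u, v') q.edges.toFinset, w e ≤
          w s(u, v') + ∑ e ∈ q.edges.toFinset, w e := by
        by_cases hm : s(u, v') ∈ q.edges.toFinset
        · rw [Finset.insert_eq_of_mem hm]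
          linarith [hw s(u, v')]
        · rw [Finset.sum_insert hm]
      linarith
  refine ⟨φ, ?_, ?_, ?_⟩
  · intro v hv
    have := h1 v ⟨v, v, SimpleGraph.Walk.nil⟩ ((hQ _).2 ⟨SimpleGraph.Walk.IsPath.nil, hv⟩) rfl
    simpa [c] using this
  · intro u v huv
    by_cases hv : ∃ p ∈ Q, p.1 = v
    · obtain ⟨q, hq, hqv, hφ⟩ := h2 v hv
      obtain ⟨p, hp, hpu, hle⟩ := ext u v huv q hq hqv
      have := h1 u p hp hpu
      linarith
    · have hu : ¬ ∃ p ∈ Q, p.1 = u := by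
        rintro ⟨p, hp, hpu⟩
        obtain ⟨q, hq, hqv, _⟩ := ext v u huv.symm p hp hpu
        exact hv ⟨q, hq, hqv⟩
      rw [h3 u hu, h3 v hv]
      linarith [hw s(u, v)]
  · intro p hp
    exact h2 p.1 ⟨p, hp, rfl⟩

lemma exists_cut [Fintype V] (G : SimpleGraph V) (T' T'' : Finset V)
    (hcard : T'.card = T''.card) (η : ℝ) (hη : 0 < η)
    (hno : ¬ HasUnitFlowIn G Finset.univ T' T'' η) :
    ∃ A : Finset V, ((A ∩ T'').card : ℝ) + η * (cutCard G A Aᶜ : ℝ) < ((A ∩ T').card : ℝ) := by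
  obtain ⟨Q, hQ⟩ := exists_pathset G T''
  by_cases hreach : ∀ a ∈ T', ∃ p ∈ Q, p.1 = a
  swap
  · push Not at hreach
    obtain ⟨a, ha, hna⟩ := hreach
    refine ⟨Finset.univ.filter fun v => ∀ p ∈ Q, p.1 ≠ v, ?_⟩
    have e1 : (Finset.univ.filter fun v => ∀ p ∈ Q, p.1 ≠ v) ∩ T'' = ∅ := by
      ext v
      simp only [Finset.mem_inter, Finset.mem_filter, Finset.mem_univ, true_and,
        Finset.notMem_empty, iff_false, not_and]
      intro h hv
      exact h ⟨v, v, SimpleGraph.Walk.nil⟩ ((hQ _).2 ⟨SimpleGraph.Walk.IsPath.nil, hv⟩) rfl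
    have e2 : cutCard G (Finset.univ.filter fun v => ∀ p ∈ Q, p.1 ≠ v)
        (Finset.univ.filter fun v => ∀ p ∈ Q, p.1 ≠ v)ᶜ = 0 := by
      unfold cutCard
      rw [Finset.card_eq_zero, Finset.filter_eq_empty_iff]
      rintro ⟨u, v⟩ huv hadj
      simp only [Finset.mem_product, Finset.mem_filter, Finset.mem_univ, true_and,
        Finset.mem_compl, not_forall, not_not] at huv
      obtain ⟨hu, ⟨v', b, q⟩, hq, rfl⟩ := huv
      exact hu ⟨u, b, (SimpleGraph.Walk.cons hadj q).bypass⟩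
        ((hQ _).2 ⟨SimpleGraph.Walk.bypass_isPath _, ((hQ _).1 hq).2⟩) rfl
    rw [e1, e2]
    simp only [Finset.card_empty, Nat.cast_zero, mul_zero, add_zero, Nat.cast_pos,
      Finset.card_pos]
    exact ⟨a, Finset.mem_inter.2 ⟨Finset.mem_filter.2 ⟨Finset.mem_univ _, hna⟩, ha⟩⟩
  let S := Σ u v : V, G.Walk u v
  let P : Finset S := Q.filter fun p => p.1 ∈ T'
  let X : Set (S → ℝ) := {x | (∀ p, x p ∈ Set.Icc (0 : ℝ) 1) ∧
    ∀ a ∈ T', ∑ p ∈ P.filter (fun p => p.1 = a), x p = 1}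
  have hXc : Convex ℝ X := by
    intro x hx y hy a b ha hb hab
    refine ⟨fun p => ?_, fun t ht => ?_⟩
    · exact (convex_Icc (0 : ℝ) 1) (hx.1 p) (hy.1 p) ha hb hab
    · simp only [Pi.add_apply, Pi.smul_apply, smul_eq_mul, Finset.sum_add_distrib,
        ← Finset.mul_sum, hx.2 t ht, hy.2 t ht]
      linarith
  have hXk : IsCompact X := by
    have hbox : IsCompact (Set.pi Set.univ fun _ : S => Set.Icc (0 : ℝ) 1) :=
      isCompact_univ_pi fun _ => isCompact_Icc
    have : X = (Set.pi Set.univ fun _ : S => Set.Icc (0 : ℝ) 1) ∩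
        ⋂ a ∈ T', {x | ∑ p ∈ P.filter (fun p => p.1 = a), x p = 1} := by
      ext x
      simp only [X, Set.mem_ofPred_eq, Set.mem_inter_iff, Set.mem_iInter, Set.mem_pi, Set.mem_univ,
        true_imp_iff]
    rw [this]
    refine hbox.inter_right (isClosed_iInter fun a => isClosed_iInter fun _ => ?_)
    exact isClosed_eq (by fun_prop) (by fun_prop)
  obtain ⟨z, w, hw, hsep⟩ := sep_aux X hXc hXk P
    (fun (v : V) (p : S) => if p.2.1 = v then (1 : ℝ) else 0)
    (fun (e : Sym2 V) (p : S) => if e ∈ p.2.2.edges then (1 : ℝ) else 0)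
    (fun v => if v ∈ T'' then 1 else 0) η (by
      rintro ⟨x, hx, hx1, hx2⟩
      refine hno ⟨P, x, fun p _ => (hx.1 p).1, ?_, fun _ _ _ _ => Finset.mem_univ _, hx.2, ?_, ?_⟩
      · intro p hp
        rw [Finset.mem_filter] at hp
        exact ⟨hp.2, ((hQ _).1 hp.1).2⟩
      · intro b hb
        have := hx1 b
        rw [if_pos hb] at this
        rw [Finset.sum_filter, ← this]
        exact Finset.sum_congr rfl fun p _ => by simp
      · intro e
        refine le_trans (le_of_eq ?_) (hx2 e)
        rw [Finset.sum_filter]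
        exact Finset.sum_congr rfl fun p _ => by simp)
  obtain ⟨φ, hφ1, hφ2, hφ3⟩ := exists_potential G T'' Q hQ z w hw
  have hm : ∀ a ∈ T', ∃ q ∈ Q, q.1 = a ∧ φ a = z q.2.1 + ∑ e ∈ q.2.2.edges.toFinset, w e := by
    intro a ha
    obtain ⟨p, hp, rfl⟩ := hreach a ha
    exact hφ3 p hp
  have hm' : ∀ a, ∃ q : S, a ∈ T' → q ∈ Q ∧ q.1 = a ∧
      φ a = z q.2.1 + ∑ e ∈ q.2.2.edges.toFinset, w e := by
    intro a
    by_cases ha : a ∈ T'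
    · obtain ⟨q, hq⟩ := hm a ha
      exact ⟨q, fun _ => hq⟩
    · exact ⟨⟨a, a, SimpleGraph.Walk.nil⟩, fun h => (ha h).elim⟩
  choose m hmm using hm'
  have hmQ := fun a ha => (hmm a ha).1
  have hms := fun a ha => (hmm a ha).2.1
  have hmc := fun a ha => (hmm a ha).2.2
  apply threshold_aux G T' T'' hcard η φ
  have hinj : Set.InjOn m (T' : Set V) := by
    intro a ha b hb hab
    rw [← hms a ha, ← hms b hb, hab]
  have himg : T'.image m ⊆ P := by
    intro p hp
    rw [Finset.mem_image] at hp
    obtain ⟨a, ha, rfl⟩ := hp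
    exact Finset.mem_filter.2 ⟨hmQ a ha, by rw [hms a ha]; exact ha⟩
  let x : S → ℝ := fun p => if p ∈ T'.image m then 1 else 0
  have hsum : ∀ g : S → ℝ, ∑ p ∈ P, g p * x p = ∑ a ∈ T', g (m a) := by
    intro g
    rw [← Finset.sum_image (f := g) hinj, ← Finset.sum_subset himg]
    · exact Finset.sum_congr rfl fun p hp => by simp only [x, if_pos hp, mul_one]
    · intro p _ hp
      simp only [x, if_neg hp, mul_zero]
  have hxX : x ∈ X := by
    refine ⟨fun p => ?_, fun a ha => ?_⟩
    · simp only [x]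
      split_ifs <;> simp
    · have := hsum (fun p => if p.1 = a then 1 else 0)
      rw [Finset.sum_filter]
      calc _ = ∑ p ∈ P, (if p.1 = a then 1 else 0) * x p :=
            Finset.sum_congr rfl fun p _ => by simp
        _ = _ := this
        _ = ∑ b ∈ T', if b = a then (1 : ℝ) else 0 :=
            Finset.sum_congr rfl fun b hb => by rw [hms b hb]
        _ = 1 := by simp [ha]
  have hfin := hsep x hxX
  simp only [hsum] at hfin
  have e1 : ∑ v, z v * ∑ a ∈ T', (if (m a).2.1 = v then (1 : ℝ) else 0) =
      ∑ a ∈ T', z (m a).2.1 := by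
    simp only [Finset.mul_sum]
    rw [Finset.sum_comm]
    exact Finset.sum_congr rfl fun a _ => by simp
  have e2 : ∑ e, w e * ∑ a ∈ T', (if e ∈ (m a).2.2.edges then (1 : ℝ) else 0) =
      ∑ a ∈ T', ∑ e ∈ (m a).2.2.edges.toFinset, w e := by
    simp only [Finset.mul_sum]
    rw [Finset.sum_comm]
    refine Finset.sum_congr rfl fun a _ => ?_
    rw [← Finset.sum_subset (Finset.subset_univ (m a).2.2.edges.toFinset)]
    · refine Finset.sum_congr rfl fun e he => ?_
      rw [if_pos (List.mem_toFinset.1 he), mul_one]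
    · intro e _ he
      rw [if_neg (fun h => he (List.mem_toFinset.2 h)), mul_zero]
  have e3 : ∑ v, z v * (if v ∈ T'' then (1 : ℝ) else 0) = ∑ v ∈ T'', z v := by
    simp
  have e4 : ∑ a ∈ T', φ a = ∑ a ∈ T', z (m a).2.1 +
      ∑ a ∈ T', ∑ e ∈ (m a).2.2.edges.toFinset, w e := by
    rw [← Finset.sum_add_distrib]
    exact Finset.sum_congr rfl hmc
  rw [e1, e2, e3, ← e4] at hfin
  have e5 : ∑ v ∈ T'', φ v ≤ ∑ v ∈ T'', z v := Finset.sum_le_sum hφ1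
  have e6 : ∑ q ∈ (Finset.univ : Finset (V × V)).filter (fun q => G.Adj q.1 q.2),
      max (φ q.1 - φ q.2) 0 ≤ ∑ e, w e := by
    let R := ((Finset.univ : Finset (V × V)).filter (fun q => G.Adj q.1 q.2)).filter
      (fun q => φ q.2 < φ q.1)
    have hR : Set.InjOn (fun q : V × V => s(q.1, q.2)) (R : Set (V × V)) := by
      rintro ⟨u, v⟩ h1 ⟨u', v'⟩ h2 heq
      have h1' := (Finset.mem_filter.1 h1).2
      have h2' := (Finset.mem_filter.1 h2).2
      simp only [Sym2.eq_iff] at heq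
      rcases heq with ⟨rfl, rfl⟩ | ⟨rfl, rfl⟩
      · rfl
      · exact absurd h1' (lt_asymm h2')
    calc _ = ∑ q ∈ R, max (φ q.1 - φ q.2) 0 := by
          symm
          refine Finset.sum_subset (Finset.filter_subset _ _) fun q hq hq' => ?_
          have : ¬ φ q.2 < φ q.1 := fun h => hq' (Finset.mem_filter.2 ⟨hq, h⟩)
          exact max_eq_right (by linarith)
      _ ≤ ∑ q ∈ R, w s(q.1, q.2) := by
          refine Finset.sum_le_sum fun q hq => ?_
          have hadj := (Finset.mem_filter.1 (Finset.mem_filter.1 hq).1).2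
          exact max_le (by linarith [hφ2 _ _ hadj]) (hw _)
      _ = ∑ e ∈ R.image (fun q : V × V => s(q.1, q.2)), w e := (Finset.sum_image hR).symm
      _ ≤ ∑ e, w e := Finset.sum_le_sum_of_subset_of_nonneg (Finset.subset_univ _)
          fun e _ _ => hw e
  have e7 := mul_le_mul_of_nonneg_left e6 hη.le
  linarith

/-- If `T` is not `(k',α)`-well-linked in `G`, then there is a partition
`(A, Aᶜ)` of the vertices with `|E(A,Aᶜ)| < α · min(|A ∩ T|, |Aᶜ ∩ T|, k')`. -/
theorem stmt3 [Fintype V] (G : SimpleGraph V) (T : Finset V) (k' : ℕ) (hk' : 0 < k')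
    (α : ℝ) (hα0 : 0 < α) (hα1 : α ≤ 1)
    (h : ¬ WellLinkedKIn G Finset.univ T k' α) :
    ∃ A : Finset V,
      (cutCard G A Aᶜ : ℝ) <
        α * min (min (((A ∩ T).card : ℝ)) (((Aᶜ ∩ T).card : ℝ))) (k' : ℝ) := by
  unfold WellLinkedKIn at h
  push Not at h
  obtain ⟨T', T'', h1, h2, _, hcard, hle, hno⟩ := h
  obtain ⟨A, hA⟩ := exists_cut G T' T'' hcard (1 / α) (by positivity) hno
  refine ⟨A, ?_⟩
  have hA' : (cutCard G A Aᶜ : ℝ) < α * (((A ∩ T').card : ℝ) - ((A ∩ T'').card : ℝ)) := by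
    have := mul_lt_mul_of_pos_left hA hα0
    rw [mul_add, ← mul_assoc, mul_one_div_cancel hα0.ne', one_mul] at this
    linarith
  refine hA'.trans_le (mul_le_mul_of_nonneg_left ?_ hα0.le)
  have c0 : (0 : ℝ) ≤ ((A ∩ T'').card : ℝ) := Nat.cast_nonneg _
  have hsplit : ∀ U : Finset V, ((A ∩ U).card : ℝ) + ((Aᶜ ∩ U).card : ℝ) = (U.card : ℝ) := by
    intro U
    have : (A ∩ U).card + (Aᶜ ∩ U).card = U.card := by
      rw [← Finset.card_union_of_disjoint, ← Finset.union_inter_distrib_right,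
        Finset.union_compl, Finset.univ_inter]
      exact Finset.disjoint_of_subset_left Finset.inter_subset_left
        (Finset.disjoint_of_subset_right Finset.inter_subset_left disjoint_compl_right)
    exact_mod_cast this
  have s1 := hsplit T'
  have s2 := hsplit T''
  have hc : (T'.card : ℝ) = (T''.card : ℝ) := by exact_mod_cast hcard
  have hk : (T'.card : ℝ) ≤ (k' : ℝ) := by exact_mod_cast hle
  have c1 : (0 : ℝ) ≤ ((Aᶜ ∩ T').card : ℝ) := Nat.cast_nonneg _
  have m1 : ((A ∩ T').card : ℝ) ≤ ((A ∩ T).card : ℝ) := by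
    exact_mod_cast Finset.card_le_card (Finset.inter_subset_inter_left h1)
  have m2 : ((Aᶜ ∩ T'').card : ℝ) ≤ ((Aᶜ ∩ T).card : ℝ) := by
    exact_mod_cast Finset.card_le_card (Finset.inter_subset_inter_left h2)
  refine le_min (le_min ?_ ?_) ?_ <;> linarith
end
end

section
/- Let G be a connected graph with maximum vertex degree at most Δ, and let T be a set of vertices that is α-well-linked in G with |T| > 1/α, for some 0 < α ≤ 1. Then there exists a collection F of vertex-disjoint trees in G, each containing at least ⌈1/α⌉ and at most 2Δ·⌈1/α⌉ vertices of T, such that for any set U ⊆ T containing at most one vertex of each tree of F, U is 1/2-well-linked in G. -/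
attribute [local instance] Classical.propDecidable

noncomputable section

variable {V : Type}

/-- `x` and `y` are joined by a walk inside `s`. -/
def Rch (G : SimpleGraph V) (s : Finset V) (x y : V) : Prop :=
  ∃ p : G.Walk x y, ∀ z ∈ p.support, z ∈ s

/-- `s` is a nonempty connected vertex set. -/
def ConnS (G : SimpleGraph V) (s : Finset V) : Prop :=
  s.Nonempty ∧ ∀ x ∈ s, ∀ y ∈ s, Rch G s x y

theorem Rch.symm {G : SimpleGraph V} {s : Finset V} {x y : V} (h : Rch G s x y) :
    Rch G s y x := by
  obtain ⟨p, hp⟩ := h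
  exact ⟨p.reverse, by simpa using hp⟩

theorem Rch.trans {G : SimpleGraph V} {s : Finset V} {x y z : V} (h : Rch G s x y)
    (h' : Rch G s y z) : Rch G s x z := by
  obtain ⟨p, hp⟩ := h
  obtain ⟨p', hp'⟩ := h'
  refine ⟨p.append p', fun w hw => ?_⟩
  rw [SimpleGraph.Walk.mem_support_append_iff] at hw
  exact hw.elim (hp w) (hp' w)

theorem Rch.mono {G : SimpleGraph V} {s t : Finset V} {x y : V} (h : Rch G s x y)
    (hst : s ⊆ t) : Rch G t x y := by
  obtain ⟨p, hp⟩ := h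
  exact ⟨p, fun z hz => hst (hp z hz)⟩

theorem Rch.refl {G : SimpleGraph V} {s : Finset V} {x : V} (h : x ∈ s) : Rch G s x x :=
  ⟨SimpleGraph.Walk.nil, by simpa using h⟩

theorem Rch.edge {G : SimpleGraph V} {s : Finset V} {x y : V} (h : x ∈ s) (h' : y ∈ s)
    (ha : G.Adj x y) : Rch G s x y :=
  ⟨SimpleGraph.Walk.cons ha SimpleGraph.Walk.nil, by simp [h, h']⟩

theorem Rch.right {G : SimpleGraph V} {s : Finset V} {x y : V} (h : Rch G s x y) : y ∈ s := by
  obtain ⟨p, hp⟩ := h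
  exact hp _ p.end_mem_support

theorem Rch.left {G : SimpleGraph V} {s : Finset V} {x y : V} (h : Rch G s x y) : x ∈ s :=
  h.symm.right

theorem connS_of_hub {G : SimpleGraph V} {s : Finset V} {v : V} (hv : v ∈ s)
    (h : ∀ x ∈ s, Rch G s x v) : ConnS G s :=
  ⟨⟨v, hv⟩, fun x hx y hy => (h x hx).trans (h y hy).symm⟩

theorem rch_avoid {G : SimpleGraph V} {A K : Finset V} {y v : V} (p : G.Walk y v)
    (hp : ∀ z ∈ p.support, z ∈ A) (hvK : v ∉ K) (hyK : y ∉ K)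
    (hcl : ∀ a ∈ A, a ≠ v → ∀ b ∈ K, G.Adj a b → a ∈ K) : Rch G (A \ K) y v := by
  induction p with
  | nil => exact Rch.refl (by simpa [hyK] using hp)
  | @cons a b c hab p ih =>
    by_cases hac : a = c
    · subst hac
      exact Rch.refl (by
        have := hp a (by simp)
        simp [this, hyK])
    · have haA : a ∈ A := hp a (by simp)
      have hbA : b ∈ A := hp b (by simp)
      have hbK : b ∉ K := fun hb => hyK (hcl a haA hac b hb hab)
      have h1 := ih (fun z hz => hp z (by simp [hz])) hvK hbK hcl
      exact (Rch.edge (by simp [haA, hyK]) (by simp [hbA, hbK]) hab).trans h1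

theorem rch_nbr {G : SimpleGraph V} {A : Finset V} {x v : V} (p : G.Walk x v)
    (hp : ∀ z ∈ p.support, z ∈ A) (hxv : x ≠ v) :
    ∃ u, G.Adj v u ∧ Rch G (A.erase v) u x := by
  induction p with
  | nil => exact absurd rfl hxv
  | @cons a b c hab p ih =>
    have haA : a ∈ A := hp a (by simp)
    have hbA : b ∈ A := hp b (by simp)
    by_cases hbc : b = c
    · subst hbc
      exact ⟨a, hab.symm, Rch.refl (by simp [haA, hxv])⟩
    · obtain ⟨u, hu, hr⟩ := ih (fun z hz => hp z (by simp [hz])) hbc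
      exact ⟨u, hu, hr.trans (Rch.edge (by simp [hbA, hbc]) (by simp [haA, hxv]) hab.symm)⟩

theorem split_lemma [Fintype V] (G : SimpleGraph V) (Δ q : ℕ) (hΔ : ∀ v, deg G v ≤ Δ)
    (hΔ1 : 1 ≤ Δ) (hq : 1 ≤ q) (T C : Finset V) (hC : ConnS G C)
    (hw : 2 * Δ * q < (T ∩ C).card) :
    ∃ A ⊆ C, ConnS G A ∧ ConnS G (C \ A) ∧ q ≤ (T ∩ A).card ∧ q ≤ (T ∩ (C \ A)).card := by
  have hqΔ : q ≤ Δ * q := Nat.le_mul_of_pos_left q hΔ1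
  let S : Finset (Finset V) := C.powerset.filter
    (fun A => ConnS G A ∧ (C \ A = ∅ ∨ ConnS G (C \ A)) ∧ q ≤ (T ∩ A).card)
  have hS : S.Nonempty := ⟨C, by
    simp only [S, Finset.mem_filter, Finset.mem_powerset]
    exact ⟨subset_rfl, hC, Or.inl (by simp), by nlinarith⟩⟩
  obtain ⟨A, hAS, hmin⟩ := S.exists_min_image Finset.card hS
  simp only [S, Finset.mem_filter, Finset.mem_powerset] at hAS hmin
  obtain ⟨hAC, hA, hB, hqA⟩ := hAS
  have hsum : (T ∩ C).card ≤ (T ∩ A).card + (T ∩ (C \ A)).card := by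
    refine le_trans (Finset.card_le_card ?_) (Finset.card_union_le _ _)
    intro x hx
    simp only [Finset.mem_inter, Finset.mem_union, Finset.mem_sdiff] at hx ⊢
    tauto
  by_cases hqB : q ≤ (T ∩ (C \ A)).card
  · refine ⟨A, hAC, hA, hB.resolve_left ?_, hqA, hqB⟩
    intro h0
    rw [h0] at hqB
    simp at hqB
    omega
  exfalso
  obtain ⟨v, hvA, hv⟩ : ∃ v ∈ A, C \ A = ∅ ∨ (ConnS G (C \ A) ∧ ∃ b ∈ C \ A, G.Adj b v) := by
    rcases hB with hB | hB
    · obtain ⟨v, hv⟩ := hA.1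
      exact ⟨v, hv, Or.inl hB⟩
    · obtain ⟨a, ha⟩ := hA.1
      obtain ⟨b, hb⟩ := hB.1
      obtain ⟨p, hp⟩ := hC.2 a (hAC ha) b (Finset.mem_sdiff.1 hb).1
      obtain ⟨d, hd, h1, h2⟩ := p.exists_boundary_dart (A : Set V) (by simpa using ha)
        (by simpa using (Finset.mem_sdiff.1 hb).2)
      refine ⟨d.fst, by simpa using h1, Or.inr ⟨hB, d.snd, ?_, d.adj.symm⟩⟩
      rw [Finset.mem_sdiff]
      exact ⟨hp _ (p.dart_snd_mem_support_of_mem_darts hd), by simpa using h2⟩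
  let K : V → Finset V := fun u => Finset.univ.filter (fun x => Rch G (A.erase v) u x)
  have hK : ∀ u x, x ∈ K u ↔ Rch G (A.erase v) u x := fun u x => by simp [K]
  have hKA : ∀ u, K u ⊆ A.erase v := fun u x hx => ((hK u x).1 hx).right
  have hKw : ∀ u, G.Adj v u → (T ∩ K u).card ≤ q := by
    intro u hu
    by_contra hcon
    push Not at hcon
    have hne : (K u).Nonempty := by
      rw [Finset.nonempty_iff_ne_empty]
      intro h0
      rw [h0] at hcon
      simp at hcon
    have huu : u ∈ A.erase v := by
      obtain ⟨x, hx⟩ := hne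
      exact ((hK u x).1 hx).left
    have huK : u ∈ K u := (hK u u).2 (Rch.refl huu)
    have hvK : v ∉ K u := fun h => by simpa using hKA u h
    have h1 : ConnS G (K u) := by
      refine connS_of_hub huK ?_
      intro x hx
      obtain ⟨p, hp⟩ := (hK u x).1 hx
      refine Rch.symm ⟨p, fun z hz => (hK u z).2 ⟨p.takeUntil z hz, fun y hy => ?_⟩⟩
      exact hp y (p.support_takeUntil_subset_support hz hy)
    have hvC : v ∈ C \ K u := by simp [hvK, hAC hvA]
    have h2 : ConnS G (C \ K u) := by
      refine connS_of_hub hvC ?_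
      intro y hy
      rw [Finset.mem_sdiff] at hy
      by_cases hyA : y ∈ A
      · obtain ⟨p, hp⟩ := hA.2 y hyA v hvA
        refine (rch_avoid p hp hvK hy.2 ?_).mono (Finset.sdiff_subset_sdiff hAC subset_rfl)
        intro a ha hav b hb hab
        exact (hK u a).2 (((hK u b).1 hb).trans (Rch.edge (hKA u hb) (by simp [ha, hav]) hab.symm))
      · have hyB : y ∈ C \ A := by simp [hy.1, hyA]
        have hsub : C \ A ⊆ C \ K u := by
          refine Finset.sdiff_subset_sdiff subset_rfl ?_
          exact (hKA u).trans (Finset.erase_subset _ _)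
        rcases hv with hv | ⟨hB, b, hb, hbv⟩
        · rw [hv] at hyB
          simp at hyB
        · exact ((hB.2 y hyB b hb).mono hsub).trans (Rch.edge (hsub hb) hvC hbv)
    have h3 := hmin (K u) ⟨((hKA u).trans (Finset.erase_subset _ _)).trans hAC, h1, Or.inr h2,
      hcon.le⟩
    have h4 := Finset.card_le_card (hKA u)
    have h5 := Finset.card_erase_lt_of_mem hvA
    omega
  have hcov : T ∩ A ⊆ insert v
      ((Finset.univ.filter (fun u => G.Adj v u)).biUnion (fun u => T ∩ K u)) := by
    intro x hx
    rw [Finset.mem_inter] at hx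
    rw [Finset.mem_insert]
    by_cases hxv : x = v
    · exact Or.inl hxv
    · right
      obtain ⟨p, hp⟩ := hA.2 x hx.2 v hvA
      obtain ⟨u, hu, hr⟩ := rch_nbr p hp hxv
      rw [Finset.mem_biUnion]
      exact ⟨u, by simpa using hu, Finset.mem_inter.2 ⟨hx.1, (hK u x).2 hr⟩⟩
  have h6 := (Finset.card_le_card hcov).trans (Finset.card_insert_le _ _)
  have h7 : ((Finset.univ.filter (fun u => G.Adj v u)).biUnion (fun u => T ∩ K u)).card
      ≤ Δ * q := by
    refine (Finset.card_biUnion_le_card_mul _ _ q ?_).trans (Nat.mul_le_mul_right q (hΔ v))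
    intro u hu
    exact hKw u (by simpa using hu)
  nlinarith

theorem partition_lemma [Fintype V] (G : SimpleGraph V) (Δ q : ℕ) (hΔ : ∀ v, deg G v ≤ Δ)
    (hΔ1 : 1 ≤ Δ) (hq : 1 ≤ q) (T : Finset V) (n : ℕ) : ∀ C : Finset V, C.card ≤ n →
    ConnS G C → q ≤ (T ∩ C).card →
    ∃ F : Set (Finset V),
      (∀ s ∈ F, s ⊆ C ∧ ConnS G s ∧ q ≤ (T ∩ s).card ∧ (T ∩ s).card ≤ 2 * Δ * q) ∧
      (∀ s ∈ F, ∀ t ∈ F, s ≠ t → Disjoint s t) ∧ (∀ v ∈ C, ∃ s ∈ F, v ∈ s) := by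
  induction n with
  | zero =>
    intro C hC hconn
    have := Finset.card_pos.2 hconn.1
    omega
  | succ n ih =>
    intro C hC hconn hqC
    by_cases hw : (T ∩ C).card ≤ 2 * Δ * q
    · refine ⟨{C}, ?_, ?_, ?_⟩
      · rintro s rfl
        exact ⟨subset_rfl, hconn, hqC, hw⟩
      · rintro s rfl t rfl h
        exact absurd rfl h
      · intro v hv
        exact ⟨C, rfl, hv⟩
    · obtain ⟨A, hAC, hA, hB, hqA, hqB⟩ := split_lemma G Δ q hΔ hΔ1 hq T C hconn (by omega)
      have hcard := Finset.card_sdiff_add_card_eq_card hAC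
      have hA0 := Finset.card_pos.2 hA.1
      have hB0 := Finset.card_pos.2 hB.1
      obtain ⟨F, hF1, hF2, hF3⟩ := ih A (by omega) hA hqA
      obtain ⟨F', hF1', hF2', hF3'⟩ := ih (C \ A) (by omega) hB hqB
      have hdis : ∀ s ∈ F, ∀ t ∈ F', Disjoint s t := fun s hs t ht =>
        Finset.disjoint_of_subset_left (hF1 s hs).1
          (Finset.disjoint_of_subset_right (hF1' t ht).1 Finset.disjoint_sdiff)
      refine ⟨F ∪ F', ?_, ?_, ?_⟩
      · rintro s (hs | hs)
        · exact ⟨(hF1 s hs).1.trans hAC, (hF1 s hs).2⟩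
        · exact ⟨(hF1' s hs).1.trans Finset.sdiff_subset, (hF1' s hs).2⟩
      · rintro s (hs | hs) t (ht | ht) hst
        · exact hF2 s hs t ht hst
        · exact hdis s hs t ht
        · exact (hdis t ht s hs).symm
        · exact hF2' s hs t ht hst
      · intro v hv
        by_cases hvA : v ∈ A
        · obtain ⟨s, hs, hvs⟩ := hF3 v hvA
          exact ⟨s, Or.inl hs, hvs⟩
        · obtain ⟨s, hs, hvs⟩ := hF3' v (by simp [hv, hvA])
          exact ⟨s, Or.inr hs, hvs⟩

theorem exists_tree (G : SimpleGraph V) (s : Finset V) (hs : ConnS G s) :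
    ∃ τ : G.Subgraph, τ.coe.IsTree ∧ τ.verts = (s : Set V) := by
  have hc : (G.induce (s : Set V)).Connected := by
    obtain ⟨v, hv⟩ := hs.1
    have : Nonempty (s : Set V) := ⟨⟨v, hv⟩⟩
    refine SimpleGraph.Connected.mk ?_
    rintro ⟨x, hx⟩ ⟨y, hy⟩
    obtain ⟨p, hp⟩ := hs.2 x hx y hy
    exact ⟨p.induce (s : Set V) hp⟩
  obtain ⟨H, hH, hT⟩ := hc.exists_isTree_le
  let τ : G.Subgraph :=
    { verts := (s : Set V)
      Adj := fun a b => ∃ (ha : a ∈ (s : Set V)) (hb : b ∈ (s : Set V)), H.Adj ⟨a, ha⟩ ⟨b, hb⟩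
      adj_sub := by
        rintro a b ⟨ha, hb, h⟩
        exact hH h
      edge_vert := by
        rintro a b ⟨ha, hb, h⟩
        exact ha
      symm := ⟨by
        rintro a b ⟨ha, hb, h⟩
        exact ⟨hb, ha, h.symm⟩⟩ }
  refine ⟨τ, ?_, rfl⟩
  have : τ.coe = H := by
    ext ⟨a, ha⟩ ⟨b, hb⟩
    constructor
    · rintro ⟨_, _, h⟩
      exact h
    · intro h
      exact ⟨ha, hb, h⟩
  rw [this]
  exact hT

theorem flow_lemma [Fintype V] (G : SimpleGraph V) (T : Finset V) (α : ℝ)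
    (hwl : WellLinked G T α) (q : ℕ) (hq : 1 ≤ q) (hqα : 1 / α ≤ q)
    (part : V → Finset V) (hpart : ∀ v, v ∈ part v)
    (hconn : ∀ v, ConnS G (part v)) (hpq : ∀ v, q ≤ (T ∩ part v).card)
    (heq : ∀ u v z, z ∈ part u → z ∈ part v → part u = part v)
    (U : Finset V)
    (hinj : ∀ u ∈ U, ∀ v ∈ U, part u = part v → u = v) : WellLinked G U (1 / 2) := by
  intro T' T'' hT' hT'' hdisj hcard
  have hS : ∀ v, ∃ S ⊆ T ∩ part v, S.card = q := fun v => Finset.exists_subset_card_eq (hpq v)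
  choose S hS hSc using hS
  have hST : ∀ v x, x ∈ S v → x ∈ T := fun v x hx => (Finset.mem_inter.1 (hS v hx)).1
  have hSp : ∀ v x, x ∈ S v → x ∈ part v := fun v x hx => (Finset.mem_inter.1 (hS v hx)).2
  have huniq : ∀ u ∈ U, ∀ v ∈ U, ∀ z, z ∈ part u → z ∈ part v → u = v :=
    fun u hu v hv z h1 h2 => hinj u hu v hv (heq u v z h1 h2)
  have hcd : ∀ R ⊆ U, (R.biUnion S).card = R.card * q := by
    intro R hR
    rw [Finset.card_biUnion, Finset.sum_congr rfl (fun x _ => hSc x), Finset.sum_const,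
      smul_eq_mul]
    intro u hu v hv huv
    refine Finset.disjoint_left.2 ?_
    intro z hz hz'
    exact huv (huniq u (hR hu) v (hR hv) z (hSp u z hz) (hSp v z hz'))
  obtain ⟨P, f, hf0, hPe, -, hfA, hfB, hfe⟩ := hwl (T'.biUnion S) (T''.biUnion S)
    (by
      intro x hx
      obtain ⟨u, -, hu⟩ := Finset.mem_biUnion.1 hx
      exact hST u x hu)
    (by
      intro x hx
      obtain ⟨u, -, hu⟩ := Finset.mem_biUnion.1 hx
      exact hST u x hu)
    (by
      rw [Finset.disjoint_left]
      intro x hx hx'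
      obtain ⟨u, hu, hxu⟩ := Finset.mem_biUnion.1 hx
      obtain ⟨v, hv, hxv⟩ := Finset.mem_biUnion.1 hx'
      have := huniq u (hT' hu) v (hT'' hv) x (hSp u x hxu) (hSp v x hxv)
      subst this
      exact Finset.disjoint_left.1 hdisj hu hv)
    (by rw [hcd T' hT', hcd T'' hT'', hcard])
  have hW : ∀ p : (Σ u v : V, G.Walk u v), ∃ w : (Σ u v : V, G.Walk u v), p ∈ P →
      w.1 ∈ T' ∧ p.1 ∈ S w.1 ∧ w.2.1 ∈ T'' ∧ p.2.1 ∈ S w.2.1 ∧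
      ∀ e ∈ w.2.2.edges, e ∈ p.2.2.edges ∨ (∀ z ∈ e, z ∈ part w.1) ∨
        (∀ z ∈ e, z ∈ part w.2.1) := by
    intro p
    by_cases hp : p ∈ P
    · obtain ⟨h1, h2⟩ := hPe p hp
      obtain ⟨u, hu, hxu⟩ := Finset.mem_biUnion.1 h1
      obtain ⟨v, hv, hxv⟩ := Finset.mem_biUnion.1 h2
      obtain ⟨p1, hp1⟩ := (hconn u).2 u (hpart u) p.1 (hSp _ _ hxu)
      obtain ⟨p2, hp2⟩ := (hconn v).2 p.2.1 (hSp _ _ hxv) v (hpart v)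
      refine ⟨⟨u, v, (p1.append p.2.2).append p2⟩, fun _ => ⟨hu, hxu, hv, hxv, ?_⟩⟩
      intro e he
      simp only [SimpleGraph.Walk.edges_append, List.mem_append] at he
      rcases he with (he | he) | he
      · exact Or.inr (Or.inl fun z hz =>
          hp1 z (SimpleGraph.Walk.mem_support_of_mem_edges he hz))
      · exact Or.inl he
      · exact Or.inr (Or.inr fun z hz =>
          hp2 z (SimpleGraph.Walk.mem_support_of_mem_edges he hz))
    · exact ⟨p, fun h => absurd h hp⟩
  choose W hW using hW
  have hq0 : (0 : ℝ) < q := by exact_mod_cast hq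
  have key : ∀ Q : (Σ u v : V, G.Walk u v) → Prop,
      ∑ w ∈ (P.image W).filter Q, (∑ p ∈ P.filter (fun p => W p = w), f p / q)
        = ∑ p ∈ P.filter (fun p => Q (W p)), f p / q := by
    intro Q
    rw [← Finset.sum_fiberwise_of_maps_to (s := P.filter (fun p => Q (W p)))
      (t := (P.image W).filter Q) (g := W)]
    · refine Finset.sum_congr rfl fun w hw => Finset.sum_congr ?_ fun _ _ => rfl
      ext p
      simp only [Finset.mem_filter] at hw ⊢
      constructor
      · rintro ⟨h1, h2⟩
        exact ⟨⟨h1, h2 ▸ hw.2⟩, h2⟩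
      · rintro ⟨⟨h1, -⟩, h2⟩
        exact ⟨h1, h2⟩
    · intro p hp
      simp only [Finset.mem_filter] at hp ⊢
      exact ⟨Finset.mem_image_of_mem W hp.1, hp.2⟩
  have hstart : ∀ a ∈ T', ∑ p ∈ P.filter (fun p => (W p).1 = a), f p / q = 1 := by
    intro a ha
    have h1 : ∑ p ∈ P.filter (fun p => (W p).1 = a), f p
        = ∑ x ∈ S a, ∑ p ∈ P.filter (fun p => p.1 = x), f p := by
      rw [← Finset.sum_fiberwise_of_maps_to (s := P.filter (fun p => (W p).1 = a))
        (t := S a) (g := fun p => p.1)]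
      · refine Finset.sum_congr rfl fun x hx => Finset.sum_congr ?_ fun _ _ => rfl
        ext p
        simp only [Finset.mem_filter]
        constructor
        · rintro ⟨⟨h1, -⟩, h2⟩
          exact ⟨h1, h2⟩
        · rintro ⟨h1, h2⟩
          refine ⟨⟨h1, ?_⟩, h2⟩
          have h3 := hW p h1
          exact huniq _ (hT' h3.1) _ (hT' ha) p.1 (hSp _ _ h3.2.1) (hSp _ _ (h2 ▸ hx))
      · intro p hp
        simp only [Finset.mem_filter] at hp
        exact hp.2 ▸ (hW p hp.1).2.1
    rw [← Finset.sum_div, h1, Finset.sum_congr rfl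
      (fun x hx => hfA x (Finset.mem_biUnion.2 ⟨a, ha, hx⟩))]
    simp [hSc, hq0.ne']
  have hend : ∀ b ∈ T'', ∑ p ∈ P.filter (fun p => (W p).2.1 = b), f p / q = 1 := by
    intro a ha
    have h1 : ∑ p ∈ P.filter (fun p => (W p).2.1 = a), f p
        = ∑ x ∈ S a, ∑ p ∈ P.filter (fun p => p.2.1 = x), f p := by
      rw [← Finset.sum_fiberwise_of_maps_to (s := P.filter (fun p => (W p).2.1 = a))
        (t := S a) (g := fun p => p.2.1)]
      · refine Finset.sum_congr rfl fun x hx => Finset.sum_congr ?_ fun _ _ => rfl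
        ext p
        simp only [Finset.mem_filter]
        constructor
        · rintro ⟨⟨h1, -⟩, h2⟩
          exact ⟨h1, h2⟩
        · rintro ⟨h1, h2⟩
          refine ⟨⟨h1, ?_⟩, h2⟩
          have h3 := (hW p h1).2.2
          exact huniq _ (hT'' h3.1) _ (hT'' ha) p.2.1 (hSp _ _ h3.2.1) (hSp _ _ (h2 ▸ hx))
      · intro p hp
        simp only [Finset.mem_filter] at hp
        exact hp.2 ▸ (hW p hp.1).2.2.2.1
    rw [← Finset.sum_div, h1, Finset.sum_congr rfl
      (fun x hx => hfB x (Finset.mem_biUnion.2 ⟨a, ha, hx⟩))]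
    simp [hSc, hq0.ne']
  have hnn : ∀ p ∈ P, 0 ≤ f p / q := fun p hp => div_nonneg (hf0 p hp) hq0.le
  refine ⟨P.image W, fun w => ∑ p ∈ P.filter (fun p => W p = w), f p / q, ?_, ?_, ?_, ?_, ?_, ?_⟩
  · intro w _
    exact Finset.sum_nonneg fun p hp => hnn p (Finset.mem_filter.1 hp).1
  · intro w hw
    obtain ⟨p, hp, rfl⟩ := Finset.mem_image.1 hw
    exact ⟨(hW p hp).1, (hW p hp).2.2.1⟩
  · intros
    exact Finset.mem_univ _
  · intro a ha
    rw [key (fun w => w.1 = a)]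
    exact hstart a ha
  · intro b hb
    rw [key (fun w => w.2.1 = b)]
    exact hend b hb
  · intro e
    suffices hsuff : ∑ p ∈ P.filter (fun p => e ∈ (W p).2.2.edges), f p / q ≤ 1 / (1 / 2) by
      refine le_trans (le_of_eq ?_) hsuff
      convert key (fun w => e ∈ w.2.2.edges)
    obtain ⟨z, hz⟩ : ∃ z, z ∈ e := by
      induction e with
      | _ a b => exact ⟨a, Sym2.mem_mk_left a b⟩
    have h1 : ∑ p ∈ P.filter (fun p => e ∈ p.2.2.edges), f p / q ≤ 1 := by
      rw [← Finset.sum_div, div_le_one hq0]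
      exact (hfe e).trans hqα
    have h2 : ∑ p ∈ P.filter (fun p => z ∈ part (W p).1 ∨ z ∈ part (W p).2.1), f p / q ≤ 1 := by
      by_cases hA : ∃ a ∈ T', z ∈ part a
      · obtain ⟨a, ha, hza⟩ := hA
        rw [← hstart a ha]
        refine Finset.sum_le_sum_of_subset_of_nonneg ?_
          fun p hp _ => hnn p (Finset.mem_filter.1 hp).1
        intro p hp
        simp only [Finset.mem_filter] at hp ⊢
        refine ⟨hp.1, ?_⟩
        have h3 := hW p hp.1
        rcases hp.2 with h | h
        · exact huniq _ (hT' h3.1) _ (hT' ha) z h hza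
        · have := huniq _ (hT'' h3.2.2.1) _ (hT' ha) z h hza
          exact absurd (this ▸ h3.2.2.1) (Finset.disjoint_left.1 hdisj ha)
      · by_cases hB : ∃ b ∈ T'', z ∈ part b
        · obtain ⟨a, ha, hza⟩ := hB
          rw [← hend a ha]
          refine Finset.sum_le_sum_of_subset_of_nonneg ?_
            fun p hp _ => hnn p (Finset.mem_filter.1 hp).1
          intro p hp
          simp only [Finset.mem_filter] at hp ⊢
          refine ⟨hp.1, ?_⟩
          have h3 := hW p hp.1
          rcases hp.2 with h | h
          · exact absurd ⟨_, h3.1, h⟩ hA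
          · exact huniq _ (hT'' h3.2.2.1) _ (hT'' ha) z h hza
        · rw [Finset.filter_eq_empty_iff.2]
          · simp
          · intro p hp h
            have h3 := hW p hp
            rcases h with h | h
            · exact hA ⟨_, h3.1, h⟩
            · exact hB ⟨_, h3.2.2.1, h⟩
    have h3 : ∑ p ∈ P.filter (fun p => e ∈ (W p).2.2.edges), f p / q ≤
        ∑ p ∈ P.filter (fun p => e ∈ p.2.2.edges) ∪
          P.filter (fun p => z ∈ part (W p).1 ∨ z ∈ part (W p).2.1), f p / q := by
      refine Finset.sum_le_sum_of_subset_of_nonneg ?_ ?_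
      · intro p hp
        simp only [Finset.mem_filter, Finset.mem_union] at hp ⊢
        rcases (hW p hp.1).2.2.2.2 e hp.2 with h | h | h
        · exact Or.inl ⟨hp.1, h⟩
        · exact Or.inr ⟨hp.1, Or.inl (h z hz)⟩
        · exact Or.inr ⟨hp.1, Or.inr (h z hz)⟩
      · intro p hp _
        simp only [Finset.mem_filter, Finset.mem_union] at hp
        exact hnn p (hp.elim And.left And.left)
    have h4 := Finset.sum_union_inter (f := fun p => f p / (q : ℝ))
      (s₁ := P.filter (fun p => e ∈ p.2.2.edges))
      (s₂ := P.filter (fun p => z ∈ part (W p).1 ∨ z ∈ part (W p).2.1))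
    have h5 : 0 ≤ ∑ p ∈ P.filter (fun p => e ∈ p.2.2.edges) ∩
          P.filter (fun p => z ∈ part (W p).1 ∨ z ∈ part (W p).2.1), f p / (q : ℝ) := by
      refine Finset.sum_nonneg fun p hp => ?_
      simp only [Finset.mem_filter, Finset.mem_inter] at hp
      exact hnn p hp.1.1
    norm_num
    linarith

/-- Basic well-linkedness boosting via a family of disjoint trees. -/
theorem stmt5 [Fintype V] (G : SimpleGraph V) (hconn : G.Connected)
    (Δ : ℕ) (hΔ : ∀ v, deg G v ≤ Δ)
    (T : Finset V) (α : ℝ) (hα0 : 0 < α) (hα1 : α ≤ 1)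
    (hwl : WellLinked G T α) (hT : (1 / α : ℝ) < (T.card : ℝ)) :
    ∃ F : Set G.Subgraph,
      (∀ τ ∈ F, τ.coe.IsTree) ∧
      (∀ τ₁ ∈ F, ∀ τ₂ ∈ F, τ₁ ≠ τ₂ → Disjoint τ₁.verts τ₂.verts) ∧
      (∀ τ ∈ F, Nat.ceil ((1 : ℝ) / α) ≤ (T.filter (fun v => v ∈ τ.verts)).card ∧
        (T.filter (fun v => v ∈ τ.verts)).card ≤ 2 * Δ * Nat.ceil ((1 : ℝ) / α)) ∧
      (∀ U : Finset V, U ⊆ T →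
        (∀ τ ∈ F, (U.filter (fun v => v ∈ τ.verts)).card ≤ 1) →
        WellLinked G U (1 / 2)) := by
  have hα1' : 1 ≤ 1 / α := by
    rw [le_div_iff₀ hα0]
    linarith
  set q := Nat.ceil ((1 : ℝ) / α) with hqdef
  have hq : 1 ≤ q := Nat.one_le_ceil_iff.2 (by linarith)
  have hqα : 1 / α ≤ q := Nat.le_ceil _
  have hqT : q ≤ T.card := Nat.ceil_le.2 hT.le
  have hT2 : 1 < T.card := by
    have : (1 : ℝ) < T.card := by linarith
    exact_mod_cast this
  have hΔ1 : 1 ≤ Δ := by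
    obtain ⟨a, ha, b, hb, hab⟩ := Finset.one_lt_card.1 hT2
    obtain ⟨p⟩ := hconn.preconnected a b
    cases p with
    | nil => exact absurd rfl hab
    | @cons _ c _ h p =>
      refine le_trans ?_ (hΔ a)
      unfold deg
      exact Finset.card_pos.2 ⟨c, by simpa using h⟩
  have huniv : ConnS G Finset.univ := by
    obtain ⟨v⟩ := hconn.nonempty
    refine ⟨⟨v, Finset.mem_univ v⟩, fun x _ y _ => ?_⟩
    obtain ⟨p⟩ := hconn.preconnected x y
    exact ⟨p, fun z _ => Finset.mem_univ z⟩
  obtain ⟨F, hF1, hF2, hF3⟩ := partition_lemma G Δ q hΔ hΔ1 hq T _ Finset.univ le_rfl huniv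
    (by simpa using hqT)
  have hfil : ∀ (R : Finset V) (τ : G.Subgraph) (s : Finset V), τ.verts = (s : Set V) →
      R.filter (fun v => v ∈ τ.verts) = R ∩ s := by
    intro R τ s h
    ext v
    simp [h]
  have htree : ∀ s : Finset V, ∃ τ : G.Subgraph, s ∈ F → τ.coe.IsTree ∧ τ.verts = (s : Set V) := by
    intro s
    by_cases hs : s ∈ F
    · obtain ⟨τ, h⟩ := exists_tree G s (hF1 s hs).2.1
      exact ⟨τ, fun _ => h⟩
    · exact ⟨⊥, fun h => absurd h hs⟩
  choose tr htr using htree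
  choose part hpF hpv using fun v => hF3 v (Finset.mem_univ v)
  have heqF : ∀ s ∈ F, ∀ t ∈ F, ∀ z, z ∈ s → z ∈ t → s = t := by
    intro s hs t ht z hzs hzt
    by_contra h
    exact Finset.disjoint_left.1 (hF2 s hs t ht h) hzs hzt
  refine ⟨tr '' F, ?_, ?_, ?_, ?_⟩
  · rintro _ ⟨s, hs, rfl⟩
    exact (htr s hs).1
  · rintro _ ⟨s, hs, rfl⟩ _ ⟨t, ht, rfl⟩ hne
    rw [(htr s hs).2, (htr t ht).2]
    have : s ≠ t := fun h => hne (by rw [h])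
    exact_mod_cast hF2 s hs t ht this
  · rintro _ ⟨s, hs, rfl⟩
    rw [hfil T _ s (htr s hs).2]
    exact (hF1 s hs).2.2
  · intro U hU hU1
    refine flow_lemma G T α hwl q hq hqα part hpv (fun v => (hF1 _ (hpF v)).2.1)
      (fun v => (hF1 _ (hpF v)).2.2.1)
      (fun u v z h1 h2 => heqF _ (hpF u) _ (hpF v) z h1 h2) U ?_
    intro u hu v hv huv
    have h := hU1 (tr (part u)) ⟨_, hpF u, rfl⟩
    rw [hfil U _ _ (htr _ (hpF u)).2] at h
    exact Finset.card_le_one.1 h u (Finset.mem_inter.2 ⟨hu, hpv u⟩) v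
      (Finset.mem_inter.2 ⟨hv, huv ▸ hpv v⟩)
end
end

section
/- Let G be a connected graph with maximum vertex degree at most Δ, and let T be a set of κ vertices that is α-well-linked in G, for 0 < α ≤ 1. Then there is a subset T' ⊆ T of ⌈3ακ/(10Δ)⌉ vertices such that T' is node-well-linked in G. -/
attribute [local instance] Classical.propDecidable

noncomputable section

variable {V : Type}

/-- `(A, B)` is a separation of `G`. -/
def IsSep [Fintype V] (G : SimpleGraph V) (A B : Finset V) : Prop :=
  (∀ x, x ∈ A ∨ x ∈ B) ∧ ∀ x y, x ∈ A → x ∉ B → y ∈ B → y ∉ A → ¬ G.Adj x y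

theorem IsSep.swap [Fintype V] {G : SimpleGraph V} {A B : Finset V} (h : IsSep G A B) :
    IsSep G B A :=
  ⟨fun x => (h.1 x).symm, fun x y hx hx' hy hy' hadj => h.2 y x hy hy' hx hx' hadj.symm⟩

theorem orbit_inj (A B : Finset V) (g : V → V)
    (hA : ∀ v, v ∉ B → g v ∉ A) (hinj : ∀ v w, v ∉ B → w ∉ B → g v = g w → v = w)
    (a a' : V) (ha : a ∈ A) (ha' : a' ∈ A) :
    ∀ i j : ℕ, (∀ k < i, g^[k] a ∉ B) → (∀ k < j, g^[k] a' ∉ B) →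
      g^[i] a = g^[j] a' → i = j ∧ a = a' := by
  intro i
  induction i with
  | zero =>
    intro j _ hj h
    cases j with
    | zero => exact ⟨rfl, h⟩
    | succ j =>
      exfalso
      rw [Function.iterate_succ_apply'] at h
      apply hA _ (hj j (by omega))
      rw [← h]; exact ha
  | succ i ih =>
    intro j hi hj h
    cases j with
    | zero =>
      exfalso
      rw [Function.iterate_succ_apply'] at h
      apply hA _ (hi i (by omega))
      rw [h]; exact ha'
    | succ j =>
      rw [Function.iterate_succ_apply', Function.iterate_succ_apply'] at h
      have := hinj _ _ (hi i (by omega)) (hj j (by omega)) h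
      obtain ⟨h1, h2⟩ := ih j (fun k hk => hi k (by omega)) (fun k hk => hj k (by omega)) this
      exact ⟨by omega, h2⟩

theorem orbit_walk (G : SimpleGraph V) (B : Finset V) (g : V → V)
    (hg : ∀ v, v ∉ B → g v = v ∨ G.Adj v (g v)) (a : V) :
    ∀ n : ℕ, (∀ k < n, g^[k] a ∉ B) →
      ∃ w : G.Walk a (g^[n] a), ∀ x ∈ w.support, ∃ i ≤ n, x = g^[i] a := by
  intro n
  induction n with
  | zero =>
    intro _
    refine ⟨SimpleGraph.Walk.nil, ?_⟩
    intro x hx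
    exact ⟨0, le_refl _, by simpa using hx⟩
  | succ n ih =>
    intro h
    obtain ⟨w, hw⟩ := ih (fun k hk => h k (by omega))
    rw [Function.iterate_succ_apply']
    rcases hg _ (h n (by omega)) with h1 | h1
    · rw [h1]
      refine ⟨w, fun x hx => ?_⟩
      obtain ⟨i, hi, hx⟩ := hw x hx
      exact ⟨i, by omega, hx⟩
    · refine ⟨w.concat h1, fun x hx => ?_⟩
      rw [SimpleGraph.Walk.support_concat] at hx
      simp only [List.mem_append, List.mem_singleton] at hx
      rcases hx with hx | hx
      · obtain ⟨i, hi, hx⟩ := hw x hx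
        exact ⟨i, by omega, hx⟩
      · exact ⟨n + 1, le_refl _, by rw [hx, Function.iterate_succ_apply']⟩

theorem linked_of_map [Fintype V] (G : SimpleGraph V) (A B : Finset V) (g : V → V)
    (hg : ∀ v, v ∉ B → g v = v ∨ G.Adj v (g v))
    (hA : ∀ v, v ∉ B → g v ∉ A) (hinj : ∀ v w, v ∉ B → w ∉ B → g v = g w → v = w) :
    NodeLinkedSets G A B := by
  have hex : ∀ a ∈ A, ∃ n, g^[n] a ∈ B := by
    intro a ha
    by_contra hno
    push Not at hno
    have : Function.Injective (fun n : ℕ => g^[n] a) := by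
      intro i j hij
      exact (orbit_inj A B g hA hinj a a ha ha i j (fun k _ => hno k) (fun k _ => hno k) hij).1
    exact not_injective_infinite_finite _ this
  have hwalk : ∀ a : V, ∃ p : (Σ u v : V, G.Walk u v), a ∈ A →
      (p.1 = a ∧ p.2.1 ∈ B ∧ p.2.2.IsPath ∧
        ∀ x ∈ p.2.2.support, ∃ i, (∀ k < i, g^[k] a ∉ B) ∧ x = g^[i] a) := by
    intro a
    by_cases ha : a ∈ A
    · have hm : ∀ k < Nat.find (hex a ha), g^[k] a ∉ B := fun k hk => Nat.find_min (hex a ha) hk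
      obtain ⟨w, hw⟩ := orbit_walk G B g hg a (Nat.find (hex a ha)) hm
      refine ⟨⟨a, _, w.bypass⟩, fun _ => ⟨rfl, Nat.find_spec (hex a ha), w.bypass_isPath, ?_⟩⟩
      intro x hx
      obtain ⟨i, hi, hx⟩ := hw x (w.support_bypass_subset_support hx)
      exact ⟨i, fun k hk => hm k (by omega), hx⟩
    · exact ⟨⟨a, a, SimpleGraph.Walk.nil⟩, fun h => absurd h ha⟩
  choose p hp using hwalk
  refine ⟨A.image p, ?_, ?_, ?_⟩
  · intro q hq
    obtain ⟨a, ha, rfl⟩ := Finset.mem_image.1 hq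
    obtain ⟨h1, h2, h3, _⟩ := hp a ha
    exact ⟨h3, by rw [h1]; exact ha, h2⟩
  · intro a ha
    exact ⟨p a, Finset.mem_image_of_mem _ ha, (hp a ha).1⟩
  · intro q hq r hr hne x hx hx'
    obtain ⟨a, ha, rfl⟩ := Finset.mem_image.1 hq
    obtain ⟨b, hb, rfl⟩ := Finset.mem_image.1 hr
    obtain ⟨i, hi, hxi⟩ := (hp a ha).2.2.2 x hx
    obtain ⟨j, hj, hxj⟩ := (hp b hb).2.2.2 x hx'
    have := (orbit_inj A B g hA hinj a b ha hb i j hi hj (hxi ▸ hxj)).2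
    exact hne (by rw [this])

/-- Menger's theorem, obtained from Hall's theorem. -/
theorem menger [Fintype V] (G : SimpleGraph V) (A B : Finset V)
    (h : ∀ X Y : Finset V, IsSep G X Y → A ⊆ X → B ⊆ Y → A.card ≤ (X ∩ Y).card) :
    NodeLinkedSets G A B := by
  let t : {v : V // v ∉ B} → Finset V := fun v =>
    Finset.univ.filter (fun u => (u = v.1 ∨ G.Adj v.1 u) ∧ u ∉ A)
  have hall : ∀ s : Finset {v : V // v ∉ B}, s.card ≤ (s.biUnion t).card := by
    intro s
    let X : Finset V := s.map (Function.Embedding.subtype _)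
    have hXB : ∀ x ∈ X, x ∉ B := by
      intro x hx
      obtain ⟨y, _, rfl⟩ := Finset.mem_map.1 hx
      exact y.2
    have hXc : X.card = s.card := Finset.card_map _
    have ht : ∀ u, u ∈ s.biUnion t ↔ (∃ x ∈ X, u = x ∨ G.Adj x u) ∧ u ∉ A := by
      intro u
      simp only [t, X, Finset.mem_biUnion, Finset.mem_filter, Finset.mem_univ, true_and,
        Finset.mem_map, Function.Embedding.subtype_apply]
      constructor
      · rintro ⟨a, ha, h1, h2⟩
        exact ⟨⟨a.1, ⟨a, ha, rfl⟩, h1⟩, h2⟩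
      · rintro ⟨⟨_, ⟨a, ha, rfl⟩, h1⟩, h2⟩
        exact ⟨a, ha, h1, h2⟩
    have key := h (s.biUnion t ∪ A) (Finset.univ \ X) ?_ Finset.subset_union_right ?_
    · have hXs : X ⊆ s.biUnion t ∪ A := by
        intro x hx
        by_cases hxA : x ∈ A
        · exact Finset.mem_union_right _ hxA
        · exact Finset.mem_union_left _ ((ht x).2 ⟨⟨x, hx, Or.inl rfl⟩, hxA⟩)
      have e : (s.biUnion t ∪ A) ∩ (Finset.univ \ X) = (s.biUnion t ∪ A) \ X := by
        ext x; simp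
      rw [e, Finset.card_sdiff_of_subset hXs] at key
      have h1 := Finset.card_union_le (s.biUnion t) A
      have h2 := Finset.card_le_card hXs
      omega
    · refine ⟨fun x => ?_, fun x y hx hx' hy hy' hadj => ?_⟩
      · by_cases hx : x ∈ X
        · left
          by_cases hxA : x ∈ A
          · exact Finset.mem_union_right _ hxA
          · exact Finset.mem_union_left _ ((ht x).2 ⟨⟨x, hx, Or.inl rfl⟩, hxA⟩)
        · right; simpa using hx
      · have hxX : x ∈ X := by simpa using hx'
        apply hy'
        by_cases hyA : y ∈ A
        · exact Finset.mem_union_right _ hyA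
        · exact Finset.mem_union_left _ ((ht y).2 ⟨⟨x, hxX, Or.inr hadj⟩, hyA⟩)
    · intro b hb
      simp only [Finset.mem_sdiff, Finset.mem_univ, true_and]
      exact fun hbX => hXB b hbX hb
  obtain ⟨f, hf, hft⟩ := (Finset.all_card_le_biUnion_card_iff_exists_injective t).1 hall
  have hft' : ∀ v, (f v = v.1 ∨ G.Adj v.1 (f v)) ∧ f v ∉ A := by
    intro v
    have := hft v
    simpa [t] using this
  refine linked_of_map G A B (fun v => if hv : v ∉ B then f ⟨v, hv⟩ else v) ?_ ?_ ?_
  · intro v hv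
    simp only [dif_pos hv]
    exact (hft' ⟨v, hv⟩).1
  · intro v hv
    simp only [dif_pos hv]
    exact (hft' ⟨v, hv⟩).2
  · intro v w hv hw hvw
    simp only [dif_pos hv, dif_pos hw] at hvw
    simpa using hf hvw

theorem cut_bound [Fintype V] (G : SimpleGraph V) (T A : Finset V) (α : ℝ) (hα0 : 0 < α)
    (hwl : WellLinked G T α) (m : ℕ) (h1 : m ≤ (T ∩ A).card) (h2 : m ≤ (T \ A).card) :
    α * m ≤ cutCard G A (Finset.univ \ A) := by
  obtain ⟨T1, hT1, hc1⟩ := Finset.exists_subset_card_eq h1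
  obtain ⟨T2, hT2, hc2⟩ := Finset.exists_subset_card_eq h2
  have hd : Disjoint T1 T2 := by
    rw [Finset.disjoint_left]
    intro x hx hx'
    exact (Finset.mem_sdiff.1 (hT2 hx')).2 (Finset.mem_inter.1 (hT1 hx)).2
  obtain ⟨P, f, hf0, hP, -, hA, -, he⟩ := hwl T1 T2 (hT1.trans Finset.inter_subset_left)
    (hT2.trans Finset.sdiff_subset) hd (hc1.trans hc2.symm)
  have s1 : ∑ p ∈ P, f p = m := by
    rw [← Finset.sum_fiberwise_of_maps_to (s := P) (t := T1) (g := fun p => p.1)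
      (fun p hp => (hP p hp).1) f, Finset.sum_congr rfl hA]
    simp [hc1]
  set C := ((A ×ˢ (Finset.univ \ A)).filter (fun ab => G.Adj ab.1 ab.2)) with hC
  have s2 : ∑ p ∈ P, f p ≤ ∑ c ∈ C, ∑ p ∈ P.filter (fun p => s(c.1, c.2) ∈ p.2.2.edges), f p := by
    simp_rw [Finset.sum_filter]
    rw [Finset.sum_comm]
    refine Finset.sum_le_sum fun p hp => ?_
    obtain ⟨hp1, hp2⟩ := hP p hp
    obtain ⟨d, hd, hd1, hd2⟩ := p.2.2.exists_boundary_dart (A : Set V)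
      (by simpa using (Finset.mem_inter.1 (hT1 hp1)).2)
      (by simpa using (Finset.mem_sdiff.1 (hT2 hp2)).2)
    have hdC : (d.fst, d.snd) ∈ C := by
      rw [hC, Finset.mem_filter, Finset.mem_product]
      exact ⟨⟨by simpa using hd1, by simpa using hd2⟩, d.adj⟩
    have hde : s(d.fst, d.snd) ∈ p.2.2.edges := by
      rw [SimpleGraph.Walk.edges]
      exact List.mem_map.2 ⟨d, hd, rfl⟩
    have := Finset.single_le_sum (s := C)
      (f := fun c : V × V => if s(c.1, c.2) ∈ p.2.2.edges then f p else 0)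
      (fun c _ => by
        show 0 ≤ if s(c.1, c.2) ∈ p.2.2.edges then f p else 0
        split_ifs
        · exact hf0 p hp
        · exact le_refl _) hdC
    simpa [hde] using this
  have s3 : ∑ c ∈ C, ∑ p ∈ P.filter (fun p => s(c.1, c.2) ∈ p.2.2.edges), f p
      ≤ C.card * (1 / α) := by
    have := Finset.sum_le_card_nsmul C
      (fun c => ∑ p ∈ P.filter (fun p => s(c.1, c.2) ∈ p.2.2.edges), f p) (1 / α)
      (fun c _ => he s(c.1, c.2))
    simpa [nsmul_eq_mul] using this
  have s4 : (m : ℝ) ≤ C.card * (1 / α) := by linarith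
  have : α * m ≤ α * (C.card * (1 / α)) := by gcongr
  have e : α * (C.card * (1 / α)) = C.card := by field_simp
  rw [e] at this
  exact this

theorem cut_le [Fintype V] (G : SimpleGraph V) (Δ : ℕ) (hΔ : ∀ v, deg G v ≤ Δ)
    (A B : Finset V) (h : IsSep G A B) :
    cutCard G A (Finset.univ \ A) ≤ (A ∩ B).card * Δ := by
  have hsub : ((A ×ˢ (Finset.univ \ A)).filter (fun ab => G.Adj ab.1 ab.2)) ⊆
      (A ∩ B).biUnion (fun v => (Finset.univ.filter (fun u => G.Adj v u)).image
        (fun u => (v, u))) := by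
    rintro ⟨x, y⟩ hxy
    simp only [Finset.mem_filter, Finset.mem_product, Finset.mem_sdiff, Finset.mem_univ,
      true_and] at hxy
    obtain ⟨⟨hx, hy⟩, hadj⟩ := hxy
    simp only [Finset.mem_biUnion, Finset.mem_image, Finset.mem_filter, Finset.mem_univ, true_and]
    refine ⟨x, ?_, y, hadj, rfl⟩
    rw [Finset.mem_inter]
    refine ⟨hx, ?_⟩
    by_contra hxB
    exact h.2 x y hx hxB ((h.1 y).resolve_left hy) hy hadj
  refine (Finset.card_le_card hsub).trans ?_
  refine Finset.card_biUnion_le_card_mul _ _ _ fun v _ => ?_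
  exact Finset.card_image_le.trans (hΔ v)

theorem dichotomy [Fintype V] (G : SimpleGraph V) (Δ : ℕ) (hΔ : ∀ v, deg G v ≤ Δ)
    (T : Finset V) (α : ℝ) (hα0 : 0 < α) (hα1 : α ≤ 1) (hwl : WellLinked G T α)
    (A B : Finset V) (h : IsSep G A B)
    (hs : (A ∩ B).card < Nat.ceil (3 * α * (T.card : ℝ) / (10 * Δ))) :
    10 * (T ∩ A).card < 3 * T.card ∨ 10 * (T ∩ B).card < 3 * T.card := by
  rw [Nat.lt_ceil] at hs
  have hΔ0 : 0 < Δ := by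
    rcases Nat.eq_zero_or_pos Δ with h0 | h0
    · subst h0
      simp at hs
      have : (0 : ℝ) ≤ (A ∩ B).card := by positivity
      linarith
    · exact h0
  have hΔ1 : (1 : ℝ) ≤ Δ := by exact_mod_cast hΔ0
  rw [lt_div_iff₀ (by positivity)] at hs
  have gen : ∀ X Y : Finset V, IsSep G X Y → (X ∩ Y).card = (A ∩ B).card →
      10 * (T ∩ X).card < 3 * T.card ∨ 10 * (T \ X).card < 3 * T.card := by
    intro X Y hXY hc
    have b1 := cut_bound G T X α hα0 hwl (min (T ∩ X).card (T \ X).card) (min_le_left _ _)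
      (min_le_right _ _)
    have b2 : (cutCard G X (Finset.univ \ X) : ℝ) ≤ (A ∩ B).card * Δ := by
      have := cut_le G Δ hΔ X Y hXY
      rw [hc] at this
      exact_mod_cast this
    have b3 : α * (10 * (min (T ∩ X).card (T \ X).card : ℕ)) < α * (3 * T.card) := by nlinarith
    have b4 := lt_of_mul_lt_mul_left b3 hα0.le
    have b5 : 10 * min (T ∩ X).card (T \ X).card < 3 * T.card := by exact_mod_cast b4
    omega
  have hsmall : 10 * (A ∩ B).card < 3 * T.card := by
    have h0 : (0 : ℝ) ≤ (A ∩ B).card := by positivity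
    have h0' : (0 : ℝ) ≤ T.card := by positivity
    have : (10 * (A ∩ B).card : ℝ) < 3 * T.card := by nlinarith
    exact_mod_cast this
  have g1 := gen A B h rfl
  have g2 := gen B A h.swap (by rw [Finset.inter_comm])
  have c1 := Finset.card_inter_add_card_sdiff T A
  have c2 := Finset.card_inter_add_card_sdiff T B
  have c3 : (T ∩ A).card ≤ (T \ B).card + (A ∩ B).card := by
    refine (Finset.card_le_card ?_).trans (Finset.card_union_le _ _)
    intro x hx
    simp only [Finset.mem_inter, Finset.mem_union, Finset.mem_sdiff] at hx ⊢
    tauto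
  omega

theorem extract (f : Finset V → ℕ) (h0 : f ∅ = 0)
    (hsub : ∀ X Y, f (X ∪ Y) + f (X ∩ Y) ≤ f X + f Y)
    (hmono : ∀ X Y, X ⊆ Y → f X ≤ f Y)
    (hunit : ∀ v X, f (insert v X) ≤ f X + 1) (T : Finset V) :
    ∃ I ⊆ T, I.card = f T ∧ ∀ J ⊆ I, J.card ≤ f J := by
  have main : ∃ I ⊆ T, I.card = f T ∧ f I = f T := by
    induction T using Finset.induction_on with
    | empty => exact ⟨∅, le_refl _, by simp [h0], rfl⟩
    | insert v T0 hv ih =>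
      obtain ⟨I0, hI0, hc, hfI⟩ := ih
      have hm := hmono T0 (insert v T0) (Finset.subset_insert _ _)
      have hu := hunit v T0
      by_cases he : f (insert v T0) = f T0
      · exact ⟨I0, hI0.trans (Finset.subset_insert _ _), by omega, by omega⟩
      · refine ⟨insert v I0, Finset.insert_subset_insert _ hI0, ?_, ?_⟩
        · rw [Finset.card_insert_of_notMem (fun h => hv (hI0 h))]; omega
        · have hs := hsub T0 (insert v I0)
          have e1 : T0 ∪ insert v I0 = insert v T0 := by
            ext x
            simp only [Finset.mem_union, Finset.mem_insert]
            have := @hI0 x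
            tauto
          have e2 : T0 ∩ insert v I0 = I0 := by
            ext x
            simp only [Finset.mem_inter, Finset.mem_insert]
            have := @hI0 x
            constructor
            · rintro ⟨h1, h2 | h2⟩
              · exact absurd (h2 ▸ h1) hv
              · exact h2
            · intro h; exact ⟨this h, Or.inr h⟩
          rw [e1, e2] at hs
          have := hmono (insert v I0) (insert v T0) (Finset.insert_subset_insert _ hI0)
          omega
  obtain ⟨I, hI, hc, hfI⟩ := main
  refine ⟨I, hI, hc, fun J hJ => ?_⟩
  have grow : ∀ K : Finset V, f (K ∪ J) ≤ f J + K.card := by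
    intro K
    induction K using Finset.induction_on with
    | empty => simp
    | insert v K hv ih =>
      rw [Finset.insert_union, Finset.card_insert_of_notMem hv]
      have := hunit v (K ∪ J)
      omega
  have h1 := grow (I \ J)
  rw [Finset.sdiff_union_of_subset hJ, Finset.card_sdiff_of_subset hJ] at h1
  have := Finset.card_le_card hJ
  omega

/-- A separation of order less than `θ` whose first side has few vertices of `T`. -/
def Sml [Fintype V] (G : SimpleGraph V) (T : Finset V) (θ : ℕ) (A B : Finset V) : Prop :=
  IsSep G A B ∧ (A ∩ B).card < θ ∧ 10 * (T ∩ A).card < 3 * T.card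

/-- The rank function of the tangle matroid. -/
def rk [Fintype V] (G : SimpleGraph V) (T : Finset V) (θ : ℕ) (X : Finset V) : ℕ :=
  sInf {n | n = θ ∨ ∃ A B, Sml G T θ A B ∧ X ⊆ A ∧ (A ∩ B).card = n}

theorem rk_le_θ [Fintype V] (G : SimpleGraph V) (T : Finset V) (θ : ℕ) (X : Finset V) :
    rk G T θ X ≤ θ := Nat.sInf_le (Or.inl rfl)

theorem rk_le [Fintype V] {G : SimpleGraph V} {T : Finset V} {θ : ℕ} {X A B : Finset V}
    (h : Sml G T θ A B) (hX : X ⊆ A) : rk G T θ X ≤ (A ∩ B).card :=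
  Nat.sInf_le (Or.inr ⟨A, B, h, hX, rfl⟩)

theorem rk_cases [Fintype V] (G : SimpleGraph V) (T : Finset V) (θ : ℕ) (X : Finset V) :
    rk G T θ X = θ ∨ ∃ A B, Sml G T θ A B ∧ X ⊆ A ∧ (A ∩ B).card = rk G T θ X :=
  Nat.sInf_mem (s := {n | n = θ ∨ ∃ A B, Sml G T θ A B ∧ X ⊆ A ∧ (A ∩ B).card = n})
    ⟨θ, Or.inl rfl⟩

theorem rk_mono [Fintype V] (G : SimpleGraph V) (T : Finset V) (θ : ℕ) (X Y : Finset V)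
    (h : X ⊆ Y) : rk G T θ X ≤ rk G T θ Y := by
  rcases rk_cases G T θ Y with hY | ⟨A, B, hs, hA, hc⟩
  · rw [hY]; exact rk_le_θ _ _ _ _
  · rw [← hc]; exact rk_le hs (h.trans hA)

/-- The large side of a small separation has many vertices of `T`. -/
theorem card_cover [Fintype V] {G : SimpleGraph V} (T : Finset V) {A B : Finset V}
    (h : IsSep G A B) : T.card ≤ (T ∩ A).card + (T ∩ B).card := by
  refine (Finset.card_le_card ?_).trans (Finset.card_union_le _ _)
  intro x hx
  have := h.1 x
  simp only [Finset.mem_inter, Finset.mem_union]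
  tauto

theorem sep_union [Fintype V] {G : SimpleGraph V} {A B C D : Finset V}
    (hAB : IsSep G A B) (hCD : IsSep G C D) : IsSep G (A ∪ C) (B ∩ D) := by
  refine ⟨fun x => ?_, fun x y hx hx' hy hy' hadj => ?_⟩
  · have := hAB.1 x
    have := hCD.1 x
    simp only [Finset.mem_union, Finset.mem_inter]
    tauto
  · rw [Finset.mem_inter] at hy hx'
    rw [Finset.mem_union, not_or] at hy'
    by_cases hxB : x ∈ B
    · have hxD : x ∉ D := fun h => hx' ⟨hxB, h⟩
      exact hCD.2 x y ((hCD.1 x).resolve_right hxD) hxD hy.2 hy'.2 hadj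
    · exact hAB.2 x y ((hAB.1 x).resolve_right hxB) hxB hy.1 hy'.1 hadj

theorem nodewl_of_dich [Fintype V] (G : SimpleGraph V) (T : Finset V) (θ : ℕ)
    (hθ : 0 < θ → 0 < T.card)
    (hd : ∀ A B, IsSep G A B → (A ∩ B).card < θ →
      10 * (T ∩ A).card < 3 * T.card ∨ 10 * (T ∩ B).card < 3 * T.card) :
    ∃ T' : Finset V, T' ⊆ T ∧ T'.card = θ ∧ NodeWellLinked G T' := by
  suffices hkey : ∃ I ⊆ T, I.card = rk G T θ T ∧ ∀ J ⊆ I, J.card ≤ rk G T θ J by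
    obtain ⟨I, hI, hc, hJ⟩ := hkey
    have hT : rk G T θ T = θ := by
      rcases rk_cases G T θ T with h | ⟨A, B, hs, hA, -⟩
      · exact h
      · have := hs.2.2
        rw [Finset.inter_eq_left.2 hA] at this
        omega
    rw [hT] at hc
    refine ⟨I, hI, hc, ?_⟩
    intro T1 T2 h1 h2 _ he
    apply menger
    intro X Y hXY hX hY
    by_contra hlt
    push Not at hlt
    have hlt' : (X ∩ Y).card < θ := by
      have := Finset.card_le_card h1
      omega
    rcases hd X Y hXY hlt' with h | h
    · have a1 := rk_le (G := G) (θ := θ) (B := Y) ⟨hXY, hlt', h⟩ hX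
      have a2 := hJ T1 h1
      omega
    · rw [Finset.inter_comm] at hlt' hlt
      have a1 := rk_le (G := G) (θ := θ) (B := X) ⟨hXY.swap, hlt', h⟩ hY
      have a2 := hJ T2 h2
      omega
  refine extract (rk G T θ) ?_ ?_ (rk_mono G T θ) ?_ T
  · rcases Nat.eq_zero_or_pos θ with h | h
    · have := rk_le_θ G T θ ∅
      omega
    · have hs : Sml G T θ ∅ Finset.univ := by
        refine ⟨⟨fun x => Or.inr (Finset.mem_univ _), fun x y hx => ?_⟩, by simpa using h, ?_⟩
        · simp at hx
        · have := hθ h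
          simp only [Finset.inter_empty, Finset.card_empty]
          omega
      have := rk_le hs (Finset.Subset.refl ∅)
      simpa using this
  · intro X Y
    rcases rk_cases G T θ X with hX | ⟨A, B, hAB, hA, hcX⟩
    · rw [hX]
      have := rk_le_θ G T θ (X ∪ Y)
      have := rk_mono G T θ (X ∩ Y) Y Finset.inter_subset_right
      omega
    rcases rk_cases G T θ Y with hY | ⟨C, D, hCD, hC, hcY⟩
    · rw [hY]
      have := rk_le_θ G T θ (X ∪ Y)
      have := rk_mono G T θ (X ∩ Y) X Finset.inter_subset_left
      omega
    have sep1 : IsSep G (A ∪ C) (B ∩ D) := sep_union hAB.1 hCD.1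
    have sep2 : IsSep G (A ∩ C) (B ∪ D) := (sep_union hAB.1.swap hCD.1.swap).swap
    have hsum : ((A ∪ C) ∩ (B ∩ D)).card + ((A ∩ C) ∩ (B ∪ D)).card
        ≤ (A ∩ B).card + (C ∩ D).card := by
      rw [← Finset.card_union_add_card_inter (A ∩ B) (C ∩ D),
        ← Finset.card_union_add_card_inter ((A ∪ C) ∩ (B ∩ D))]
      apply Nat.add_le_add
      · apply Finset.card_le_card
        intro x
        simp only [Finset.mem_union, Finset.mem_inter]
        tauto
      · apply Finset.card_le_card
        intro x
        simp only [Finset.mem_union, Finset.mem_inter]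
        tauto
    have b1 : rk G T θ (X ∪ Y) ≤ ((A ∪ C) ∩ (B ∩ D)).card := by
      by_cases hlt : ((A ∪ C) ∩ (B ∩ D)).card < θ
      · refine rk_le ⟨sep1, hlt, ?_⟩ (Finset.union_subset_union hA hC)
        rcases hd _ _ sep1 hlt with h | h
        · exact h
        · exfalso
          have c1 := card_cover T sep1
          have c2 : (T ∩ (A ∪ C)).card ≤ (T ∩ A).card + (T ∩ C).card := by
            rw [Finset.inter_union_distrib_left]
            exact Finset.card_union_le _ _
          have c3 := hAB.2.2
          have c4 := hCD.2.2
          omega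
      · have := rk_le_θ G T θ (X ∪ Y)
        omega
    have b2 : rk G T θ (X ∩ Y) ≤ ((A ∩ C) ∩ (B ∪ D)).card := by
      by_cases hlt : ((A ∩ C) ∩ (B ∪ D)).card < θ
      · refine rk_le ⟨sep2, hlt, ?_⟩ (Finset.inter_subset_inter hA hC)
        have c1 : (T ∩ (A ∩ C)).card ≤ (T ∩ A).card :=
          Finset.card_le_card (Finset.inter_subset_inter_left Finset.inter_subset_left)
        have c3 := hAB.2.2
        omega
      · have := rk_le_θ G T θ (X ∩ Y)
        omega
    omega
  · intro v X
    rcases rk_cases G T θ X with hX | ⟨A, B, hAB, hA, hcX⟩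
    · have := rk_le_θ G T θ (insert v X)
      omega
    have sep : IsSep G (insert v A) (insert v B) := by
      refine ⟨fun x => ?_, fun x y hx hx' hy hy' hadj => ?_⟩
      · have := hAB.1.1 x
        simp only [Finset.mem_insert]
        tauto
      · simp only [Finset.mem_insert] at hx hx' hy hy'
        have a3 := hAB.1.2 x y
        tauto
    have hcard : (insert v A ∩ insert v B).card ≤ (A ∩ B).card + 1 := by
      rw [← Finset.insert_inter_distrib]
      exact Finset.card_insert_le _ _
    by_cases hlt : (insert v A ∩ insert v B).card < θ
    · have : rk G T θ (insert v X) ≤ (insert v A ∩ insert v B).card := by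
        refine rk_le ⟨sep, hlt, ?_⟩ (Finset.insert_subset_insert _ hA)
        rcases hd _ _ sep hlt with h | h
        · exact h
        · exfalso
          have c1 := card_cover T hAB.1
          have c2 : (T ∩ B).card ≤ (T ∩ insert v B).card :=
            Finset.card_le_card (Finset.inter_subset_inter_left (Finset.subset_insert _ _))
          have c3 := hAB.2.2
          omega
      omega
    · have := rk_le_θ G T θ (insert v X)
      omega

/-- From an `α`-well-linked set of `κ` vertices in a connected graph of
maximum degree `Δ` one can extract a node-well-linked subset of size `⌈3ακ/(10Δ)⌉`. -/
theorem stmt6 [Fintype V] (G : SimpleGraph V) (hconn : G.Connected)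
    (Δ : ℕ) (hΔ : ∀ v, deg G v ≤ Δ)
    (T : Finset V) (κ : ℕ) (hκ : T.card = κ)
    (α : ℝ) (hα0 : 0 < α) (hα1 : α ≤ 1) (hwl : WellLinked G T α) :
    ∃ T' : Finset V, T' ⊆ T ∧
      T'.card = Nat.ceil (3 * α * (κ : ℝ) / (10 * Δ)) ∧
      NodeWellLinked G T' := by


  subst hκ
  refine nodewl_of_dich G T _ ?_ (dichotomy G Δ hΔ T α hα0 hα1 hwl)
  intro h
  by_contra h0
  have : T.card = 0 := by omega
  simp [this] at h
end
end

section
/- Let k be the size of the largest node-well-linked vertex set in a graph G. Then k/4 − 1 ≤ tw(G) ≤ k − 1, where tw(G) denotes the treewidth of G. -/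
attribute [local instance] Classical.propDecidable

noncomputable section

variable {V : Type}

/-- `G` admits a tree-decomposition of width at most `w`: there is a tree `τ` and a bag
`bag i ⊆ V` for each node `i`, such that every edge of `G` is contained in some bag,
for every vertex `v` the nodes whose bags contain `v` induce a nonempty connected
subtree, and every bag has at most `w + 1` vertices. -/
def HasTreeDecompOfWidthLE [Fintype V] (G : SimpleGraph V) (w : ℝ) : Prop :=
  ∃ (ι : Type) (_ : Fintype ι) (τ : SimpleGraph ι) (_ : τ.IsTree) (bag : ι → Finset V),
    (∀ u v : V, G.Adj u v → ∃ i, u ∈ bag i ∧ v ∈ bag i) ∧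
    (∀ v : V, (τ.induce {i | v ∈ bag i}).Connected) ∧
    (∀ i, ((bag i).card : ℝ) ≤ w + 1)

open SimpleGraph

/-- `S` is (pre)connected inside `G`. -/
def CS {α : Type} (G : SimpleGraph α) (S : Set α) : Prop :=
  ∀ u ∈ S, ∀ v ∈ S, ∃ p : G.Walk u v, ∀ x ∈ p.support, x ∈ S

lemma CS.of_induce {α : Type} {G : SimpleGraph α} {S : Set α}
    (h : (G.induce S).Preconnected) : CS G S := by
  intro u hu v hv
  obtain ⟨p⟩ := h ⟨u, hu⟩ ⟨v, hv⟩
  refine ⟨p.map (SimpleGraph.Embedding.induce S).toHom, ?_⟩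
  intro x hx
  have hx' : x ∈ p.support.map (SimpleGraph.Embedding.induce (G := G) S).toHom := by
    rw [← Walk.support_map]
    exact hx
  rw [List.mem_map] at hx'
  obtain ⟨y, _, rfl⟩ := hx'
  exact y.2

lemma CS.to_induce {α : Type} {G : SimpleGraph α} {S : Set α}
    (h : CS G S) : (G.induce S).Preconnected := by
  rintro ⟨u, hu⟩ ⟨v, hv⟩
  obtain ⟨p, hp⟩ := h u hu v hv
  exact ⟨p.induce S hp⟩

lemma CS.of_center {α : Type} {G : SimpleGraph α} {S : Set α} (x : α)
    (h : ∀ u ∈ S, ∃ p : G.Walk u x, ∀ y ∈ p.support, y ∈ S) : CS G S := by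
  intro u hu v hv
  obtain ⟨p, hp⟩ := h u hu
  obtain ⟨q, hq⟩ := h v hv
  refine ⟨p.append q.reverse, ?_⟩
  intro y hy
  rw [Walk.mem_support_append_iff] at hy
  rcases hy with hy | hy
  · exact hp y hy
  · rw [Walk.support_reverse, List.mem_reverse] at hy
    exact hq y hy

lemma CS.union {α : Type} {G : SimpleGraph α} {S T : Set α} (hS : CS G S) (hT : CS G T)
    (x : α) (hx : x ∈ S) (hx' : x ∈ T) : CS G (S ∪ T) := by
  refine CS.of_center x ?_
  rintro u (hu | hu)
  · obtain ⟨p, hp⟩ := hS u hu x hx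
    exact ⟨p, fun y hy => Or.inl (hp y hy)⟩
  · obtain ⟨p, hp⟩ := hT u hu x hx'
    exact ⟨p, fun y hy => Or.inr (hp y hy)⟩

/-- The path between two nodes of a tree. -/
def tp {ι : Type} {τ : SimpleGraph ι} (h : τ.IsTree) (a b : ι) : τ.Walk a b :=
  (h.existsUnique_path a b).choose

lemma tp_isPath {ι : Type} {τ : SimpleGraph ι} (h : τ.IsTree) (a b : ι) : (tp h a b).IsPath :=
  (h.existsUnique_path a b).choose_spec.1

lemma tp_unique {ι : Type} {τ : SimpleGraph ι} (h : τ.IsTree) {a b : ι} (p : τ.Walk a b)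
    (hp : p.IsPath) : p = tp h a b :=
  (h.existsUnique_path a b).choose_spec.2 p hp

lemma tp_sub {ι : Type} {τ : SimpleGraph ι} (h : τ.IsTree) {a b : ι} (p : τ.Walk a b) :
    ∀ x ∈ (tp h a b).support, x ∈ p.support := by
  intro x hx
  rw [← tp_unique h p.bypass p.bypass_isPath] at hx
  exact p.support_bypass_subset_support hx

lemma CS.convex {ι : Type} {τ : SimpleGraph ι} (h : τ.IsTree) {S : Set ι} (hS : CS τ S)
    {a b : ι} (ha : a ∈ S) (hb : b ∈ S) : ∀ x ∈ (tp h a b).support, x ∈ S := by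
  intro x hx
  obtain ⟨p, hp⟩ := hS a ha b hb
  exact hp x (tp_sub h p x hx)

/-- Menger's theorem, via Hall's theorem. -/
lemma menger_s8 [Fintype V] (G : SimpleGraph V) (A B : Finset V)
    (h : ∀ S : Finset V, (∀ a ∈ A, ∀ b ∈ B, ∀ p : G.Walk a b, ∃ x ∈ p.support, x ∈ S) →
      A.card ≤ S.card) :
    ∃ O : V → Set V, (∀ a ∈ A, ∀ a' ∈ A, a ≠ a' → ∀ x ∈ O a, x ∉ O a') ∧
      ∀ a ∈ A, ∃ b ∈ B, ∃ p : G.Walk a b, p.IsPath ∧ ∀ x ∈ p.support, x ∈ O a := by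
  let t : {v // v ∉ B} → Finset V := fun v =>
    Finset.univ.filter (fun u => (u = v.1 ∨ G.Adj v.1 u) ∧ u ∉ A)
  have hall : ∀ s : Finset {v // v ∉ B}, s.card ≤ (s.biUnion t).card := by
    intro s
    by_contra hlt
    push Not at hlt
    let X : Finset V := s.map (Function.Embedding.subtype _)
    have hXc : X.card = s.card := Finset.card_map _
    have hXB : ∀ v ∈ X, v ∉ B := by
      intro v hv
      simp only [X, Finset.mem_map] at hv
      obtain ⟨y, _, rfl⟩ := hv
      exact y.2
    let N : Finset V := Finset.univ.filter (fun u => ∃ v ∈ X, u = v ∨ G.Adj v u)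
    have hXN : X ⊆ N := by
      intro v hv
      simp only [N, Finset.mem_filter, Finset.mem_univ, true_and]
      exact ⟨v, hv, Or.inl rfl⟩
    have hbi : s.biUnion t = N \ A := by
      ext u
      simp only [t, N, X, Finset.mem_biUnion, Finset.mem_filter, Finset.mem_univ, true_and,
        Finset.mem_sdiff, Finset.mem_map, Function.Embedding.subtype_apply]
      constructor
      · rintro ⟨a, ha, h1, h2⟩
        exact ⟨⟨a.1, ⟨a, ha, rfl⟩, h1⟩, h2⟩
      · rintro ⟨⟨_, ⟨a, ha, rfl⟩, h1⟩, h2⟩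
        exact ⟨a, ha, h1, h2⟩
    have hS := h ((A \ N) ∪ (N \ X)) (by
      intro a ha b hb p
      by_cases haX : a ∈ X
      · obtain ⟨d, hd, h1, h2⟩ := p.exists_boundary_dart (↑X : Set V) haX
          (fun hbX => hXB b hbX hb)
        refine ⟨d.snd, p.dart_snd_mem_support_of_mem_darts hd, ?_⟩
        refine Finset.mem_union_right _ (Finset.mem_sdiff.2 ⟨?_, h2⟩)
        simp only [N, Finset.mem_filter, Finset.mem_univ, true_and]
        exact ⟨d.fst, h1, Or.inr d.adj⟩
      · refine ⟨a, p.start_mem_support, ?_⟩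
        by_cases haN : a ∈ N
        · exact Finset.mem_union_right _ (Finset.mem_sdiff.2 ⟨haN, haX⟩)
        · exact Finset.mem_union_left _ (Finset.mem_sdiff.2 ⟨ha, haN⟩))
    have h1 := Finset.card_union_le (A \ N) (N \ X)
    have h2 := Finset.card_sdiff_add_card_inter A N
    have h3 := Finset.card_sdiff_add_card_inter N A
    have h4 := Finset.card_sdiff_add_card_eq_card hXN
    rw [Finset.inter_comm] at h3
    rw [hbi] at hlt
    omega
  obtain ⟨f, hf, hft⟩ := (Finset.all_card_le_biUnion_card_iff_exists_injective t).1 hall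
  let F : V → V := fun v => if h : v ∉ B then f ⟨v, h⟩ else v
  have hF1 : ∀ v, v ∉ B → F v ∉ A ∧ (F v = v ∨ G.Adj v (F v)) := by
    intro v hv
    have := hft ⟨v, hv⟩
    simp only [t, Finset.mem_filter, Finset.mem_univ, true_and] at this
    simp only [F, dif_pos hv]
    exact ⟨this.2, this.1⟩
  have hF2 : ∀ v w, v ∉ B → w ∉ B → F v = F w → v = w := by
    intro v w hv hw hvw
    simp only [F, dif_pos hv, dif_pos hw] at hvw
    exact congrArg Subtype.val (hf hvw)
  have hex : ∀ a ∈ A, ∃ n, F^[n] a ∈ B := by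
    intro a ha
    by_contra hno
    push Not at hno
    have key : ∀ m d, F^[m] a = F^[m + (d + 1)] a → False := by
      intro m
      induction m with
      | zero =>
        intro d hd
        rw [zero_add, Function.iterate_succ_apply'] at hd
        exact (hF1 _ (hno d)).1 (hd ▸ ha)
      | succ m ih =>
        intro d hd
        rw [show m + 1 + (d + 1) = (m + (d + 1)) + 1 by ring, Function.iterate_succ_apply',
          Function.iterate_succ_apply'] at hd
        exact ih d (hF2 _ _ (hno _) (hno _) hd)
    obtain ⟨m, n, hmn, heq⟩ := Finite.exists_ne_map_eq_of_infinite (fun n : ℕ => F^[n] a)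
    rcases lt_or_gt_of_ne hmn with hlt | hlt
    · obtain ⟨d, rfl⟩ := Nat.exists_eq_add_of_lt hlt
      exact key m d heq
    · obtain ⟨d, rfl⟩ := Nat.exists_eq_add_of_lt hlt
      exact key n d heq.symm
  have hex' : ∀ a, ∃ n, a ∈ A → F^[n] a ∈ B ∧ ∀ i < n, F^[i] a ∉ B := by
    intro a
    by_cases ha : a ∈ A
    · exact ⟨Nat.find (hex a ha), fun _ => ⟨Nat.find_spec (hex a ha),
        fun i hi => Nat.find_min (hex a ha) hi⟩⟩
    · exact ⟨0, fun h => absurd h ha⟩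
  choose n hn using hex'
  refine ⟨fun a => {x | ∃ i ≤ n a, F^[i] a = x}, ?_, ?_⟩
  · have key : ∀ i j a a', a ∈ A → a' ∈ A → i ≤ n a → j ≤ n a' → F^[i] a = F^[j] a' → a = a' := by
      intro i
      induction i with
      | zero =>
        intro j a a' ha ha' hi hj heq
        cases j with
        | zero => exact heq
        | succ j =>
          rw [Function.iterate_succ_apply'] at heq
          exact absurd (show F (F^[j] a') ∈ A from heq ▸ ha)
            (hF1 _ ((hn a' ha').2 j (by omega))).1
      | succ i ih =>
        intro j a a' ha ha' hi hj heq
        cases j with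
        | zero =>
          rw [Function.iterate_succ_apply'] at heq
          exact absurd (show F (F^[i] a) ∈ A from heq ▸ ha')
            (hF1 _ ((hn a ha).2 i (by omega))).1
        | succ j =>
          rw [Function.iterate_succ_apply', Function.iterate_succ_apply'] at heq
          exact ih j a a' ha ha' (by omega) (by omega)
            (hF2 _ _ ((hn a ha).2 i (by omega)) ((hn a' ha').2 j (by omega)) heq)
    rintro a ha a' ha' hne x ⟨i, hi, rfl⟩ ⟨j, hj, heq⟩
    exact hne (key i j a a' ha ha' hi hj heq.symm)
  · intro a ha
    have key : ∀ i, i ≤ n a → ∃ p : G.Walk a (F^[i] a), ∀ x ∈ p.support,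
        ∃ i ≤ n a, F^[i] a = x := by
      intro i
      induction i with
      | zero =>
        intro _
        refine ⟨Walk.nil, ?_⟩
        intro x hx
        simp at hx
        exact ⟨0, Nat.zero_le _, hx.symm⟩
      | succ i ih =>
        intro hi
        obtain ⟨p, hp⟩ := ih (by omega)
        have h1 := (hF1 _ ((hn a ha).2 i (by omega))).2
        rw [Function.iterate_succ_apply']
        rcases h1 with h1 | h1
        · rw [h1]
          exact ⟨p, hp⟩
        · refine ⟨p.concat h1, ?_⟩
          intro x hx
          simp only [Walk.support_concat, List.mem_append,
            List.mem_singleton] at hx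
          rcases hx with hx | hx
          · exact hp x hx
          · exact ⟨i + 1, hi, by rw [Function.iterate_succ_apply', hx]⟩
    obtain ⟨p, hp⟩ := key (n a) le_rfl
    exact ⟨_, (hn a ha).1, p.bypass, p.bypass_isPath,
      fun x hx => hp x (p.support_bypass_subset_support hx)⟩

/-- Tree-decomposition of `G[U]`. -/
structure TD (G : SimpleGraph V) (U : Finset V) {ι : Type} (τ : SimpleGraph ι)
    (bag : ι → Finset V) : Prop where
  tree : τ.IsTree
  sub : ∀ i, bag i ⊆ U
  cover : ∀ v ∈ U, ∃ i, v ∈ bag i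
  edge : ∀ u ∈ U, ∀ v ∈ U, G.Adj u v → ∃ i, u ∈ bag i ∧ v ∈ bag i
  conn : ∀ v, CS τ {i | v ∈ bag i}

lemma TD.walk_lift {G : SimpleGraph V} {U : Finset V} {ι : Type} {τ : SimpleGraph ι}
    {bag : ι → Finset V} (h : TD G U τ bag) {u v : V} (p : G.Walk u v)
    (hp : ∀ x ∈ p.support, x ∈ U) : ∀ i j, u ∈ bag i → v ∈ bag j →
    ∃ q : τ.Walk i j, ∀ m ∈ q.support, ∃ x ∈ p.support, x ∈ bag m := by
  induction p with
  | nil =>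
    intro i j hi hj
    obtain ⟨q, hq⟩ := h.conn _ i hi j hj
    exact ⟨q, fun m hm => ⟨_, Walk.start_mem_support _, hq m hm⟩⟩
  | @cons u w v hadj p ih =>
    intro i j hi hj
    have hp' : ∀ x ∈ p.support, x ∈ U := fun x hx => hp x (by simp [hx])
    obtain ⟨m, hm1, hm2⟩ := h.edge u (hp u (by simp)) w (hp' w p.start_mem_support) hadj
    obtain ⟨q, hq⟩ := ih hp' m j hm2 hj
    obtain ⟨q', hq'⟩ := h.conn u i hi m hm1
    refine ⟨q'.append q, ?_⟩
    intro y hy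
    rw [Walk.mem_support_append_iff] at hy
    rcases hy with hy | hy
    · exact ⟨u, by simp, hq' y hy⟩
    · obtain ⟨x, hx, hxy⟩ := hq y hy
      exact ⟨x, by simp [hx], hxy⟩

lemma TD.sep {G : SimpleGraph V} {U : Finset V} {ι : Type} {τ : SimpleGraph ι}
    {bag : ι → Finset V} (h : TD G U τ bag) {u v : V} (p : G.Walk u v)
    (hp : ∀ x ∈ p.support, x ∈ U) {i j : ι} (hi : u ∈ bag i) (hj : v ∈ bag j) {t : ι}
    (ht : t ∈ (tp h.tree i j).support) : ∃ x ∈ p.support, x ∈ bag t := by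
  obtain ⟨q, hq⟩ := h.walk_lift p hp i j hi hj
  exact hq t (tp_sub h.tree q t ht)

lemma TD.hits {G : SimpleGraph V} {U : Finset V} {ι : Type} {τ : SimpleGraph ι}
    {bag : ι → Finset V} (h : TD G U τ bag) {B : Finset V} (hB : B ⊆ U) (hc : CS G (↑B : Set V)) :
    CS τ {i | ∃ v ∈ B, v ∈ bag i} := by
  rintro i ⟨u, hu, hui⟩ j ⟨v, hv, hvj⟩
  obtain ⟨p, hp⟩ := hc u hu v hv
  obtain ⟨q, hq⟩ := h.walk_lift p (fun x hx => hB (hp x hx)) i j hui hvj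
  refine ⟨q, fun m hm => ?_⟩
  obtain ⟨x, hx, hxm⟩ := hq m hm
  exact ⟨x, hp x hx, hxm⟩

lemma sum_walk_proj {α β : Type} {G : SimpleGraph α} {H : SimpleGraph β} {x y : α ⊕ β}
    (p : (G ⊕g H).Walk x y) : ∀ a b, x = Sum.inl a → y = Sum.inl b →
    ∃ q : G.Walk a b, ∀ e ∈ q.edges, e.map Sum.inl ∈ p.edges := by
  induction p with
  | nil =>
    intro a b ha hb
    subst ha
    cases hb
    exact ⟨Walk.nil, by simp⟩
  | @cons x z y hadj p ih =>
    intro a b ha hb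
    subst ha
    cases z with
    | inr z => exact absurd hadj (by simp)
    | inl z =>
      obtain ⟨q, hq⟩ := ih z b rfl hb
      have hadj' : G.Adj a z := by simpa using hadj
      refine ⟨Walk.cons hadj' q, ?_⟩
      intro e he
      rw [Walk.edges_cons, List.mem_cons] at he
      rw [Walk.edges_cons, List.mem_cons]
      rcases he with rfl | he
      · left; simp
      · right; exact hq e he

lemma sum_bridge_inl {α β : Type} {G : SimpleGraph α} {H : SimpleGraph β} (hG : G.IsAcyclic)
    {a b : α} (hab : G.Adj a b) : (G ⊕g H).IsBridge s(Sum.inl a, Sum.inl b) := by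
  rw [isBridge_iff_forall_walk_mem_edges]
  intro p
  obtain ⟨q, hq⟩ := sum_walk_proj p a b rfl rfl
  have := isBridge_iff_forall_walk_mem_edges.1 (isAcyclic_iff_forall_adj_isBridge.1 hG hab) q
  simpa using hq _ this

lemma sum_acyclic {α β : Type} {G : SimpleGraph α} {H : SimpleGraph β} (hG : G.IsAcyclic)
    (hH : H.IsAcyclic) : (G ⊕g H).IsAcyclic := by
  intro x c hc
  have hL : ∀ (α β : Type) (G : SimpleGraph α) (H : SimpleGraph β) (hG : G.IsAcyclic) (a : α)
      (c : (G ⊕g H).Walk (Sum.inl a) (Sum.inl a)), ¬ c.IsCycle := by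
    intro α β G H hG a c hc
    cases c with
    | nil => exact hc.not_nil Walk.nil_nil
    | @cons _ z _ hadj p =>
      cases z with
      | inr z => exact absurd hadj (by simp)
      | inl z =>
        have hadj' : G.Adj a z := by simpa using hadj
        have hb := sum_bridge_inl (H := H) hG hadj'
        exact (isBridge_iff_forall_cycle_notMem hadj).1 hb _ hc (by simp)
  cases x with
  | inl a => exact hL _ _ _ _ hG a c hc
  | inr b =>
    have := hL _ _ _ _ hH b (c.map (Iso.sumComm (G := G) (H := H)).toHom)
    exact this (hc.map (Iso.sumComm (G := G) (H := H)).injective)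

lemma CS.map {α β : Type} {G : SimpleGraph α} {H : SimpleGraph β} (f : G →g H) {S : Set α}
    (h : CS G S) : CS H (f '' S) := by
  rintro _ ⟨u, hu, rfl⟩ _ ⟨v, hv, rfl⟩
  obtain ⟨p, hp⟩ := h u hu v hv
  refine ⟨p.map f, ?_⟩
  intro x hx
  rw [Walk.support_map, List.mem_map] at hx
  obtain ⟨y, hy, rfl⟩ := hx
  exact ⟨y, hp y hy, rfl⟩

/-- `G[U]` has a tree-decomposition all of whose bags satisfy `Q`, with `X` among the bags. -/
def HasTD (G : SimpleGraph V) (U : Finset V) (Q : Finset V → Prop) (X : Finset V) : Prop :=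
  ∃ (ι : Type) (_ : Fintype ι) (τ : SimpleGraph ι) (bag : ι → Finset V),
    TD G U τ bag ∧ (∀ i, Q (bag i)) ∧ ∃ s, bag s = X

lemma HasTD.single (G : SimpleGraph V) (U : Finset V) (Q : Finset V → Prop) (hQ : Q U) :
    HasTD G U Q U := by
  refine ⟨Unit, inferInstance, ⊥, fun _ => U, ⟨IsTree.of_subsingleton, fun _ => subset_rfl,
    fun v hv => ⟨(), hv⟩, fun u hu v hv _ => ⟨(), hu, hv⟩, ?_⟩, fun _ => hQ, (), rfl⟩
  intro v i hi j hj
  exact ⟨Walk.nil, fun x _ => hi⟩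

lemma HasTD.glue {G : SimpleGraph V} {U₁ U₂ X₁ X₂ : Finset V} {Q : Finset V → Prop}
    (h₁ : HasTD G U₁ Q X₁) (h₂ : HasTD G U₂ Q X₂)
    (hX : ∀ v ∈ U₁, v ∈ U₂ → v ∈ X₁ ∧ v ∈ X₂)
    (he : ∀ u ∈ U₁ ∪ U₂, ∀ v ∈ U₁ ∪ U₂, G.Adj u v → (u ∈ U₁ ∧ v ∈ U₁) ∨ (u ∈ U₂ ∧ v ∈ U₂)) :
    HasTD G (U₁ ∪ U₂) Q X₁ := by
  obtain ⟨ι₁, _, τ₁, bag₁, t₁, q₁, s₁, hs₁⟩ := h₁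
  obtain ⟨ι₂, _, τ₂, bag₂, t₂, q₂, s₂, hs₂⟩ := h₂
  let τ : SimpleGraph (ι₁ ⊕ ι₂) := (τ₁ ⊕g τ₂) ⊔ SimpleGraph.edge (Sum.inl s₁) (Sum.inr s₂)
  have hle : (τ₁ ⊕g τ₂) ≤ τ := le_sup_left
  let f₁ : τ₁ →g τ := ⟨Sum.inl, fun {a b} hab => hle (by simpa using hab)⟩
  let f₂ : τ₂ →g τ := ⟨Sum.inr, fun {a b} hab => hle (by simpa using hab)⟩
  have hadj : τ.Adj (Sum.inr s₂) (Sum.inl s₁) := by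
    simp [τ, SimpleGraph.edge_adj]
  refine ⟨ι₁ ⊕ ι₂, inferInstance, τ, Sum.elim bag₁ bag₂, ⟨⟨?_, ?_⟩, ?_, ?_, ?_, ?_⟩, ?_,
    Sum.inl s₁, hs₁⟩
  · exact t₁.tree.connected.sum_sup_edge t₂.tree.connected
  · exact IsAcyclic.sup_edge_of_not_reachable (not_reachable_sum_inl_inr _ _)
      (sum_acyclic t₁.tree.isAcyclic t₂.tree.isAcyclic)
  · rintro (i | i)
    · exact (t₁.sub i).trans Finset.subset_union_left
    · exact (t₂.sub i).trans Finset.subset_union_right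
  · intro v hv
    rcases Finset.mem_union.1 hv with hv | hv
    · obtain ⟨i, hi⟩ := t₁.cover v hv
      exact ⟨Sum.inl i, hi⟩
    · obtain ⟨i, hi⟩ := t₂.cover v hv
      exact ⟨Sum.inr i, hi⟩
  · intro u hu v hv huv
    rcases he u hu v hv huv with ⟨h1, h2⟩ | ⟨h1, h2⟩
    · obtain ⟨i, hi⟩ := t₁.edge u h1 v h2 huv
      exact ⟨Sum.inl i, hi⟩
    · obtain ⟨i, hi⟩ := t₂.edge u h1 v h2 huv
      exact ⟨Sum.inr i, hi⟩
  · intro v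
    have c₁ := (t₁.conn v).map f₁
    have c₂ := (t₂.conn v).map f₂
    by_cases hv1 : v ∈ U₁
    · by_cases hv2 : v ∈ U₂
      · obtain ⟨hvX₁, hvX₂⟩ := hX v hv1 hv2
        rw [← hs₁] at hvX₁
        rw [← hs₂] at hvX₂
        refine CS.of_center (Sum.inl s₁) ?_
        rintro (i | i) hi
        · obtain ⟨p, hp⟩ := c₁ (Sum.inl i) ⟨i, hi, rfl⟩ (Sum.inl s₁) ⟨s₁, hvX₁, rfl⟩
          refine ⟨p, fun y hy => ?_⟩
          obtain ⟨z, hz, rfl⟩ := hp y hy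
          exact hz
        · obtain ⟨p, hp⟩ := c₂ (Sum.inr i) ⟨i, hi, rfl⟩ (Sum.inr s₂) ⟨s₂, hvX₂, rfl⟩
          refine ⟨p.concat hadj, fun y hy => ?_⟩
          simp only [Walk.support_concat, List.mem_append,
            List.mem_singleton] at hy
          rcases hy with hy | rfl
          · obtain ⟨z, hz, rfl⟩ := hp y hy
            exact hz
          · exact hvX₁
      · convert c₁ using 1
        ext x
        constructor
        · intro hx
          rcases x with i | i
          · exact ⟨i, hx, rfl⟩
          · exact absurd (t₂.sub i hx) hv2
        · rintro ⟨z, hz, rfl⟩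
          exact hz
    · convert c₂ using 1
      ext x
      constructor
      · intro hx
        rcases x with i | i
        · exact absurd (t₁.sub i hx) hv1
        · exact ⟨i, hx, rfl⟩
      · rintro ⟨z, hz, rfl⟩
        exact hz
  · rintro (i | i)
    · exact q₁ i
    · exact q₂ i

lemma CS_support {α : Type} {G : SimpleGraph α} {u v : α} (p : G.Walk u v) :
    CS G {t | t ∈ p.support} := by
  refine CS.of_center v ?_
  intro x hx
  exact ⟨p.dropUntil x hx, fun y hy => p.support_dropUntil_subset_support hx hy⟩

/-- Two vertex sets touch. -/
def Touch (G : SimpleGraph V) (b c : Finset V) : Prop := ∃ u ∈ b, ∃ v ∈ c, u = v ∨ G.Adj u v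

/-- Brambles. -/
def IsBr (G : SimpleGraph V) (B : Finset (Finset V)) : Prop :=
  (∀ b ∈ B, CS G (↑b : Set V)) ∧ ∀ b ∈ B, ∀ c ∈ B, Touch G b c

/-- `S` covers `B`. -/
def Covers (B : Finset (Finset V)) (S : Finset V) : Prop := ∀ b ∈ B, ∃ x ∈ b, x ∈ S

/-- Admissibility of a bag. -/
def Adm (k : ℕ) (B : Finset (Finset V)) (S : Finset V) : Prop := k < S.card → ¬ Covers B S

lemma cover_wl [Fintype V] {G : SimpleGraph V} {B : Finset (Finset V)} (hB : IsBr G B)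
    {H : Finset V} (hH : Covers B H) (hmin : ∀ S, Covers B S → H.card ≤ S.card) :
    NodeWellLinked G H := by
  intro A A' hA hA' hdis hcard
  obtain ⟨O, hO1, hO2⟩ := menger_s8 G A A' (by
    intro S hS
    by_contra hlt
    push Not at hlt
    have key : ∀ D : Finset V, D ⊆ H → D.card = A.card → ∃ b ∈ B, (∀ x ∈ b, x ∉ S) ∧
        ∃ x ∈ b, x ∈ D := by
      intro D hD hDc
      by_contra hno
      push Not at hno
      have := hmin ((H \ D) ∪ S) (by
        intro b hb
        by_cases hbS : ∀ x ∈ b, x ∉ S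
        · obtain ⟨x, hx, hxH⟩ := hH b hb
          exact ⟨x, hx, Finset.mem_union_left _ (Finset.mem_sdiff.2 ⟨hxH, hno b hb hbS x hx⟩)⟩
        · push Not at hbS
          obtain ⟨x, hx, hxS⟩ := hbS
          exact ⟨x, hx, Finset.mem_union_right _ hxS⟩)
      have h1 := Finset.card_union_le (H \ D) S
      have h2 := Finset.card_sdiff_add_card_eq_card hD
      omega
    obtain ⟨b, hb, hbS, x, hx, hxA⟩ := key A hA rfl
    obtain ⟨c, hc, hcS, y, hy, hyA⟩ := key A' hA' hcard.symm
    obtain ⟨u, hu, v, hv, huv⟩ := hB.2 b hb c hc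
    obtain ⟨p, hp⟩ := hB.1 b hb x hx u hu
    obtain ⟨q, hq⟩ := hB.1 c hc v hv y hy
    have : ∃ r : G.Walk u v, ∀ z ∈ r.support, z = u ∨ z = v := by
      rcases huv with rfl | huv
      · exact ⟨Walk.nil, by simp⟩
      · exact ⟨Walk.cons huv Walk.nil, by simp⟩
    obtain ⟨r, hr⟩ := this
    obtain ⟨z, hz, hzS⟩ := hS x hxA y hyA ((p.append r).append q)
    rw [Walk.mem_support_append_iff, Walk.mem_support_append_iff] at hz
    rcases hz with (hz | hz) | hz
    · exact hbS z (hp z hz) hzS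
    · rcases hr z hz with rfl | rfl
      · exact hbS _ hu hzS
      · exact hcS _ hv hzS
    · exact hcS z (hq z hz) hzS)
  choose e he P hP hPO using hO2
  refine ⟨A.attach.image (fun a => ⟨a.1, e a.1 a.2, P a.1 a.2⟩), ?_, ?_, ?_⟩
  · intro p hp
    obtain ⟨a, _, rfl⟩ := Finset.mem_image.1 hp
    exact ⟨hP _ _, a.2, he _ _⟩
  · intro a ha
    exact ⟨_, Finset.mem_image.2 ⟨⟨a, ha⟩, Finset.mem_attach _ _, rfl⟩, rfl⟩
  · intro p hp q hq hne x hx hx'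
    obtain ⟨a, _, rfl⟩ := Finset.mem_image.1 hp
    obtain ⟨a', _, rfl⟩ := Finset.mem_image.1 hq
    have haa : a.1 ≠ a'.1 := by
      intro h
      have : a = a' := Subtype.ext h
      subst this
      exact hne rfl
    exact hO1 _ a.2 _ a'.2 haa x (hPO _ _ x hx) (hPO _ _ x hx')

lemma walk_avoid {G : SimpleGraph V} {X C : Finset V}
    (hcl : ∀ c ∈ C, ∀ v, G.Adj c v → v ∈ C ∨ v ∈ X) {u v : V} (p : G.Walk u v)
    (hv : v ∉ C) (hX : ∀ x ∈ p.support, x ∉ X) : ∀ x ∈ p.support, x ∉ C := by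
  induction p with
  | nil => simpa using hv
  | @cons u w v hadj p ih =>
    have h1 := ih hv (fun x hx => hX x (by simp [hx]))
    intro x hx
    rw [Walk.support_cons, List.mem_cons] at hx
    rcases hx with rfl | hx
    · intro hxC
      rcases hcl x hxC w hadj with h | h
      · exact h1 w p.start_mem_support h
      · exact hX w (by simp) h
    · exact h1 x hx

lemma path_avoid {G : SimpleGraph V} {X C : Finset V}
    (hcl : ∀ c ∈ C, ∀ v, G.Adj c v → v ∈ C ∨ v ∈ X) {u v : V} (p : G.Walk u v)
    (hp : p.IsPath) (hv : v ∉ C) (hX : ∀ y ∈ p.support, y ∈ X → y = u) :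
    ∀ y ∈ p.support, y ∈ C → y = u := by
  intro y hy hyC
  cases p with
  | nil => simpa using hy
  | cons hadj p =>
    rw [Walk.cons_isPath_iff] at hp
    have h4 := walk_avoid hcl p hv (by
      intro z hz hzX
      have := hX z (by simp [hz]) hzX
      subst this
      exact hp.2 hz)
    rw [Walk.support_cons, List.mem_cons] at hy
    rcases hy with rfl | hy
    · rfl
    · exact absurd hyC (h4 y hy)

lemma shift [Fintype V] {G : SimpleGraph V} {ι : Type} [Fintype ι] {τ : SimpleGraph ι}
    {bag : ι → Finset V} (td : TD G Finset.univ τ bag) (s : ι) {B : Finset (Finset V)}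
    {X C : Finset V} {k : ℕ} (hXC : ∀ x ∈ X, x ∉ C)
    (hcl : ∀ c ∈ C, ∀ v, G.Adj c v → v ∈ C ∨ v ∈ X) (hk : X.card ≤ k)
    (hXcov : Covers B X) (hmin : ∀ S, Covers B S → X.card ≤ S.card)
    (hconn : ∀ b ∈ B, CS G (↑b : Set V)) (hQ : ∀ i, Adm k (insert C B) (bag i))
    (hs : Covers B (bag s)) (hsC : ∀ v ∈ bag s, v ∉ C) :
    HasTD G (X ∪ C) (Adm k B) X := by
  obtain ⟨O, hO1, hO2⟩ := menger_s8 G X (bag s) (by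
    intro S hS
    refine hmin S ?_
    intro b hb
    obtain ⟨x, hx, hxX⟩ := hXcov b hb
    obtain ⟨y, hy, hys⟩ := hs b hb
    obtain ⟨p, hp⟩ := hconn b hb x hx y hy
    obtain ⟨z, hz, hzS⟩ := hS x hxX y hys p
    exact ⟨z, hp z hz, hzS⟩)
  choose e he P hP hPO using hO2
  have hPX : ∀ x hx, ∀ y ∈ (P x hx).support, y ∈ X → y = x := by
    intro x hx y hy hyX
    by_contra hne
    exact hO1 y hyX x hx hne y (hPO y hyX y (Walk.start_mem_support _)) (hPO x hx y hy)
  have hPU : ∀ x hx, ∀ y ∈ (P x hx).support, y ∈ X ∪ C → y = x := by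
    intro x hx y hy hyU
    rcases Finset.mem_union.1 hyU with hyX | hyC
    · exact hPX x hx y hy hyX
    · exact path_avoid hcl (P x hx) (hP x hx) (hsC _ (he x hx)) (hPX x hx) y hy hyC
  have htx : ∀ x, ∃ i, x ∈ bag i := fun x => td.cover x (Finset.mem_univ _)
  choose tx htx using htx
  let W : ι → Finset V := fun t =>
    (bag t ∩ (X ∪ C)) ∪ X.filter (fun x => t ∈ (tp td.tree s (tx x)).support)
  have hW : ∀ t v, v ∈ W t ↔ (v ∈ bag t ∧ (v ∈ X ∨ v ∈ C)) ∨
      (v ∈ X ∧ t ∈ (tp td.tree s (tx v)).support) := by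
    intro t v
    simp [W]
  refine ⟨ι, inferInstance, τ, W, ⟨td.tree, ?_, ?_, ?_, ?_⟩, ?_, s, ?_⟩
  · intro i v hv
    rw [hW] at hv
    rw [Finset.mem_union]
    tauto
  · intro v hv
    exact ⟨tx v, (hW _ _).2 (Or.inl ⟨htx v, Finset.mem_union.1 hv⟩)⟩
  · intro u hu v hv huv
    obtain ⟨i, h1, h2⟩ := td.edge u (Finset.mem_univ _) v (Finset.mem_univ _) huv
    exact ⟨i, (hW _ _).2 (Or.inl ⟨h1, Finset.mem_union.1 hu⟩),
      (hW _ _).2 (Or.inl ⟨h2, Finset.mem_union.1 hv⟩)⟩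
  · intro v
    by_cases hvX : v ∈ X
    · have := (td.conn v).union (CS_support (tp td.tree s (tx v))) (tx v) (htx v)
        (Walk.end_mem_support _)
      convert this using 1
      ext t
      simp only [Set.mem_ofPred_eq, Set.mem_union, hW]
      tauto
    · by_cases hvC : v ∈ C
      · convert td.conn v using 1
        ext t
        simp only [Set.mem_ofPred_eq, hW]
        tauto
      · intro i hi
        simp only [Set.mem_ofPred_eq, hW] at hi
        tauto
  · intro t hlt hcov
    have hcard : (W t).card ≤ (bag t).card := by
      let E := X.filter (fun x => t ∈ (tp td.tree s (tx x)).support ∧ x ∉ bag t)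
      have hE : ∀ x ∈ E, ∃ (hx : x ∈ X) (y : V), y ∈ (P x hx).support ∧ y ∈ bag t \ (X ∪ C) := by
        intro x hx
        simp only [E, Finset.mem_filter] at hx
        obtain ⟨hxX, hxt, hxb⟩ := hx
        obtain ⟨y, hy, hyt⟩ := td.sep (P x hxX).reverse (fun _ _ => Finset.mem_univ _)
          (he x hxX) (htx x) hxt
        rw [Walk.support_reverse, List.mem_reverse] at hy
        refine ⟨hxX, y, hy, Finset.mem_sdiff.2 ⟨hyt, fun hyU => ?_⟩⟩
        have := hPU x hxX y hy hyU
        subst this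
        exact hxb hyt
      have hEc : E.card ≤ (bag t \ (X ∪ C)).card := by
        choose hEX g hg1 hg2 using hE
        refine Finset.card_le_card_of_injOn (fun x => if h : x ∈ E then g x h else x) ?_ ?_
        · intro x hx
          have hx' : x ∈ E := hx
          simp only [dif_pos hx']
          exact hg2 x hx'
        · intro x hx y hy hxy
          have hx' : x ∈ E := hx
          have hy' : y ∈ E := hy
          simp only [dif_pos hx', dif_pos hy'] at hxy
          by_contra hne
          refine hO1 x (hEX x hx') y (hEX y hy') hne (g x hx') (hPO _ _ _ (hg1 x hx')) ?_
          rw [hxy]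
          exact hPO _ _ _ (hg1 y hy')
      have hsub : W t ⊆ (bag t ∩ (X ∪ C)) ∪ E := by
        intro v hv
        rw [hW] at hv
        simp only [E, Finset.mem_union, Finset.mem_inter, Finset.mem_filter]
        tauto
      have h1 := Finset.card_le_card hsub
      have h2 := Finset.card_union_le (bag t ∩ (X ∪ C)) E
      have h3 := Finset.card_sdiff_add_card_inter (bag t) (X ∪ C)
      omega
    have hnc := hQ t (by omega)
    apply hnc
    intro b hb
    rcases Finset.mem_insert.1 hb with rfl | hb
    · have : ¬ W t ⊆ X := fun hsub => by
        have := Finset.card_le_card hsub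
        omega
      rw [Finset.not_subset] at this
      obtain ⟨v, hv, hvX⟩ := this
      rw [hW] at hv
      exact ⟨v, by tauto, by tauto⟩
    · obtain ⟨x, hx, hxW⟩ := hcov b hb
      rw [hW] at hxW
      rcases hxW with hxW | hxW
      · exact ⟨x, hx, hxW.1⟩
      · obtain ⟨y, hy, hys⟩ := hs b hb
        obtain ⟨p, hp⟩ := hconn b hb y hy x hx
        obtain ⟨z, hz, hzt⟩ := td.sep p (fun _ _ => Finset.mem_univ _) hys (htx x) hxW.2
        exact ⟨z, hp z hz, hzt⟩
  · ext v
    rw [hW]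
    constructor
    · rintro (⟨h1, h2⟩ | h)
      · exact h2.resolve_right (hsC v h1)
      · exact h.1
    · intro hv
      exact Or.inr ⟨hv, Walk.start_mem_support _⟩

lemma exists_comp [Fintype V] {G : SimpleGraph V} {X W : Finset V} (hXW : ∀ x ∈ X, x ∉ W)
    (hcl : ∀ c ∈ W, ∀ v, G.Adj c v → v ∈ W ∨ v ∈ X) {v : V} (hv : v ∈ W) :
    ∃ C : Finset V, v ∈ C ∧ (∀ x ∈ X, x ∉ C) ∧ (∀ c ∈ C, ∀ u, G.Adj c u → u ∈ C ∨ u ∈ X) ∧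
      CS G (↑C : Set V) ∧ C ⊆ W ∧ (∀ c ∈ W \ C, ∀ u, G.Adj c u → u ∈ W \ C ∨ u ∈ X) := by
  let C : Finset V := Finset.univ.filter
    (fun u => ∃ p : G.Walk u v, ∀ x ∈ p.support, x ∉ X)
  have hvX : v ∉ X := fun h => hXW v h hv
  have hC : ∀ u, u ∈ C ↔ ∃ p : G.Walk u v, ∀ x ∈ p.support, x ∉ X := by
    intro u
    simp [C]
  have hvC : v ∈ C := (hC v).2 ⟨Walk.nil, by simpa using hvX⟩
  have hXC : ∀ x ∈ X, x ∉ C := by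
    intro x hx hxC
    obtain ⟨p, hp⟩ := (hC x).1 hxC
    exact hp x p.start_mem_support hx
  have hclC : ∀ c ∈ C, ∀ u, G.Adj c u → u ∈ C ∨ u ∈ X := by
    intro c hc u hcu
    by_cases hu : u ∈ X
    · exact Or.inr hu
    · left
      obtain ⟨p, hp⟩ := (hC c).1 hc
      refine (hC u).2 ⟨Walk.cons hcu.symm p, ?_⟩
      intro x hx
      rw [Walk.support_cons, List.mem_cons] at hx
      rcases hx with rfl | hx
      · exact hu
      · exact hp x hx
  have hCS : CS G (↑C : Set V) := by
    refine CS.of_center v ?_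
    intro u hu
    obtain ⟨p, hp⟩ := (hC u).1 hu
    refine ⟨p, fun y hy => (hC y).2 ⟨p.dropUntil y hy, fun x hx =>
      hp x (p.support_dropUntil_subset_support hy hx)⟩⟩
  have hCW : C ⊆ W := by
    intro u hu
    by_contra huW
    obtain ⟨p, hp⟩ := (hC u).1 hu
    have h1 := walk_avoid hcl p.reverse huW (by
      intro x hx
      rw [Walk.support_reverse, List.mem_reverse] at hx
      exact hp x hx)
    exact h1 v (Walk.start_mem_support _) hv
  have hclD : ∀ c ∈ W \ C, ∀ u, G.Adj c u → u ∈ W \ C ∨ u ∈ X := by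
    intro c hc u hcu
    rw [Finset.mem_sdiff] at hc
    rcases hcl c hc.1 u hcu with h | h
    · by_cases huC : u ∈ C
      · rcases hclC u huC c hcu.symm with h' | h'
        · exact absurd h' hc.2
        · exact absurd hc.1 (hXW c h')
      · exact Or.inl (Finset.mem_sdiff.2 ⟨h, huC⟩)
    · exact Or.inr h
  exact ⟨C, hvC, hXC, hclC, hCS, hCW, hclD⟩

lemma combine [Fintype V] {G : SimpleGraph V} {X : Finset V} {Q : Finset V → Prop} (hQX : Q X)
    (hcomp : ∀ C : Finset V, (∀ x ∈ X, x ∉ C) → (∀ c ∈ C, ∀ v, G.Adj c v → v ∈ C ∨ v ∈ X) →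
      CS G (↑C : Set V) → C.Nonempty → HasTD G (X ∪ C) Q X) :
    ∀ n (W : Finset V), W.card = n → (∀ x ∈ X, x ∉ W) →
      (∀ c ∈ W, ∀ v, G.Adj c v → v ∈ W ∨ v ∈ X) → HasTD G (X ∪ W) Q X := by
  intro n
  induction n using Nat.strong_induction_on with
  | _ n ih =>
    intro W hWn hXW hcl
    by_cases hW : W = ∅
    · subst hW
      rw [Finset.union_empty]
      exact HasTD.single G X Q hQX
    · obtain ⟨v, hv⟩ := Finset.nonempty_iff_ne_empty.2 hW
      obtain ⟨C, hvC, hXC, hclC, hCS, hCW, hclD⟩ := exists_comp hXW hcl hv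
      have h1 := hcomp C hXC hclC hCS ⟨v, hvC⟩
      have hlt : (W \ C).card < n := by
        rw [← hWn]
        refine Finset.card_lt_card (Finset.ssubset_iff_subset_ne.2 ⟨Finset.sdiff_subset, ?_⟩)
        intro heq
        rw [← heq] at hv
        exact (Finset.mem_sdiff.1 hv).2 hvC
      have h2 := ih _ hlt (W \ C) rfl (fun x hx hx' => hXW x hx (Finset.mem_sdiff.1 hx').1) hclD
      have h3 := h1.glue h2 (by
        intro u hu hu'
        simp only [Finset.mem_union, Finset.mem_sdiff] at hu hu'
        tauto) (by
        intro u hu w hw huw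
        have hX1 : ∀ z, (z ∈ C ∨ z ∈ X) → z ∈ X ∪ C := fun z hz =>
          Finset.mem_union.2 hz.symm
        have hX2 : ∀ z, (z ∈ W \ C ∨ z ∈ X) → z ∈ X ∪ W \ C := fun z hz =>
          Finset.mem_union.2 hz.symm
        have hcase : ∀ z ∈ (X ∪ C) ∪ (X ∪ W \ C), z ∈ C ∨ z ∈ W \ C ∨ z ∈ X := by
          intro z hz
          rcases Finset.mem_union.1 hz with hz | hz
          · rcases Finset.mem_union.1 hz with hz | hz
            · exact Or.inr (Or.inr hz)
            · exact Or.inl hz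
          · rcases Finset.mem_union.1 hz with hz | hz
            · exact Or.inr (Or.inr hz)
            · exact Or.inr (Or.inl hz)
        rcases hcase u hu with h | h | h
        · exact Or.inl ⟨hX1 u (Or.inl h), hX1 w (hclC u h w huw)⟩
        · exact Or.inr ⟨hX2 u (Or.inl h), hX2 w (hclD u h w huw)⟩
        · rcases hcase w hw with h' | h' | h'
          · exact Or.inl ⟨hX1 u (Or.inr h), hX1 w (Or.inl h')⟩
          · exact Or.inr ⟨hX2 u (Or.inr h), hX2 w (Or.inl h')⟩
          · exact Or.inl ⟨hX1 u (Or.inr h), hX1 w (Or.inr h')⟩)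
      convert h3 using 1
      ext u
      have := @hCW u
      simp only [Finset.mem_union, Finset.mem_sdiff]
      tauto

lemma duality [Fintype V] {G : SimpleGraph V} {k : ℕ}
    (hk : ∀ B, IsBr G B → ∃ S : Finset V, Covers B S ∧ S.card ≤ k) :
    ∀ n (B : Finset (Finset V)), Fintype.card (Finset V) - B.card = n → IsBr G B →
      ∃ X, HasTD G Finset.univ (Adm k B) X := by
  intro n
  induction n using Nat.strong_induction_on with
  | _ n ih =>
    intro B hBn hB
    by_contra hno
    have hex : ∃ m, ∃ S : Finset V, Covers B S ∧ S.card = m := by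
      obtain ⟨S, hS, _⟩ := hk B hB
      exact ⟨_, S, hS, rfl⟩
    obtain ⟨X, hXcov, hXm⟩ := Nat.find_spec hex
    have hmin : ∀ S, Covers B S → X.card ≤ S.card := by
      intro S hS
      rw [hXm]
      exact Nat.find_min' hex ⟨S, hS, rfl⟩
    have hXk : X.card ≤ k := by
      obtain ⟨S, hS, hSk⟩ := hk B hB
      exact (hmin S hS).trans hSk
    have hQX : Adm k B X := fun h => by omega
    apply hno
    refine ⟨X, ?_⟩
    have := combine (G := G) (X := X) (Q := Adm k B) hQX ?_ _ (Finset.univ \ X) rfl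
      (fun x hx hx' => (Finset.mem_sdiff.1 hx').2 hx) (by
        intro c _ v _
        by_cases hv : v ∈ X
        · exact Or.inr hv
        · exact Or.inl (Finset.mem_sdiff.2 ⟨Finset.mem_univ _, hv⟩))
    · convert this using 1
      ext v
      simp only [Finset.mem_univ, Finset.mem_union, Finset.mem_sdiff, true_and]
      tauto
    · intro C hXC hcl hCS hCne
      by_cases hbr : ∀ b ∈ B, Touch G C b
      · have hCB : C ∉ B := by
          intro hC
          obtain ⟨x, hx, hxX⟩ := hXcov C hC
          exact hXC x hxX hx
        have hB' : IsBr G (insert C B) := by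
          constructor
          · intro b hb
            rcases Finset.mem_insert.1 hb with rfl | hb
            · exact hCS
            · exact hB.1 b hb
          · intro b hb c hc
            rcases Finset.mem_insert.1 hb with rfl | hb1
            · rcases Finset.mem_insert.1 hc with rfl | hc
              · obtain ⟨v, hv⟩ := hCne
                exact ⟨v, hv, v, hv, Or.inl rfl⟩
              · exact hbr c hc
            · rcases Finset.mem_insert.1 hc with rfl | hc
              · obtain ⟨u, hu, v, hv, huv⟩ := hbr b hb1
                exact ⟨v, hv, u, hu, huv.imp Eq.symm (fun h => h.symm)⟩
              · exact hB.2 b hb1 c hc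
        have hc1 := Finset.card_insert_of_notMem hCB
        have hc2 := Finset.card_le_univ (insert C B)
        obtain ⟨X', ι, _, τ, bag, td, hq, s', hs'⟩ := ih _ (by omega) (insert C B) rfl hB'
        by_cases hadm : ∀ i, Adm k B (bag i)
        · exact absurd ⟨X', ι, inferInstance, τ, bag, td, hadm, s', hs'⟩ hno
        · push Not at hadm
          obtain ⟨s, hs⟩ := hadm
          unfold Adm at hs
          push Not at hs
          refine shift td s hXC hcl hXk hXcov hmin hB.1 hq hs.2 ?_
          intro v hv hvC
          apply hq s hs.1
          intro b hb
          rcases Finset.mem_insert.1 hb with rfl | hb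
          · exact ⟨v, hvC, hv⟩
          · exact hs.2 b hb
      · push Not at hbr
        obtain ⟨b, hb, hbC⟩ := hbr
        let N : Finset V := Finset.univ.filter (fun v => v ∈ C ∨ ∃ c ∈ C, G.Adj c v)
        have hN : ∀ v, v ∈ N ↔ v ∈ C ∨ ∃ c ∈ C, G.Adj c v := by
          intro v
          simp [N]
        have hNs : ∀ v ∈ N, v ∈ C ∨ v ∈ X := by
          intro v hv
          rcases (hN v).1 hv with h | ⟨c, hc, hcv⟩
          · exact Or.inl h
          · exact hcl c hc v hcv
        have h1 := HasTD.single G X (Adm k B) hQX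
        have h2 := HasTD.single G N (Adm k B) (by
          intro _ hcov
          obtain ⟨x, hx, hxN⟩ := hcov b hb
          rcases (hN x).1 hxN with h | ⟨c, hc, hcx⟩
          · exact hbC ⟨x, h, x, hx, Or.inl rfl⟩
          · exact hbC ⟨c, hc, x, hx, Or.inr hcx⟩)
        have h3 := h1.glue h2 (fun v hv hv' => ⟨hv, hv'⟩) (by
          intro u hu v hv huv
          have hu' : u ∈ C ∨ u ∈ X := by
            rcases Finset.mem_union.1 hu with h | h
            · exact Or.inr h
            · exact hNs u h
          have hv' : v ∈ C ∨ v ∈ X := by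
            rcases Finset.mem_union.1 hv with h | h
            · exact Or.inr h
            · exact hNs v h
          by_cases huC : u ∈ C
          · exact Or.inr ⟨(hN u).2 (Or.inl huC), (hN v).2 (Or.inr ⟨u, huC, huv⟩)⟩
          · by_cases hvC : v ∈ C
            · exact Or.inr ⟨(hN u).2 (Or.inr ⟨v, hvC, huv.symm⟩), (hN v).2 (Or.inl hvC)⟩
            · exact Or.inl ⟨hu'.resolve_left huC, hv'.resolve_left hvC⟩)
        convert h3 using 1
        ext v
        have a1 := hNs v
        have a2 := hN v
        simp only [Finset.mem_union]
        tauto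

lemma upper [Fintype V] (G : SimpleGraph V) (k : ℕ)
    (hub : ∀ T : Finset V, NodeWellLinked G T → T.card ≤ k) :
    HasTreeDecompOfWidthLE G ((k : ℝ) - 1) := by
  have hk : ∀ B, IsBr G B → ∃ S : Finset V, Covers B S ∧ S.card ≤ k := by
    intro B hB
    have hex : ∃ m, ∃ S : Finset V, Covers B S ∧ S.card = m := by
      refine ⟨_, Finset.univ, ?_, rfl⟩
      intro b hb
      obtain ⟨u, hu, _⟩ := hB.2 b hb b hb
      exact ⟨u, hu, Finset.mem_univ _⟩
    obtain ⟨X, hXcov, hXm⟩ := Nat.find_spec hex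
    refine ⟨X, hXcov, hub X (cover_wl hB hXcov ?_)⟩
    intro S hS
    rw [hXm]
    exact Nat.find_min' hex ⟨S, hS, rfl⟩
  obtain ⟨X, ι, _, τ, bag, td, hq, _⟩ := duality hk _ ∅ rfl
    ⟨fun b hb => absurd hb (Finset.notMem_empty _), fun b hb => absurd hb (Finset.notMem_empty _)⟩
  refine ⟨ι, inferInstance, τ, td.tree, bag, ?_, ?_, ?_⟩
  · intro u v huv
    exact td.edge u (Finset.mem_univ _) v (Finset.mem_univ _) huv
  · intro v
    obtain ⟨i, hi⟩ := td.cover v (Finset.mem_univ _)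
    have : Nonempty {i | v ∈ bag i} := ⟨⟨i, hi⟩⟩
    exact ⟨(td.conn v).to_induce⟩
  · intro i
    have : (bag i).card ≤ k := by
      by_contra h
      exact hq i (by omega) (fun b hb => absurd hb (Finset.notMem_empty _))
    have : ((bag i).card : ℝ) ≤ k := by exact_mod_cast this
    linarith

lemma tp_split {ι : Type} {τ : SimpleGraph ι} (h : τ.IsTree) {a b x : ι}
    (hx : x ∈ (tp h a b).support) : tp h a b = (tp h a x).append (tp h x b) := by
  obtain ⟨q, r, hq, hr, heq⟩ := (tp_isPath h a b).mem_support_iff_exists_append.1 hx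
  rw [heq, tp_unique h q hq, tp_unique h r hr]

lemma tp_length {ι : Type} {τ : SimpleGraph ι} (h : τ.IsTree) {a b x : ι}
    (hx : x ∈ (tp h a b).support) :
    (tp h a b).length = (tp h a x).length + (tp h x b).length := by
  rw [tp_split h hx, Walk.length_append]

lemma tp_eq_of_le {ι : Type} {τ : SimpleGraph ι} (h : τ.IsTree) {a b x : ι}
    (hx : x ∈ (tp h a b).support) (hle : (tp h a b).length ≤ (tp h a x).length) : x = b := by
  have := tp_length h hx
  exact Walk.eq_of_length_eq_zero (p := tp h x b) (by omega)

lemma top_mem {ι : Type} {τ : SimpleGraph ι} (h : τ.IsTree) {S : Set ι} (hS : CS τ S) (r t u : ι)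
    (ht : t ∈ S) (hmin : ∀ x ∈ S, (tp h r t).length ≤ (tp h r x).length) (hu : u ∈ S) :
    t ∈ (tp h r u).support := by
  have hpath : ((tp h r t).append (tp h t u)).IsPath := by
    rw [Walk.isPath_def, Walk.support_append, List.nodup_append]
    have h2 := (tp_isPath h t u).support_nodup
    refine ⟨(tp_isPath h r t).support_nodup, h2.tail, ?_⟩
    intro x hx y hy hxy
    subst hxy
    have hxS := hS.convex h ht hu x (List.mem_of_mem_tail hy)
    have := tp_eq_of_le h hx (hmin x hxS)
    subst this
    rw [← Walk.cons_tail_support, List.nodup_cons] at h2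
    exact h2.1 hy
  rw [← tp_unique h _ hpath, Walk.mem_support_append_iff]
  exact Or.inl (Walk.end_mem_support _)

lemma helly {ι J : Type} [Finite ι] [Finite J] [Nonempty J] {τ : SimpleGraph ι} (h : τ.IsTree)
    (S : J → Set ι) (hS : ∀ j, CS τ (S j)) (hmeet : ∀ j j', ∃ i, i ∈ S j ∧ i ∈ S j') :
    ∃ t, ∀ j, t ∈ S j := by
  obtain ⟨r⟩ := h.connected.nonempty
  have htop : ∀ j, ∃ t ∈ S j, ∀ x ∈ S j, (tp h r t).length ≤ (tp h r x).length := by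
    intro j
    obtain ⟨i, hi, _⟩ := hmeet j j
    exact Set.exists_min_image (S j) (fun x => (tp h r x).length) (Set.toFinite _) ⟨i, hi⟩
  choose top htS hmin using htop
  obtain ⟨j₀, hj₀⟩ := Finite.exists_max (fun j => (tp h r (top j)).length)
  refine ⟨top j₀, fun j => ?_⟩
  obtain ⟨u, hu0, huj⟩ := hmeet j₀ j
  have h1 := top_mem h (hS j₀) r (top j₀) u (htS _) (hmin _) hu0
  have h2 := top_mem h (hS j) r (top j) u (htS _) (hmin _) huj
  rw [tp_split h h2, Walk.mem_support_append_iff] at h1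
  rcases h1 with h1 | h1
  · have := tp_eq_of_le h h1 (hj₀ j)
    rw [this]
    exact htS j
  · exact (hS j).convex h (htS j) huj _ h1

lemma lower [Fintype V] (G : SimpleGraph V) (k : ℕ) (T : Finset V) (hT : T.card = k)
    (hTw : NodeWellLinked G T) (w : ℝ) (hw : HasTreeDecompOfWidthLE G w) :
    (k : ℝ) / 4 - 1 ≤ w := by
  obtain ⟨ι, _, τ, hτ, bag, hedge, hconn, hcard⟩ := hw
  by_contra hlt
  push Not at hlt
  have hsmall : ∀ i, 4 * (bag i).card < k := by
    intro i
    have h1 := hcard i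
    have : (4 * (bag i).card : ℝ) < k := by linarith
    exact_mod_cast this
  have td : TD G Finset.univ τ bag := by
    refine ⟨hτ, fun _ => Finset.subset_univ _, ?_, fun u _ v _ huv => hedge u v huv,
      fun v => CS.of_induce (hconn v).preconnected⟩
    intro v _
    obtain ⟨⟨i, hi⟩⟩ := (hconn v).nonempty
    exact ⟨i, hi⟩
  have hbal : ∃ i, ∀ C : Finset V, CS G (↑C : Set V) → k < 2 * (C ∩ T).card →
      ∃ v ∈ C, v ∈ bag i := by
    let J := {C : Finset V // CS G (↑C : Set V) ∧ k < 2 * (C ∩ T).card}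
    by_cases hJ : Nonempty J
    · obtain ⟨t, ht⟩ := helly hτ (fun C : J => {i | ∃ v ∈ C.1, v ∈ bag i})
        (fun C => td.hits (Finset.subset_univ _) C.2.1) (by
          rintro ⟨C, hC, hCk⟩ ⟨D, hD, hDk⟩
          have : ¬ Disjoint (C ∩ T) (D ∩ T) := by
            intro hdis
            have h1 := Finset.card_union_of_disjoint hdis
            have h2 : ((C ∩ T) ∪ (D ∩ T)).card ≤ T.card :=
              Finset.card_le_card (Finset.union_subset Finset.inter_subset_right
                Finset.inter_subset_right)
            omega
          rw [Finset.not_disjoint_iff] at this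
          obtain ⟨v, hv1, hv2⟩ := this
          obtain ⟨i, hi⟩ := td.cover v (Finset.mem_univ _)
          exact ⟨i, ⟨v, (Finset.mem_inter.1 hv1).1, hi⟩, ⟨v, (Finset.mem_inter.1 hv2).1, hi⟩⟩)
      exact ⟨t, fun C hC hCk => ht ⟨C, hC, hCk⟩⟩
    · obtain ⟨i⟩ := hτ.connected.nonempty
      exact ⟨i, fun C hC hCk => absurd ⟨⟨C, hC, hCk⟩⟩ hJ⟩
  obtain ⟨i, hi⟩ := hbal
  have hSk := hsmall i
  generalize bag i = S at hi hSk
  have hex : ∃ m, ∃ D : Finset V, ((∀ x ∈ S, x ∉ D) ∧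
      (∀ c ∈ D, ∀ v, G.Adj c v → v ∈ D ∨ v ∈ S) ∧ k ≤ 4 * (D ∩ T).card) ∧ D.card = m := by
    refine ⟨_, Finset.univ \ S, ⟨fun x hx hx' => (Finset.mem_sdiff.1 hx').2 hx, ?_, ?_⟩, rfl⟩
    · intro c _ v _
      by_cases hv : v ∈ S
      · exact Or.inr hv
      · exact Or.inl (Finset.mem_sdiff.2 ⟨Finset.mem_univ _, hv⟩)
    · have h1 : T \ S ⊆ (Finset.univ \ S) ∩ T := by
        intro v hv
        rw [Finset.mem_sdiff] at hv
        exact Finset.mem_inter.2 ⟨Finset.mem_sdiff.2 ⟨Finset.mem_univ _, hv.2⟩, hv.1⟩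
      have h2 := Finset.card_le_card h1
      have h3 := Finset.le_card_sdiff S T
      omega
  obtain ⟨D, ⟨hSD, hclD, hDk⟩, hDm⟩ := Nat.find_spec hex
  have hmin : ∀ D' : Finset V, (∀ x ∈ S, x ∉ D') → (∀ c ∈ D', ∀ v, G.Adj c v → v ∈ D' ∨ v ∈ S) →
      k ≤ 4 * (D' ∩ T).card → D.card ≤ D'.card := by
    intro D' h1 h2 h3
    rw [hDm]
    exact Nat.find_min' hex ⟨D', ⟨h1, h2, h3⟩, rfl⟩
  have hD2 : 2 * (D ∩ T).card ≤ k := by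
    have hne : (D ∩ T).Nonempty := by
      rw [← Finset.card_pos]
      omega
    obtain ⟨v, hv⟩ := hne
    obtain ⟨C, hvC, hSC, hclC, hCS, hCD, hclDC⟩ :=
      exists_comp hSD hclD (Finset.mem_inter.1 hv).1
    have hC2 : 2 * (C ∩ T).card ≤ k := by
      by_contra h
      obtain ⟨x, hx, hxS⟩ := hi C hCS (by omega)
      exact hSC x hxS hx
    by_cases hC4 : k ≤ 4 * (C ∩ T).card
    · have := Finset.eq_of_subset_of_card_le hCD (hmin C hSC hclC hC4)
      rwa [← this]
    · have hDC4 : ¬ k ≤ 4 * ((D \ C) ∩ T).card := by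
        intro h
        have h1 := hmin (D \ C) (fun x hx hx' => hSD x hx (Finset.mem_sdiff.1 hx').1) hclDC h
        have h2 := Finset.card_sdiff_add_card_eq_card hCD
        have h3 : 0 < C.card := Finset.card_pos.2 ⟨v, hvC⟩
        omega
      have h1 : D ∩ T ⊆ (C ∩ T) ∪ ((D \ C) ∩ T) := by
        intro x hx
        simp only [Finset.mem_union, Finset.mem_inter, Finset.mem_sdiff] at hx ⊢
        tauto
      have h2 := Finset.card_le_card h1
      have h3 := Finset.card_union_le (C ∩ T) ((D \ C) ∩ T)
      omega
  obtain ⟨A, hA, hAc⟩ := Finset.exists_subset_card_eq (s := D ∩ T) (n := S.card + 1) (by omega)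
  have hrest : S.card + 1 ≤ ((T \ S) \ D).card := by
    have h1 : T ⊆ S ∪ (D ∩ T) ∪ ((T \ S) \ D) := by
      intro x hx
      simp only [Finset.mem_union, Finset.mem_inter, Finset.mem_sdiff]
      tauto
    have h2 := Finset.card_le_card h1
    have h3 := Finset.card_union_le (S ∪ (D ∩ T)) ((T \ S) \ D)
    have h4 := Finset.card_union_le S (D ∩ T)
    omega
  obtain ⟨A', hA', hAc'⟩ := Finset.exists_subset_card_eq hrest
  have hA1 : ∀ a ∈ A, a ∈ D ∧ a ∈ T := fun a ha => Finset.mem_inter.1 (hA ha)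
  have hA2 : ∀ a ∈ A', a ∈ T ∧ a ∉ D := by
    intro a ha
    have := hA' ha
    simp only [Finset.mem_sdiff] at this
    exact ⟨this.1.1, this.2⟩
  obtain ⟨P, hP1, hP2, hP3⟩ := hTw A A' (fun a ha => (hA1 a ha).2) (fun a ha => (hA2 a ha).1)
    (Finset.disjoint_left.2 fun a ha ha' => (hA2 a ha').2 (hA1 a ha).1) (by omega)
  have hcross : ∀ a ∈ A, ∃ p ∈ P, p.1 = a ∧ ∃ x ∈ p.2.2.support, x ∈ S := by
    intro a ha
    obtain ⟨p, hp, hpa⟩ := hP2 a ha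
    refine ⟨p, hp, hpa, ?_⟩
    by_contra hno
    push Not at hno
    have h1 := walk_avoid hclD p.2.2 (hA2 _ (hP1 p hp).2.2).2 hno
    exact h1 p.1 (Walk.start_mem_support _) (hA1 _ (hP1 p hp).2.1).1
  choose! p hpP hpa x hx hxS using hcross
  have hle : A.card ≤ S.card := by
    refine Finset.card_le_card_of_injOn x (fun a ha => hxS a ha) ?_
    intro a ha b hb hab
    by_contra hne
    have hpne : p a ha ≠ p b hb := by
      intro h
      apply hne
      exact (hpa a ha).symm.trans ((congrArg Sigma.fst h).trans (hpa b hb))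
    apply hP3 (p a ha) (hpP a ha) (p b hb) (hpP b hb) hpne (x a) (hx a ha)
    rw [hab]
    exact hx b hb
  omega

/-- If `k` is the size of the largest node-well-linked vertex set in
`G`, then `k/4 − 1 ≤ tw(G) ≤ k − 1`. -/
theorem stmt8 [Fintype V] (G : SimpleGraph V) (k : ℕ)
    (hmax : ∃ T : Finset V, T.card = k ∧ NodeWellLinked G T)
    (hub : ∀ T : Finset V, NodeWellLinked G T → T.card ≤ k) :
    HasTreeDecompOfWidthLE G ((k : ℝ) - 1) ∧
    (∀ w : ℝ, HasTreeDecompOfWidthLE G w → (k : ℝ) / 4 - 1 ≤ w) := by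
  constructor
  · exact upper G k hub
  · intro w hw
    obtain ⟨T, hT, hTw⟩ := hmax
    exact lower G k T hT hTw w hw
end
end

section
/- Let G' be any graph (parallel edges allowed) with maximum vertex degree at most Δ and m' edges. Then there is a partition (A,B) of V(G') such that the number of edges inside A and the number of edges inside B are each at least m'/4 − Δ. -/
attribute [local instance] Classical.propDecidable

noncomputable section

namespace Judicious
open Finset

def sg {V : Type} (A : Finset V) (v : V) : ℤ := if v ∈ A then 1 else -1

def lin {V E : Type} [Fintype E] (x y : E → V) (A : Finset V) : ℤ :=
  ∑ e, (sg A (x e) + sg A (y e))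

def quad {V E : Type} [Fintype E] (x y : E → V) (A : Finset V) : ℤ :=
  ∑ e, sg A (x e) * sg A (y e)

def ind {V : Type} (u v : V) : ℤ := if u = v then 1 else 0

def dg {V E : Type} [Fintype E] (x y : E → V) (v : V) : ℤ :=
  ∑ e, (ind (x e) v + ind (y e) v)

lemma sg_erase {V : Type} (A : Finset V) (v u : V) (hv : v ∈ A) :
    sg (A.erase v) u = sg A u - 2 * ind u v := by
  unfold sg ind
  by_cases h : u = v
  · subst h; simp [hv]
  · simp [h]

lemma sg_compl {V : Type} [Fintype V] (A : Finset V) (u : V) :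
    sg Aᶜ u = - sg A u := by
  unfold sg
  by_cases h : u ∈ A <;> simp [h]

lemma lin_compl {V E : Type} [Fintype V] [Fintype E] (x y : E → V) (A : Finset V) :
    lin x y Aᶜ = - lin x y A := by
  unfold lin
  rw [← Finset.sum_neg_distrib]
  refine Finset.sum_congr rfl fun e _ => ?_
  rw [sg_compl, sg_compl]; ring

lemma quad_compl {V E : Type} [Fintype V] [Fintype E] (x y : E → V) (A : Finset V) :
    quad x y Aᶜ = quad x y A := by
  unfold quad
  refine Finset.sum_congr rfl fun e _ => ?_
  rw [sg_compl, sg_compl]; ring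

lemma lin_erase {V E : Type} [Fintype E] (x y : E → V) (A : Finset V) (v : V) (hv : v ∈ A) :
    lin x y (A.erase v) = lin x y A - 2 * dg x y v := by
  unfold lin dg
  rw [Finset.mul_sum, ← Finset.sum_sub_distrib]
  refine Finset.sum_congr rfl fun e _ => ?_
  rw [sg_erase A v _ hv, sg_erase A v _ hv]; ring

lemma quad_erase {V E : Type} [Fintype E] (x y : E → V) (hxy : ∀ e, x e ≠ y e)
    (A : Finset V) (v : V) (hv : v ∈ A) :
    quad x y (A.erase v) = quad x y A
      - 2 * ∑ e, (ind (x e) v * sg A (y e) + ind (y e) v * sg A (x e)) := by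
  unfold quad
  rw [Finset.mul_sum, ← Finset.sum_sub_distrib]
  refine Finset.sum_congr rfl fun e _ => ?_
  rw [sg_erase A v _ hv, sg_erase A v _ hv]
  have h : ind (x e) v * ind (y e) v = 0 := by
    unfold ind
    by_cases h : x e = v
    · have : y e ≠ v := fun h2 => hxy e (h.trans h2.symm)
      simp [this]
    · simp [h]
  linear_combination 4 * h

lemma sum_ind {V : Type} (A : Finset V) (u : V) : 2 * ∑ v ∈ A, ind u v = 1 + sg A u := by
  unfold ind sg
  rw [Finset.sum_ite_eq]
  split_ifs <;> norm_num

lemma sg_sq {V : Type} (A : Finset V) (u : V) : sg A u * sg A u = 1 := by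
  unfold sg; split_ifs <;> norm_num

lemma sum_local {V E : Type} [Fintype E] (x y : E → V) (A : Finset V) :
    2 * ∑ v ∈ A, ∑ e, (ind (x e) v * sg A (y e) + ind (y e) v * sg A (x e))
      = lin x y A + 2 * quad x y A := by
  unfold lin quad
  rw [Finset.sum_comm, Finset.mul_sum, Finset.mul_sum, ← Finset.sum_add_distrib]
  refine Finset.sum_congr rfl fun e _ => ?_
  rw [Finset.sum_add_distrib, ← Finset.sum_mul, ← Finset.sum_mul]
  linear_combination sg A (y e) * sum_ind A (x e) + sg A (x e) * sum_ind A (y e)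

lemma dg_nonneg {V E : Type} [Fintype E] (x y : E → V) (v : V) : 0 ≤ dg x y v := by
  unfold dg ind
  refine Finset.sum_nonneg fun e _ => ?_
  split_ifs <;> norm_num

/-- a nearly balanced partition exists -/
lemma exists_bal {V E : Type} [Fintype V] [Fintype E] (x y : E → V) (D : ℤ) (hD0 : 0 ≤ D)
    (hD : ∀ v, dg x y v ≤ D) : ∃ A : Finset V, |lin x y A| ≤ 2 * D := by
  obtain ⟨A, -, hA⟩ := Finset.exists_min_image (Finset.univ : Finset (Finset V))
    (fun A => |lin x y A|) ⟨∅, Finset.mem_univ _⟩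
  have key : ∀ B : Finset V, |lin x y B| = |lin x y A| → lin x y B ≤ 2 * D := by
    intro B hB
    by_contra! hlt
    have : ∃ e ∈ (Finset.univ : Finset E), 0 < sg B (x e) + sg B (y e) := by
      apply Finset.exists_lt_of_sum_lt
      simp only [Finset.sum_const_zero]
      have : 0 < lin x y B := by omega
      exact this
    obtain ⟨e, -, he⟩ := this
    have hx : x e ∈ B := by
      by_contra h
      unfold sg at he
      simp only [h, if_false] at he
      split_ifs at he <;> omega
    have hpos : 0 < dg x y (x e) := by
      unfold dg
      refine Finset.sum_pos' (fun e _ => ?_) ⟨e, Finset.mem_univ _, ?_⟩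
      · unfold ind; split_ifs <;> norm_num
      · unfold ind; simp only [if_true]; split_ifs <;> norm_num
    have h1 := lin_erase x y B (x e) hx
    have h2 := hA (B.erase (x e)) (Finset.mem_univ _)
    have h3 := hD (x e)
    simp only [← hB] at h2
    rw [abs_of_pos (by omega : 0 < lin x y B), abs_of_nonneg (by omega)] at h2
    omega
  refine ⟨A, abs_le.2 ⟨?_, key A rfl⟩⟩
  have := key Aᶜ (by rw [lin_compl, abs_neg])
  rw [lin_compl] at this
  omega

lemma exists_good {V E : Type} [Fintype V] [Fintype E] (x y : E → V) (hxy : ∀ e, x e ≠ y e)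
    (D : ℤ) (hD0 : 0 ≤ D) (hD : ∀ v, dg x y v ≤ D) :
    ∃ A : Finset V, -4 * D ≤ quad x y A + lin x y A ∧ -4 * D ≤ quad x y A - lin x y A := by
  obtain ⟨A0, hA0⟩ := exists_bal x y D hD0 hD
  obtain ⟨A, hAm, hA⟩ := Finset.exists_max_image
    (Finset.univ.filter (fun A : Finset V => |lin x y A| ≤ 2 * D))
    (fun A => quad x y A) ⟨A0, by simpa using hA0⟩
  have hAb : |lin x y A| ≤ 2 * D := by simpa using hAm
  have key : ∀ B : Finset V, |lin x y B| ≤ 2 * D → quad x y B = quad x y A → 0 ≤ lin x y B →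
      0 ≤ lin x y B + 2 * quad x y B := by
    intro B hB hq h0
    rw [← sum_local]
    refine mul_nonneg (by norm_num) (Finset.sum_nonneg fun v hv => ?_)
    have h1 := lin_erase x y B v hv
    have h2 := quad_erase x y hxy B v hv
    have h3 := hD v
    have h4 := dg_nonneg x y v
    rw [abs_le] at hB
    have h5 := hA (B.erase v) (by
      simp only [Finset.mem_filter, Finset.mem_univ, true_and]
      rw [abs_le]; omega)
    omega
  rcases le_total 0 (lin x y A) with h | h
  · have := key A hAb rfl h
    rw [abs_le] at hAb
    exact ⟨A, by omega, by omega⟩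
  · have := key Aᶜ (by rwa [lin_compl, abs_neg]) (quad_compl x y A) (by rw [lin_compl]; omega)
    rw [lin_compl, quad_compl] at this
    rw [abs_le] at hAb
    exact ⟨A, by omega, by omega⟩

end Judicious

/-- Any (multi)graph with `m'` edges and maximum degree at most `Δ` has a
partition `(A, Aᶜ)` of its vertices such that at least `m'/4 − Δ` edges lie inside `A` and
at least `m'/4 − Δ` edges lie inside `Aᶜ`.  Here a multigraph is given by a finite edge
type `E` with an endpoint map `ends : E → Sym2 V`, with no loops, and the degree of a
vertex counts (with multiplicity) the edges incident to it. -/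
theorem stmt9 {V E : Type} [Fintype V] [Fintype E]
    (ends : E → Sym2 V) (hloop : ∀ e, ¬ (ends e).IsDiag)
    (Δ : ℕ)
    (hdeg : ∀ v : V, (Finset.univ.filter (fun e => v ∈ ends e)).card ≤ Δ) :
    ∃ A : Finset V,
      (Fintype.card E : ℝ) / 4 - (Δ : ℝ) ≤
        ((Finset.univ.filter (fun e : E => ∀ v ∈ ends e, v ∈ A)).card : ℝ) ∧
      (Fintype.card E : ℝ) / 4 - (Δ : ℝ) ≤
        ((Finset.univ.filter (fun e : E => ∀ v ∈ ends e, v ∉ A)).card : ℝ) := by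
  have hrep : ∀ e, ∃ p : V × V, ends e = s(p.1, p.2) := fun e => by
    induction h : ends e using Sym2.ind with
    | _ a b => exact ⟨(a, b), rfl⟩
  choose p hp using hrep
  have hxy : ∀ e, (p e).1 ≠ (p e).2 := fun e h => hloop e (by rw [hp e]; simpa using h)
  have hD : ∀ v, Judicious.dg (fun e => (p e).1) (fun e => (p e).2) v ≤ (Δ : ℤ) := by
    intro v
    have h := hdeg v
    have h2 : Judicious.dg (fun e => (p e).1) (fun e => (p e).2) v
        = ((Finset.univ.filter (fun e => v ∈ ends e)).card : ℤ) := by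
      rw [Finset.card_filter]
      push_cast
      unfold Judicious.dg Judicious.ind
      refine Finset.sum_congr rfl fun e _ => ?_
      have := hxy e
      rw [hp e]
      simp only [Sym2.mem_iff]
      by_cases h1 : (p e).1 = v
      · have h3 : (p e).2 ≠ v := fun h3 => this (h1.trans h3.symm)
        simp [h1, h3]
      · by_cases h3 : (p e).2 = v
        · simp [h1, h3]
        · simp [h1, h3, Ne.symm h1, Ne.symm h3]
    rw [h2]; exact_mod_cast h
  obtain ⟨A, h1, h2⟩ := Judicious.exists_good (fun e => (p e).1) (fun e => (p e).2) hxy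
    (Δ : ℤ) (by positivity) hD
  have hc : (Fintype.card E : ℤ) = ∑ e : E, 1 := by simp
  have hA : 4 * ((Finset.univ.filter (fun e : E => ∀ v ∈ ends e, v ∈ A)).card : ℤ)
      = Fintype.card E + (Judicious.quad (fun e => (p e).1) (fun e => (p e).2) A
        + Judicious.lin (fun e => (p e).1) (fun e => (p e).2) A) := by
    rw [hc, Finset.card_filter]
    push_cast
    unfold Judicious.quad Judicious.lin Judicious.sg
    rw [Finset.mul_sum, ← Finset.sum_add_distrib, ← Finset.sum_add_distrib]
    refine Finset.sum_congr rfl fun e _ => ?_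
    rw [hp e]
    by_cases h1 : (p e).1 ∈ A <;> by_cases h2 : (p e).2 ∈ A <;> simp [h1, h2]
  have hB : 4 * ((Finset.univ.filter (fun e : E => ∀ v ∈ ends e, v ∉ A)).card : ℤ)
      = Fintype.card E + (Judicious.quad (fun e => (p e).1) (fun e => (p e).2) A
        - Judicious.lin (fun e => (p e).1) (fun e => (p e).2) A) := by
    rw [hc, Finset.card_filter]
    push_cast
    unfold Judicious.quad Judicious.lin Judicious.sg
    rw [Finset.mul_sum, ← Finset.sum_sub_distrib, ← Finset.sum_add_distrib]
    refine Finset.sum_congr rfl fun e _ => ?_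
    rw [hp e]
    by_cases h1 : (p e).1 ∈ A <;> by_cases h2 : (p e).2 ∈ A <;> simp [h1, h2]
  refine ⟨A, ?_, ?_⟩
  · have h : (Fintype.card E : ℤ) - 4 * Δ
        ≤ 4 * ((Finset.univ.filter (fun e : E => ∀ v ∈ ends e, v ∈ A)).card : ℤ) := by
      rw [hA]; linarith
    have h' : (Fintype.card E : ℝ) - 4 * Δ
        ≤ 4 * ((Finset.univ.filter (fun e : E => ∀ v ∈ ends e, v ∈ A)).card : ℝ) := by
      exact_mod_cast h
    linarith
  · have h : (Fintype.card E : ℤ) - 4 * Δ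
        ≤ 4 * ((Finset.univ.filter (fun e : E => ∀ v ∈ ends e, v ∉ A)).card : ℤ) := by
      rw [hB]; linarith
    have h' : (Fintype.card E : ℝ) - 4 * Δ
        ≤ 4 * ((Finset.univ.filter (fun e : E => ∀ v ∈ ends e, v ∉ A)).card : ℝ) := by
      exact_mod_cast h
    linarith
end
end

section
/- Let Z be a connected n-vertex graph, and let L ≥ 1, p ≥ 1 be integers with n/(2L) ≥ p + 5. Then Z contains either a spanning tree with at least L leaves, or a 2-path of length at least p, i.e., a simple path P such that every vertex of P has degree exactly 2 in Z. -/
attribute [local instance] Classical.propDecidable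

noncomputable section

variable {V : Type}

/-- The set of leaves (degree-one vertices). -/
def leavesOf [Fintype V] (T : SimpleGraph V) : Finset V :=
  Finset.univ.filter (fun x => deg T x = 1)

theorem deg_eq_degree [Fintype V] (T : SimpleGraph V) (x : V) : deg T x = T.degree x := by
  unfold deg
  rw [← SimpleGraph.card_neighborFinset_eq_degree]
  congr 1
  ext y
  simp

theorem exchange_tree [Fintype V] (T : SimpleGraph V) (hT : T.IsTree) (v u a b : V)
    (hvu : v ≠ u) (hnadj : ¬ T.Adj v u) (hva : T.Adj v a) (hab : T.Adj a b)
    (q : T.Walk b u) (hq : a ∉ q.support) (hbv : b ≠ v) :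
    (T.deleteEdges {s(a, b)} ⊔ SimpleGraph.edge v u).IsTree := by
  set T' := T.deleteEdges {s(a, b)} ⊔ SimpleGraph.edge v u with hT'
  have hadj : ∀ x y, T'.Adj x y ↔ (T.Adj x y ∧ s(x, y) ≠ s(a, b)) ∨
      ((x = v ∧ y = u ∨ x = u ∧ y = v) ∧ x ≠ y) := by
    intro x y
    simp [hT', SimpleGraph.edge_adj]
  have hau : a ≠ u := by rintro rfl; exact hnadj hva
  rw [SimpleGraph.isTree_iff_connected_and_card]
  constructor
  · have hq' : T'.Reachable b u := by
      refine ⟨q.transfer T' ?_⟩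
      intro e he
      induction e with
      | h x y =>
        rw [SimpleGraph.mem_edgeSet, hadj]
        left
        refine ⟨q.adj_of_mem_edges he, ?_⟩
        intro heq
        rw [heq] at he
        exact hq (q.fst_mem_support_of_mem_edges he)
    have h1 : T'.Adj u v := by rw [hadj]; right; exact ⟨Or.inr ⟨rfl, rfl⟩, hvu.symm⟩
    have h2 : T'.Adj v a := by
      rw [hadj]; left; refine ⟨hva, ?_⟩
      intro heq
      simp only [Sym2.eq_iff] at heq
      rcases heq with ⟨h, _⟩ | ⟨h, _⟩
      · exact hva.ne h
      · exact hbv h.symm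
    have hba : T'.Reachable b a := hq'.trans (h1.reachable.trans h2.reachable)
    have key : ∀ x y, T.Adj x y → T'.Reachable x y := by
      intro x y hxy
      by_cases he : s(x, y) = s(a, b)
      · simp only [Sym2.eq_iff] at he
        rcases he with ⟨rfl, rfl⟩ | ⟨rfl, rfl⟩
        · exact hba.symm
        · exact hba
      · exact SimpleGraph.Adj.reachable ((hadj x y).2 (Or.inl ⟨hxy, he⟩))
    have := hT.connected.nonempty
    refine ⟨fun x y => ?_⟩
    obtain ⟨w⟩ := hT.connected x y
    induction w with
    | nil => exact SimpleGraph.Reachable.refl _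
    | cons h _ ih => exact (key _ _ h).trans ih
  · have hc := (SimpleGraph.isTree_iff_connected_and_card.1 hT).2
    have hE : T'.edgeSet = insert s(v, u) (T.edgeSet \ {s(a, b)}) := by
      ext e
      induction e with
      | h x y =>
        simp only [SimpleGraph.mem_edgeSet, hadj, Set.mem_insert_iff, Set.mem_sdiff, ne_eq,
          Set.mem_singleton_iff, Sym2.eq_iff]
        constructor
        · rintro (h | ⟨h, _⟩)
          · exact Or.inr h
          · exact Or.inl h
        · rintro (h | h)
          · right; refine ⟨h, ?_⟩
            rintro rfl
            rcases h with ⟨rfl, h⟩ | ⟨rfl, h⟩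
            · exact hvu h
            · exact hvu h.symm
          · exact Or.inl h
    rw [← hc, hE, Nat.card_coe_set_eq, Nat.card_coe_set_eq, Set.ncard_exchange]
    · simpa using hnadj
    · simpa using hab

theorem exchange [Fintype V] (G T : SimpleGraph V) (hT : T.IsTree) (hle : T ≤ G) (v u : V)
    (hG : G.Adj v u) (hnadj : ¬ T.Adj v u) (hv : deg T v ≠ 1)
    (hloc : ∀ y, T.Adj v y → deg T y = 2 ∧ ∀ z, T.Adj y z → z ≠ v → deg T z = 2) :
    ∃ T' ≤ G, T'.IsTree ∧ (leavesOf T).card < (leavesOf T').card := by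
  obtain ⟨w, hw, -⟩ := hT.existsUnique_path v u
  have hvu := hG.ne
  cases w with
  | nil => exact absurd rfl hvu
  | @cons _ a _ hva w =>
  cases w with
  | nil => exact absurd hva hnadj
  | @cons _ b _ hab q =>
  have hq : a ∉ q.support := by
    have := hw.of_cons
    rw [SimpleGraph.Walk.cons_isPath_iff] at this
    exact this.2
  have hbv : b ≠ v := by
    rintro rfl
    rw [SimpleGraph.Walk.cons_isPath_iff] at hw
    apply hw.2
    simp
  have htree := exchange_tree T hT v u a b hvu hnadj hva hab q hq hbv
  have hau : a ≠ u := by rintro rfl; exact hnadj hva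
  obtain ⟨ha2, hb2⟩ := hloc a hva
  replace hb2 := hb2 b hab hbv
  refine ⟨_, ?_, htree, ?_⟩
  · refine sup_le ((SimpleGraph.deleteEdges_le _).trans hle) ?_
    exact (SimpleGraph.edge_le_iff G).2 (Or.inr hG)
  set T' := T.deleteEdges {s(a, b)} ⊔ SimpleGraph.edge v u with hT'
  have hadj : ∀ x y, T'.Adj x y ↔ (T.Adj x y ∧ ¬ (x = a ∧ y = b ∨ x = b ∧ y = a)) ∨
      ((x = v ∧ y = u ∨ x = u ∧ y = v) ∧ x ≠ y) := by
    intro x y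
    simp [hT', SimpleGraph.edge_adj]
  have hother : ∀ x, x ≠ v → x ≠ u → x ≠ a → x ≠ b → deg T' x = deg T x := by
    intro x h1 h2 h3 h4
    unfold deg
    congr 1
    ext y
    simp [hadj, h1, h2, h3, h4]
  have hda : deg T' a = 1 := by
    have : deg T' a = deg T a - 1 := by
      unfold deg
      rw [← Finset.card_erase_of_mem (a := b) (by simpa using hab)]
      congr 1
      ext y
      have := hab.ne
      have := hva.ne'
      simp only [hadj, Finset.mem_filter, Finset.mem_univ, true_and, Finset.mem_erase]
      tauto
    omega
  have hdb : b ≠ u → deg T' b = 1 := by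
    intro hbu
    have : deg T' b = deg T b - 1 := by
      unfold deg
      rw [← Finset.card_erase_of_mem (a := a) (by simpa using hab.symm)]
      congr 1
      ext y
      have := hab.ne'
      simp only [hadj, Finset.mem_filter, Finset.mem_univ, true_and, Finset.mem_erase]
      tauto
    omega
  by_cases hbu : b = u
  · have hsub : insert a (leavesOf T) ⊆ leavesOf T' := by
      intro x hx
      simp only [leavesOf, Finset.mem_insert, Finset.mem_filter, Finset.mem_univ, true_and] at hx ⊢
      rcases hx with rfl | hx
      · exact hda
      · rw [hother x]
        · exact hx
        · rintro rfl; exact hv hx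
        · rintro rfl; rw [← hbu] at hx; omega
        · rintro rfl; omega
        · rintro rfl; omega
    have := Finset.card_le_card hsub
    rw [Finset.card_insert_of_notMem (by simp [leavesOf, ha2])] at this
    omega
  · have hsub : insert a (insert b ((leavesOf T).erase u)) ⊆ leavesOf T' := by
      intro x hx
      simp only [leavesOf, Finset.mem_insert, Finset.mem_erase, Finset.mem_filter,
        Finset.mem_univ, true_and] at hx ⊢
      rcases hx with rfl | rfl | ⟨hxu, hx⟩
      · exact hda
      · exact hdb hbu
      · rw [hother x]
        · exact hx
        · rintro rfl; exact hv hx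
        · exact hxu
        · rintro rfl; omega
        · rintro rfl; omega
    have := Finset.card_le_card hsub
    rw [Finset.card_insert_of_notMem (by simp [leavesOf, ha2, hab.ne]),
      Finset.card_insert_of_notMem (by simp [leavesOf, hb2])] at this
    have := Finset.pred_card_le_card_erase (s := leavesOf T) (a := u)
    omega

theorem parent_unique (T : SimpleGraph V) (hT : T.IsTree) (r a b w : V)
    (ha : T.Adj a w) (hb : T.Adj b w) (hda : T.dist r w = T.dist r a + 1)
    (hdb : T.dist r w = T.dist r b + 1) : a = b := by
  obtain ⟨p, hp⟩ := hT.connected.exists_walk_length_eq_dist r a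
  obtain ⟨q, hq⟩ := hT.connected.exists_walk_length_eq_dist r b
  have h1 : (p.concat ha).IsPath := SimpleGraph.Walk.isPath_of_length_eq_dist _ (by
    rw [SimpleGraph.Walk.length_concat]; omega)
  have h2 : (q.concat hb).IsPath := SimpleGraph.Walk.isPath_of_length_eq_dist _ (by
    rw [SimpleGraph.Walk.length_concat]; omega)
  have h3 := (hT.existsUnique_path r w).unique h1 h2
  have := congrArg SimpleGraph.Walk.penultimate h3
  simpa using this

theorem nbrs_two [Fintype V] (T : SimpleGraph V) (v a b : V) (h : deg T v = 2) (hab : a ≠ b)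
    (ha : T.Adj v a) (hb : T.Adj v b) : ∀ y, T.Adj v y → y = a ∨ y = b := by
  intro y hy
  have hsub : ({a, b} : Finset V) ⊆ Finset.univ.filter (fun u => T.Adj v u) := by
    intro x hx
    simp only [Finset.mem_insert, Finset.mem_singleton] at hx
    rcases hx with rfl | rfl <;> simpa
  have := Finset.eq_of_subset_of_card_le hsub (by
    unfold deg at h
    rw [h, Finset.card_pair hab])
  have hy' : y ∈ ({a, b} : Finset V) := by rw [this]; simpa
  simpa using hy'

/-- There are fewer than twice as many vertices of degree `≠ 2` as leaves. -/
theorem bad_count [Fintype V] (T : SimpleGraph V) (hT : T.IsTree) (hn : 2 ≤ Fintype.card V) :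
    (Finset.univ.filter (fun x => deg T x ≠ 2)).card + 2 ≤ 2 * (leavesOf T).card := by
  have hsum := T.sum_degrees_eq_twice_card_edges
  have hcard := hT.card_edgeFinset
  have : Nontrivial V := Fintype.one_lt_card_iff_nontrivial.1 hn
  have hpos : ∀ x, 1 ≤ deg T x := by
    intro x
    rw [deg_eq_degree]
    exact hT.connected.preconnected.degree_pos_of_nontrivial x
  have hkey : ∀ x, 2 + (if deg T x ≠ 2 then 1 else 0) ≤ deg T x + 2 * (if deg T x = 1 then 1 else 0) := by
    intro x
    have := hpos x
    split_ifs <;> omega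
  have := Finset.sum_le_sum (fun x (_ : x ∈ Finset.univ) => hkey x)
  rw [Finset.sum_add_distrib, Finset.sum_add_distrib, ← Finset.mul_sum,
    ← Finset.card_filter, ← Finset.card_filter] at this
  simp only [Finset.sum_const, Finset.card_univ, smul_eq_mul, deg_eq_degree] at this
  simp only [leavesOf, deg_eq_degree]
  rw [hsum] at this
  omega

theorem chain_exists [Fintype V] (T : SimpleGraph V) (hT : T.IsTree) (k : ℕ)
    (hk : (Finset.univ.filter (fun x => deg T x ≠ 2)).card * (k + 1) < Fintype.card V) :
    ∃ f : ℕ → V, (∀ i ≤ k, deg T (f i) = 2) ∧ (∀ i < k, T.Adj (f i) (f (i + 1))) ∧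
      (∀ i ≤ k, ∀ j ≤ k, f i = f j → i = j) := by
  obtain ⟨r⟩ := hT.connected.nonempty
  have hchild : ∀ v, ∃ c, deg T v = 2 → T.Adj v c ∧ T.dist r c = T.dist r v + 1 := by
    intro v
    by_cases hv : deg T v = 2
    · have hv' := hv
      unfold deg at hv'
      obtain ⟨a, b, hab, hs⟩ := Finset.card_eq_two.1 hv'
      have ha : T.Adj v a := by
        have : a ∈ Finset.univ.filter (fun u => T.Adj v u) := by rw [hs]; simp
        simpa using this
      have hb : T.Adj v b := by
        have : b ∈ Finset.univ.filter (fun u => T.Adj v u) := by rw [hs]; simp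
        simpa using this
      rcases hT.dist_eq_dist_add_one_of_adj r ha with h1 | h1
      · rcases hT.dist_eq_dist_add_one_of_adj r hb with h2 | h2
        · exact absurd (parent_unique T hT r a b v ha.symm hb.symm h1 h2) hab
        · exact ⟨b, fun _ => ⟨hb, h2⟩⟩
      · exact ⟨a, fun _ => ⟨ha, h1⟩⟩
    · exact ⟨v, fun h => absurd h hv⟩
  choose c hc using hchild
  have hpar : ∀ w, ∃ a, ∀ v, T.Adj v w → T.dist r w = T.dist r v + 1 → v = a := by
    intro w
    by_cases hw : ∃ v, T.Adj v w ∧ T.dist r w = T.dist r v + 1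
    · obtain ⟨v, h1, h2⟩ := hw
      exact ⟨v, fun v' h3 h4 => parent_unique T hT r v' v w h3 h1 h4 h2⟩
    · push Not at hw
      exact ⟨w, fun v h1 h2 => absurd h2 (hw v h1)⟩
  choose pr hpr using hpar
  by_cases hex : ∃ v, ∀ i ≤ k, deg T (c^[i] v) = 2
  · obtain ⟨v, hv⟩ := hex
    have hd : ∀ i ≤ k, T.dist r (c^[i] v) = T.dist r v + i := by
      intro i
      induction i with
      | zero => simp
      | succ i ih =>
        intro hi
        rw [Function.iterate_succ_apply', (hc _ (hv i (by omega))).2, ih (by omega)]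
        omega
    refine ⟨fun i => c^[i] v, hv, ?_, ?_⟩
    · intro i hi
      simp only [Function.iterate_succ_apply']
      exact (hc _ (hv i (by omega))).1
    · intro i hi j hj hij
      have h1 := hd i hi
      have h2 := hd j hj
      simp only at hij
      rw [hij] at h1
      omega
  · exfalso
    push Not at hex
    have hback : ∀ v i, (∀ j < i, deg T (c^[j] v) = 2) → pr^[i] (c^[i] v) = v := by
      intro v i
      induction i with
      | zero => simp
      | succ i ih =>
        intro hi
        have h1 := hc _ (hi i (by omega))
        rw [Function.iterate_succ_apply' c, Function.iterate_succ_apply pr, ← hpr _ _ h1.1 h1.2]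
        exact ih (fun j hj => hi j (by omega))
    have hsurj : (Finset.univ : Finset V) ⊆
        ((Finset.univ.filter (fun x => deg T x ≠ 2)) ×ˢ Finset.range (k + 1)).image
          (fun z => pr^[z.2] z.1) := by
      intro v _
      have hv := hex v
      have hfind := Nat.find_spec hv
      have hmin : ∀ j < Nat.find hv, deg T (c^[j] v) = 2 := by
        intro j hj
        have := Nat.find_min hv hj
        push Not at this
        exact this (by omega)
      rw [Finset.mem_image]
      refine ⟨(c^[Nat.find hv] v, Nat.find hv), ?_, hback v _ hmin⟩
      simp only [Finset.mem_product, Finset.mem_filter, Finset.mem_univ, true_and,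
        Finset.mem_range]
      exact ⟨hfind.2, by omega⟩
    have := (Finset.card_le_card hsurj).trans Finset.card_image_le
    rw [Finset.card_product, Finset.card_range, Finset.card_univ] at this
    omega

theorem walk_of_fun (G : SimpleGraph V) (k : ℕ) (g : ℕ → V)
    (h : ∀ i < k, G.Adj (g i) (g (i + 1))) :
    ∃ Q : G.Walk (g 0) (g k), Q.length = k ∧ Q.support = (List.range (k + 1)).map g := by
  induction k with
  | zero => exact ⟨SimpleGraph.Walk.nil, by simp, by simp⟩
  | succ k ih =>
    obtain ⟨Q, h1, h2⟩ := ih (fun i hi => h i (by omega))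
    refine ⟨Q.concat (h k (by omega)), by simp [h1], ?_⟩
    rw [SimpleGraph.Walk.support_concat, h2, List.range_succ (n := k + 1)]
    simp

/-- A connected `n`-vertex graph with `n/(2L) ≥ p + 5` contains either a
spanning tree with at least `L` leaves, or a simple path of length at least `p` all of
whose vertices have degree exactly 2 in the graph. -/
theorem stmt11 [Fintype V] (G : SimpleGraph V) (hconn : G.Connected)
    (L p : ℕ) (hL : 1 ≤ L) (hp : 1 ≤ p)
    (h : ((p : ℝ) + 5) ≤ (Fintype.card V : ℝ) / (2 * L)) :
    (∃ H : G.Subgraph, H.verts = Set.univ ∧ H.coe.IsTree ∧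
      L ≤ {v : V | (H.neighborSet v).ncard = 1}.ncard) ∨
    (∃ (u v : V) (Q : G.Walk u v), Q.IsPath ∧ p ≤ Q.length ∧
      ∀ x ∈ Q.support, deg G x = 2) := by
  by_contra hcon
  push Not at hcon
  obtain ⟨hnoT, hnoP⟩ := hcon
  have hcardN : 2 * L * (p + 5) ≤ Fintype.card V := by
    have hL' : (0 : ℝ) < 2 * L := by positivity
    rw [le_div_iff₀ hL'] at h
    have : ((2 * L * (p + 5) : ℕ) : ℝ) ≤ (Fintype.card V : ℝ) := by
      push_cast
      linarith
    exact_mod_cast this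
  have hleaf : ∀ T : SimpleGraph V, T ≤ G → T.IsTree → (leavesOf T).card < L := by
    intro T hle hT
    let H : G.Subgraph :=
      { verts := Set.univ
        Adj := T.Adj
        adj_sub := fun h => hle h
        edge_vert := fun _ => Set.mem_univ _
        symm := T.symm }
    have hspan : H.IsSpanning := fun x => Set.mem_univ x
    have hHT : H.spanningCoe = T := by ext x y; rfl
    have htree : H.coe.IsTree := by
      rw [← (H.spanningCoeEquivCoeOfSpanning hspan).isTree_iff, hHT]
      exact hT
    have := hnoT H rfl htree
    refine lt_of_eq_of_lt ?_ this
    rw [← Set.ncard_coe_finset]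
    congr 1
    ext x
    simp only [leavesOf, Finset.coe_filter, Finset.mem_univ, true_and, Set.mem_setOf_eq]
    have : H.neighborSet x = ((Finset.univ.filter (fun u => T.Adj x u) : Finset V) : Set V) := by
      ext y
      simp [H, SimpleGraph.Subgraph.mem_neighborSet]
    rw [this, Set.ncard_coe_finset]
    rfl
  obtain ⟨T₀, hT₀le, hT₀⟩ := hconn.exists_isTree_le
  obtain ⟨T, hTmem, hmax⟩ := Finset.exists_max_image
    (Finset.univ.filter (fun T : SimpleGraph V => T ≤ G ∧ T.IsTree))
    (fun T => (leavesOf T).card) ⟨T₀, by simp [hT₀le, hT₀]⟩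
  simp only [Finset.mem_filter, Finset.mem_univ, true_and] at hTmem hmax
  obtain ⟨hle, hT⟩ := hTmem
  have hl := hleaf T hle hT
  have hbad := bad_count T hT (by nlinarith)
  obtain ⟨f, hf2, hfadj, hfinj⟩ := chain_exists T hT (p + 4) (by nlinarith)
  have hdeg : ∀ i ≤ p, deg G (f (i + 2)) = 2 := by
    intro i hi
    by_contra hne
    have hnb : ∀ j, j + 2 ≤ p + 4 → ∀ y, T.Adj (f (j + 1)) y → y = f j ∨ y = f (j + 2) := by
      intro j hj
      refine nbrs_two T _ _ _ (hf2 _ (by omega)) ?_ (hfadj j (by omega)).symm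
        (hfadj (j + 1) (by omega))
      intro h
      have := hfinj _ (by omega) _ (by omega) h
      omega
    have hex : ∃ u, G.Adj (f (i + 2)) u ∧ ¬ T.Adj (f (i + 2)) u := by
      by_contra hno
      push Not at hno
      apply hne
      refine Eq.trans ?_ (hf2 (i + 2) (by omega))
      unfold deg
      congr 1
      ext y
      simp only [Finset.mem_filter, Finset.mem_univ, true_and]
      exact ⟨hno y, fun h => hle h⟩
    obtain ⟨u, hu1, hu2⟩ := hex
    obtain ⟨T', h1, h2, h3⟩ := exchange G T hT hle (f (i + 2)) u hu1 hu2
      (by rw [hf2 _ (by omega)]; omega) (by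
        intro y hy
        rcases hnb (i + 1) (by omega) y hy with rfl | rfl
        · refine ⟨hf2 _ (by omega), fun z hz hzv => ?_⟩
          rcases hnb i (by omega) z hz with rfl | rfl
          · exact hf2 _ (by omega)
          · exact hf2 _ (by omega)
        · refine ⟨hf2 _ (by omega), fun z hz hzv => ?_⟩
          rcases hnb (i + 2) (by omega) z hz with rfl | rfl
          · exact hf2 _ (by omega)
          · exact hf2 _ (by omega))
    have := hmax T' ⟨h1, h2⟩
    omega
  obtain ⟨Q, hQ1, hQ2⟩ := walk_of_fun G p (fun i => f (i + 2))
    (fun i hi => hle (hfadj (i + 2) (by omega)))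
  obtain ⟨x, hx, hx2⟩ := hnoP _ _ Q (by
    rw [SimpleGraph.Walk.isPath_def, hQ2]
    refine List.Nodup.map_on ?_ List.nodup_range
    intro a ha b hb hab
    rw [List.mem_range] at ha hb
    have := hfinj _ (by omega) _ (by omega) hab
    omega) hQ1.ge
  rw [hQ2, List.mem_map] at hx
  obtain ⟨i, hi, rfl⟩ := hx
  rw [List.mem_range] at hi
  exact hx2 (hdeg i (by omega))
end
end
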